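/- arXiv:1201.2778 — 2 statements merged into one kernel-verified Lean document; each statement's English description precedes it below -/
import Mathlib

section
/- Let m ≥ 4 and let γ : ℝ → ℝ^m be a C^∞ curve of finite type at 0 with γ'(0) = 0, γ''(0) ≠ 0, dim span{γ''(0), γ'''(0)} = 2, dim span{γ''(0), γ'''(0), γ⁽⁴⁾(0)} = 3, and dim span{γ''(0), γ'''(0), γ⁽⁴⁾(0), γ⁽⁵⁾(0)} = 4 (i.e. γ has type (2,3,4,5,a₅,…,a_m) at 0), and let δ : ℝ → ℝ^m be a C^∞ map with γ'(t) = t·δ(t) for all t. Then the tangent map-germ Tan(γ)(s,t) = γ(t) + s·δ(t) at (0,0) is diffeomorphic (right–left equivalent) to the open swallowtail map-germ (u,x) ↦ (u, x³ + ux, (3/4)x⁴ + (1/2)ux², (3/5)x⁵ + (1/3)ux³, 0, …, 0) : (ℝ², 0) → (ℝ^m, 0). -/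
open Filter Topology

/-- Two map-germs `f` at `a` and `g` at `b` are diffeomorphic (right-left equivalent):
there are germs of `C^∞` diffeomorphisms `σ : (E, a) → (E, b)` and
`τ : (F, f a) → (F, g b)` with `g ∘ σ = τ ∘ f` as germs at `a`. -/
def GermEquiv {E F : Type*} [NormedAddCommGroup E] [NormedSpace ℝ E]
    [NormedAddCommGroup F] [NormedSpace ℝ F]
    (f : E → F) (a : E) (g : E → F) (b : E) : Prop :=
  ∃ σ σinv : E → E, ∃ τ τinv : F → F,
    σ a = b ∧ τ (f a) = g b ∧
    ContDiffAt ℝ (⊤ : ℕ∞) σ a ∧ ContDiffAt ℝ (⊤ : ℕ∞) σinv b ∧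
    ContDiffAt ℝ (⊤ : ℕ∞) τ (f a) ∧ ContDiffAt ℝ (⊤ : ℕ∞) τinv (g b) ∧
    (∀ᶠ x in 𝓝 a, σinv (σ x) = x) ∧ (∀ᶠ y in 𝓝 b, σ (σinv y) = y) ∧
    (∀ᶠ z in 𝓝 (f a), τinv (τ z) = z) ∧ (∀ᶠ w in 𝓝 (g b), τ (τinv w) = w) ∧
    (∀ᶠ x in 𝓝 a, g (σ x) = τ (f x))

namespace OST
open scoped ContDiff
open Function MeasureTheory

lemma temp_of_bdd {f : ℝ → ℝ} (hf : ContDiff ℝ ∞ f) (R : ℝ)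
    (h : ∀ n : ℕ, ∃ C : ℝ, ∀ x, R < |x| → ‖iteratedDeriv n f x‖ ≤ C) : f.HasTemperateGrowth := by
  refine ⟨hf, fun n => ?_⟩
  obtain ⟨C, hC⟩ := h n
  have hc : Continuous (iteratedDeriv n f) := hf.continuous_iteratedDeriv n (mod_cast le_top)
  obtain ⟨C', hC'⟩ := (isCompact_Icc (a := -R) (b := R)).exists_bound_of_continuousOn hc.continuousOn
  refine ⟨0, max C C', fun x => ?_⟩
  rw [norm_iteratedFDeriv_eq_norm_iteratedDeriv, pow_zero, mul_one]
  by_cases hx : R < |x|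
  · exact (hC x hx).trans (le_max_left _ _)
  · exact (hC' x (by rw [Set.mem_Icc, ← abs_le]; linarith)).trans (le_max_right _ _)

lemma temp_fst {E F : Type*} [NormedAddCommGroup E] [NormedSpace ℝ E]
    [NormedAddCommGroup F] [NormedSpace ℝ F] :
    Function.HasTemperateGrowth (fun p : E × F => p.1) :=
  (ContinuousLinearMap.fst ℝ E F).hasTemperateGrowth

lemma temp_snd {E F : Type*} [NormedAddCommGroup E] [NormedSpace ℝ E]
    [NormedAddCommGroup F] [NormedSpace ℝ F] :
    Function.HasTemperateGrowth (fun p : E × F => p.2) :=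
  (ContinuousLinearMap.snd ℝ E F).hasTemperateGrowth

lemma temp_prodMk {D E F : Type*} [NormedAddCommGroup D] [NormedSpace ℝ D]
    [NormedAddCommGroup E] [NormedSpace ℝ E]
    [NormedAddCommGroup F] [NormedSpace ℝ F] {f : D → E} {g : D → F}
    (hf : f.HasTemperateGrowth) (hg : g.HasTemperateGrowth) :
    Function.HasTemperateGrowth (fun x => (f x, g x)) := by
  have h1 := (ContinuousLinearMap.inl ℝ E F).hasTemperateGrowth.comp hf
  have h2 := (ContinuousLinearMap.inr ℝ E F).hasTemperateGrowth.comp hg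
  convert h1.add h2 using 1
  ext x <;> simp

lemma temp_comp {D E F : Type*} [NormedAddCommGroup D] [NormedSpace ℝ D]
    [NormedAddCommGroup E] [NormedSpace ℝ E]
    [NormedAddCommGroup F] [NormedSpace ℝ F] {f : E → F} {g : D → E}
    (hf : f.HasTemperateGrowth) (hg : g.HasTemperateGrowth) :
    Function.HasTemperateGrowth (fun x => f (g x)) := hf.comp hg

lemma temp_fderiv {E F : Type*} [NormedAddCommGroup E] [NormedSpace ℝ E]
    [NormedAddCommGroup F] [NormedSpace ℝ F] {f : E → F}
    (hf : f.HasTemperateGrowth) : Function.HasTemperateGrowth (fderiv ℝ f) := by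
  refine ⟨hf.1.fderiv_right (m := ∞) (by simp), fun n => ?_⟩
  obtain ⟨k, C, h⟩ := hf.2 (n+1)
  exact ⟨k, C, fun x => by rw [norm_iteratedFDeriv_fderiv]; exact h x⟩

lemma temp_smoothTransition : Function.HasTemperateGrowth Real.smoothTransition := by
  refine temp_of_bdd Real.smoothTransition.contDiff 1 (fun n => ⟨1, fun x hx => ?_⟩)
  rcases lt_abs.1 hx with h | h
  · have : Real.smoothTransition =ᶠ[𝓝 x] fun _ => (1:ℝ) := by
      filter_upwards [lt_mem_nhds h] with y hy using Real.smoothTransition.one_of_one_le hy.le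
    rw [(this.iteratedDeriv_eq n), iteratedDeriv_const]
    split_ifs <;> simp
  · have : Real.smoothTransition =ᶠ[𝓝 x] fun _ => (0:ℝ) := by
      filter_upwards [gt_mem_nhds (show x < 0 by linarith)] with y hy using
        Real.smoothTransition.zero_of_nonpos hy.le
    rw [(this.iteratedDeriv_eq n), iteratedDeriv_const]
    split_ifs <;> simp

/-- smooth function equal to `1/m` for `m ≥ 1`. -/
noncomputable def psi (m : ℝ) : ℝ := Real.smoothTransition (2 * m - 1) * m⁻¹

lemma psi_eq {m : ℝ} (hm : 1 ≤ m) : psi m = m⁻¹ := by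
  rw [psi, Real.smoothTransition.one_of_one_le (by linarith), one_mul]

lemma temp_psi : Function.HasTemperateGrowth psi := by
  have hs : ContDiff ℝ ∞ psi := by
    rw [contDiff_iff_contDiffAt]
    intro x
    by_cases hx : x < 1/2
    · have : psi =ᶠ[𝓝 x] fun _ => (0:ℝ) := by
        filter_upwards [gt_mem_nhds hx] with y hy
        rw [psi, Real.smoothTransition.zero_of_nonpos (by linarith), zero_mul]
      exact contDiffAt_const.congr_of_eventuallyEq this
    · have hx0 : x ≠ 0 := by linarith
      have : ContDiffAt ℝ ∞ (fun m : ℝ => Real.smoothTransition (2 * m - 1)) x :=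
        (Real.smoothTransition.contDiff.comp (by fun_prop : ContDiff ℝ ∞ fun m : ℝ => 2 * m - 1)).contDiffAt
      exact this.mul (contDiffAt_inv ℝ hx0)
  refine temp_of_bdd hs 1 (fun n => ⟨n.factorial, fun x hx => ?_⟩)
  rcases lt_abs.1 hx with h | h
  · have : psi =ᶠ[𝓝 x] fun y => y⁻¹ := by
      filter_upwards [lt_mem_nhds h] with y hy using psi_eq hy.le
    rw [(this.iteratedDeriv_eq n), iteratedDeriv_eq_iterate, iter_deriv_inv]
    have h1 : |x ^ (-1 - (n:ℤ))| ≤ 1 := by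
      rw [abs_zpow, show (-1 - (n:ℤ)) = -((n+1 : ℕ):ℤ) by push_cast; ring, zpow_neg, zpow_natCast]
      exact inv_le_one_of_one_le₀ (one_le_pow₀ hx.le)
    simp only [norm_mul, Real.norm_eq_abs, abs_pow, abs_neg, abs_one, one_pow, one_mul, Nat.abs_cast]
    nlinarith [(Nat.cast_nonneg n.factorial : (0:ℝ) ≤ n.factorial)]
  · have : psi =ᶠ[𝓝 x] fun _ => (0:ℝ) := by
      filter_upwards [gt_mem_nhds (show x < 0 by linarith)] with y hy
      rw [psi, Real.smoothTransition.zero_of_nonpos (by linarith), zero_mul]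
    rw [(this.iteratedDeriv_eq n), iteratedDeriv_const]
    split_ifs <;> simp

lemma temp_integral_aux {V E : Type} [NormedAddCommGroup V] [NormedSpace ℝ V]
    [NormedAddCommGroup E] [NormedSpace ℝ E] [SecondCountableTopology E]
    (ρ : ℝ → V) (hρ : Continuous ρ) (w : ℝ → ℂ) (hw : AEStronglyMeasurable w)
    (hwint : ∀ k : ℕ, Integrable (fun t => (1 + ‖ρ t‖) ^ k * ‖w t‖)) (n : ℕ) :
    ∀ (F : Type) [NormedAddCommGroup F] [NormedSpace ℝ F] [NormedSpace ℂ F]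
      [SMulCommClass ℝ ℂ F]
      [CompleteSpace F]
      (S : V × E → F), S.HasTemperateGrowth →
      ContDiff ℝ n (fun x => ∫ t, w t • S (ρ t, x)) ∧
      ∃ (k : ℕ) (C : ℝ), ∀ x, ‖iteratedFDeriv ℝ n (fun x => ∫ t, w t • S (ρ t, x)) x‖
        ≤ C * (1 + ‖x‖) ^ k := by
  -- basic facts
  have meas : ∀ (F : Type) [NormedAddCommGroup F] [NormedSpace ℝ F] [NormedSpace ℂ F]
      (S : V × E → F), Continuous S → ∀ x, AEStronglyMeasurable (fun t => w t • S (ρ t, x)) := by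
    intro F _ _ _ S hS x
    exact hw.smul (hS.comp (hρ.prodMk continuous_const)).aestronglyMeasurable
  have bd : ∀ (F : Type) [NormedAddCommGroup F] [NormedSpace ℝ F] [NormedSpace ℂ F]
      (S : V × E → F), S.HasTemperateGrowth → ∃ (k : ℕ) (C : ℝ), 0 ≤ C ∧ ∀ t x,
        ‖w t • S (ρ t, x)‖ ≤ C * (1 + ‖x‖) ^ k * ((1 + ‖ρ t‖) ^ k * ‖w t‖) := by
    intro F _ _ _ S hS
    obtain ⟨k, C, hC, h⟩ := hS.norm_iteratedFDeriv_le_uniform 0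
    refine ⟨k, C, hC, fun t x => ?_⟩
    have h1 := h 0 le_rfl (ρ t, x)
    rw [norm_iteratedFDeriv_zero] at h1
    rw [norm_smul]
    have h2 : 1 + ‖(ρ t, x)‖ ≤ (1 + ‖x‖) * (1 + ‖ρ t‖) := by
      rw [Prod.norm_def]
      have := norm_nonneg x
      have := norm_nonneg (ρ t)
      rcases max_choice ‖ρ t‖ ‖x‖ with h | h <;> simp only [h] <;> nlinarith
    have h3 : (1 + ‖(ρ t, x)‖) ^ k ≤ (1 + ‖x‖) ^ k * (1 + ‖ρ t‖) ^ k := by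
      rw [← mul_pow]; gcongr
    calc ‖w t‖ * ‖S (ρ t, x)‖ ≤ ‖w t‖ * (C * ((1 + ‖x‖) ^ k * (1 + ‖ρ t‖) ^ k)) := by
          gcongr; exact h1.trans (by gcongr)
      _ = _ := by ring
  have integ : ∀ (F : Type) [NormedAddCommGroup F] [NormedSpace ℝ F] [NormedSpace ℂ F]
      (S : V × E → F), S.HasTemperateGrowth → ∀ x, Integrable (fun t => w t • S (ρ t, x)) := by
    intro F _ _ _ S hS x
    obtain ⟨k, C, hC, h⟩ := bd F S hS
    exact ((hwint k).const_mul (C * (1 + ‖x‖) ^ k)).mono' (meas F S hS.1.continuous x)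
      (Eventually.of_forall fun t => h t x)
  have bd0 : ∀ (F : Type) [NormedAddCommGroup F] [NormedSpace ℝ F] [NormedSpace ℂ F]
      (S : V × E → F), S.HasTemperateGrowth → ∃ (k : ℕ) (C : ℝ), ∀ x,
        ‖∫ t, w t • S (ρ t, x)‖ ≤ C * (1 + ‖x‖) ^ k := by
    intro F _ _ _ S hS
    obtain ⟨k, C, hC, h⟩ := bd F S hS
    refine ⟨k, C * ∫ t, ((1 + ‖ρ t‖) ^ k * ‖w t‖), fun x => ?_⟩
    refine (norm_integral_le_of_norm_le ((hwint k).const_mul (C * (1 + ‖x‖) ^ k))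
      (Eventually.of_forall fun t => h t x)).trans ?_
    rw [integral_const_mul]
    exact le_of_eq (by ring)
  have key : ∀ (F : Type) [NormedAddCommGroup F] [NormedSpace ℝ F] [NormedSpace ℂ F]
      [SMulCommClass ℝ ℂ F] [CompleteSpace F]
      (S : V × E → F), S.HasTemperateGrowth → ∀ x,
        HasFDerivAt (fun x => ∫ t, w t • S (ρ t, x))
          (∫ t, w t • (fun q => (fderiv ℝ S q).comp (ContinuousLinearMap.inr ℝ V E)) (ρ t, x)) x := by
    intro F _ _ _ _ _ S hS x
    have hS' : Function.HasTemperateGrowth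
        (fun q => (fderiv ℝ S q).comp (ContinuousLinearMap.inr ℝ V E)) :=
      temp_comp (((ContinuousLinearMap.compL ℝ E (V × E) F).flip
        (ContinuousLinearMap.inr ℝ V E)).hasTemperateGrowth) (temp_fderiv hS)
    obtain ⟨k, C, hC, h⟩ := bd _ _ hS'
    refine hasFDerivAt_integral_of_dominated_of_fderiv_le (𝕜 := ℝ)
      (F := fun x t => w t • S (ρ t, x))
      (F' := fun x t => w t •
        (fun q => (fderiv ℝ S q).comp (ContinuousLinearMap.inr ℝ V E)) (ρ t, x))
      (bound := fun t => C * (1 + (‖x‖ + 1)) ^ k * ((1 + ‖ρ t‖) ^ k * ‖w t‖))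
      (Metric.ball_mem_nhds x one_pos) (Eventually.of_forall fun y => meas F S hS.1.continuous y)
      (integ F S hS x) (meas _ _ hS'.1.continuous x) (Eventually.of_forall ?_)
      ((hwint k).const_mul _) (Eventually.of_forall ?_)
    · intro t y hy
      refine (h t y).trans ?_
      have : ‖y‖ ≤ ‖x‖ + 1 := by
        have h1 : ‖y - x‖ < 1 := by simpa [dist_eq_norm] using hy
        have h2 := norm_add_le x (y - x)
        rw [add_sub_cancel] at h2
        linarith
      gcongr
    · intro t y hy
      have h1 : HasFDerivAt (fun y => S (ρ t, y))
          ((fderiv ℝ S (ρ t, y)).comp (ContinuousLinearMap.inr ℝ V E)) y := by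
        have h2 : HasFDerivAt S (fderiv ℝ S (ρ t, y)) (ρ t, y) :=
          (hS.1.differentiable (by simp) _).hasFDerivAt
        exact h2.comp y (hasFDerivAt_prodMk_right (ρ t) y)
      exact h1.const_smul (w t)
  induction n with
  | zero =>
    intro F _ _ _ _ _ S hS
    refine ⟨?_, ?_⟩
    · rw [Nat.cast_zero, contDiff_zero]
      exact continuous_iff_continuousAt.2 fun x => (key F S hS x).continuousAt
    · obtain ⟨k, C, h⟩ := bd0 F S hS
      exact ⟨k, C, fun x => by rw [norm_iteratedFDeriv_zero]; exact h x⟩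
  | succ n ih =>
    intro F _ _ _ _ _ S hS
    have hS' : Function.HasTemperateGrowth
        (fun q => (fderiv ℝ S q).comp (ContinuousLinearMap.inr ℝ V E)) :=
      temp_comp (((ContinuousLinearMap.compL ℝ E (V × E) F).flip
        (ContinuousLinearMap.inr ℝ V E)).hasTemperateGrowth) (temp_fderiv hS)
    have hfd : fderiv ℝ (fun x => ∫ t, w t • S (ρ t, x)) = fun x => ∫ t, w t •
        (fun q => (fderiv ℝ S q).comp (ContinuousLinearMap.inr ℝ V E)) (ρ t, x) := by
      ext1 x; exact (key F S hS x).fderiv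
    obtain ⟨h1, k, C, h2⟩ := ih (E →L[ℝ] F) _ hS'
    refine ⟨?_, k, C, fun x => ?_⟩
    · rw [Nat.cast_succ, contDiff_succ_iff_fderiv]
      refine ⟨fun x => (key F S hS x).differentiableAt, by simp, ?_⟩
      rw [hfd]; exact h1
    · rw [← norm_iteratedFDeriv_fderiv, hfd]; exact h2 x

lemma temp_integral {V E : Type} [NormedAddCommGroup V] [NormedSpace ℝ V]
    [NormedAddCommGroup E] [NormedSpace ℝ E] [SecondCountableTopology E]
    (ρ : ℝ → V) (hρ : Continuous ρ) (w : ℝ → ℂ) (hw : AEStronglyMeasurable w)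
    (hwint : ∀ k : ℕ, Integrable (fun t => (1 + ‖ρ t‖) ^ k * ‖w t‖))
    (S : V × E → ℂ) (hS : S.HasTemperateGrowth) :
    Function.HasTemperateGrowth (fun x => ∫ t, w t * S (ρ t, x)) :=
  ⟨contDiff_infty.2 fun n => (temp_integral_aux ρ hρ w hw hwint n ℂ S hS).1,
    fun n => (temp_integral_aux ρ hρ w hw hwint n ℂ S hS).2⟩

lemma temp_integrable {V E : Type} [NormedAddCommGroup V] [NormedSpace ℝ V]
    [NormedAddCommGroup E] [NormedSpace ℝ E]
    (ρ : ℝ → V) (hρ : Continuous ρ) (w : ℝ → ℂ) (hw : AEStronglyMeasurable w)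
    (hwint : ∀ k : ℕ, Integrable (fun t => (1 + ‖ρ t‖) ^ k * ‖w t‖))
    (S : V × E → ℂ) (hS : S.HasTemperateGrowth) (x : E) :
    Integrable (fun t => w t * S (ρ t, x)) := by
  obtain ⟨k, C, hC, h⟩ := hS.norm_iteratedFDeriv_le_uniform 0
  refine ((hwint k).const_mul (C * (1 + ‖x‖) ^ k)).mono'
    (hw.mul (hS.1.continuous.comp (hρ.prodMk continuous_const)).aestronglyMeasurable)
      (Eventually.of_forall fun t => ?_)
  have h1 := h 0 le_rfl (ρ t, x)
  rw [norm_iteratedFDeriv_zero] at h1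
  rw [norm_mul]
  have h2 : 1 + ‖(ρ t, x)‖ ≤ (1 + ‖x‖) * (1 + ‖ρ t‖) := by
    rw [Prod.norm_def]
    have := norm_nonneg x
    have := norm_nonneg (ρ t)
    rcases max_choice ‖ρ t‖ ‖x‖ with h | h <;> simp only [h] <;> nlinarith
  have h3 : (1 + ‖(ρ t, x)‖) ^ k ≤ (1 + ‖x‖) ^ k * (1 + ‖ρ t‖) ^ k := by
    rw [← mul_pow]; gcongr
  calc ‖w t‖ * ‖S (ρ t, x)‖ ≤ ‖w t‖ * (C * ((1 + ‖x‖) ^ k * (1 + ‖ρ t‖) ^ k)) := by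
        gcongr; exact h1.trans (by gcongr)
    _ = _ := by ring

end OST

namespace OST
open scoped ContDiff
open Function MeasureTheory

/-- the cutoff polynomial -/
def D2 (U Y : ℝ) : ℝ := 27 * Y ^ 2 - 4 * (4 - U) * (16 - U) ^ 2

lemma pert_bound (T p k A B : ℝ) (hT : 1 ≤ T) (hA : |A| ≤ 513 * T ^ 2) (hB : |B| ≤ 1480 * T ^ 2 + 60 * T ^ 2)
    (hpk : p ^ 2 + k ^ 2 < 1 / (4200000 * T ^ 4)) : |p * A + k * B| < 1 := by
  have hT2 : 0 < T ^ 2 := by positivity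
  have h1 : (p * A + k * B) ^ 2 ≤ (p ^ 2 + k ^ 2) * (A ^ 2 + B ^ 2) := by
    nlinarith [sq_nonneg (p * B - k * A)]
  have hA2 : A ^ 2 ≤ (513 * T ^ 2) ^ 2 := sq_le_sq' (by linarith [neg_abs_le A]) (le_trans (le_abs_self _) hA)
  have hB2 : B ^ 2 ≤ (1540 * T ^ 2) ^ 2 := sq_le_sq' (by linarith [neg_abs_le B]) (by linarith [le_abs_self B])
  have h2 : A ^ 2 + B ^ 2 ≤ 3000000 * T ^ 4 := by nlinarith [sq_nonneg (T^2)]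
  have h3 : (p * A + k * B) ^ 2 < 1 := by
    calc (p * A + k * B) ^ 2 ≤ (p ^ 2 + k ^ 2) * (A ^ 2 + B ^ 2) := h1
      _ ≤ 1 / (4200000 * T ^ 4) * (3000000 * T ^ 4) := by
          gcongr
      _ < 1 := by field_simp; norm_num
  exact (sq_lt_one_iff_abs_lt_one _).1 h3

lemma small_of (T p k : ℝ) (hT : 1 ≤ T) (hpk : p ^ 2 + k ^ 2 < 1 / (4200000 * T ^ 4)) :
    |p| ≤ 1 ∧ |k| ≤ 1 := by
  have h : 1 / (4200000 * T ^ 4) ≤ 1 := by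
    rw [div_le_one (by positivity)]
    nlinarith [one_le_pow₀ hT (n := 4)]
  constructor
  · exact abs_le_one_iff_mul_self_le_one.2 (by nlinarith [sq_nonneg k])
  · exact abs_le_one_iff_mul_self_le_one.2 (by nlinarith [sq_nonneg p])

lemma bound_one (t U Y : ℝ) (h : -2 < D2 U Y) :
    1 / (4200000 * (1 + t ^ 2) ^ 4) ≤
      (t ^ 3 - 3 * t + U * t - Y) ^ 2 + (3 * t ^ 2 - 1 + U) ^ 2 := by
  by_contra! hlt
  set p := t ^ 3 - 3 * t + U * t - Y with hp
  set k := 3 * t ^ 2 - 1 + U with hk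
  set T := 1 + t ^ 2 with hTdef
  have hT : 1 ≤ T := by nlinarith [sq_nonneg t]
  obtain ⟨hp1, hk1⟩ := small_of T p k hT hlt
  rw [abs_le] at hp1 hk1
  have htT : |t| ≤ T := by
    rw [abs_le]; constructor <;> nlinarith [sq_nonneg (t - 1), sq_nonneg (t + 1)]
  rw [abs_le] at htT
  have hT2 : T ≤ T ^ 2 := by nlinarith
  have hD : D2 U Y = -108 * T * (25 + 9 * t ^ 2) + (p * (27 * (4 * t * T + p - 2 * t * k)) +
      k * (27 * (-4 * t ^ 2 * T + t ^ 2 * k) - 4 * (-(15 + 3 * t ^ 2 - k) ^ 2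
        + 3 * T * (-2 * (15 + 3 * t ^ 2) + k)))) := by
    rw [D2, hp, hk, hTdef]; ring
  have hA : |27 * (4 * t * T + p - 2 * t * k)| ≤ 513 * T ^ 2 := by
    have h1 : |t * k| ≤ T := by
      rw [abs_mul]; nlinarith [abs_nonneg t, abs_nonneg k, abs_le.2 htT, abs_le.2 hk1]
    rw [abs_le] at h1
    rw [abs_le]; constructor <;> nlinarith
  have hB : |27 * (-4 * t ^ 2 * T + t ^ 2 * k) - 4 * (-(15 + 3 * t ^ 2 - k) ^ 2
        + 3 * T * (-2 * (15 + 3 * t ^ 2) + k))| ≤ 1480 * T ^ 2 + 60 * T ^ 2 := by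
    have e1 : t ^ 2 = T - 1 := by rw [hTdef]; ring
    have hTk : |T * k| ≤ T := by
      rw [abs_mul, abs_of_pos (by linarith : 0 < T)]
      nlinarith [abs_le.2 hk1]
    rw [abs_le] at hTk
    have hkk : k ^ 2 ≤ 1 := by nlinarith
    rw [e1, abs_le]; constructor <;> nlinarith
  have := pert_bound T p k _ _ hT hA hB hlt
  rw [abs_lt] at this
  nlinarith [sq_nonneg t]

lemma bound_two (t U Y : ℝ) (h : D2 U Y < -1) :
    1 / (4200000 * (1 + t ^ 2) ^ 4) ≤
      (t ^ 3 - 12 * t + U * t - Y) ^ 2 + (3 * t ^ 2 - 4 + U) ^ 2 := by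
  by_contra! hlt
  set p := t ^ 3 - 12 * t + U * t - Y with hp
  set k := 3 * t ^ 2 - 4 + U with hk
  set T := 1 + t ^ 2 with hTdef
  have hT : 1 ≤ T := by nlinarith [sq_nonneg t]
  obtain ⟨hp1, hk1⟩ := small_of T p k hT hlt
  rw [abs_le] at hp1 hk1
  have htT : |t| ≤ T := by
    rw [abs_le]; constructor <;> nlinarith [sq_nonneg (t - 1), sq_nonneg (t + 1)]
  rw [abs_le] at htT
  have hT2 : T ≤ T ^ 2 := by nlinarith
  have hD : D2 U Y = (p * (27 * (2 * t * (8 + 2 * t ^ 2) + p - 2 * t * k)) +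
      k * (27 * (-2 * t ^ 2 * (8 + 2 * t ^ 2) + t ^ 2 * k) - 4 * (-(12 + 3 * t ^ 2 - k) ^ 2
        + 3 * t ^ 2 * (-2 * (12 + 3 * t ^ 2) + k)))) := by
    rw [D2, hp, hk]; ring
  have e1 : t ^ 2 = T - 1 := by rw [hTdef]; ring
  have hA : |27 * (2 * t * (8 + 2 * t ^ 2) + p - 2 * t * k)| ≤ 513 * T ^ 2 := by
    have h1 : |t * k| ≤ T := by
      rw [abs_mul]; nlinarith [abs_nonneg t, abs_nonneg k, abs_le.2 htT, abs_le.2 hk1]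
    have h2 : |t * (8 + 2 * t ^ 2)| ≤ 8 * T ^ 2 := by
      rw [abs_mul, abs_of_nonneg (by positivity : 0 ≤ 8 + 2 * t ^ 2), e1]
      nlinarith [abs_nonneg t, abs_le.2 htT]
    rw [abs_le] at h1 h2
    rw [abs_le]; constructor <;> nlinarith
  have hB : |27 * (-2 * t ^ 2 * (8 + 2 * t ^ 2) + t ^ 2 * k) - 4 * (-(12 + 3 * t ^ 2 - k) ^ 2
        + 3 * t ^ 2 * (-2 * (12 + 3 * t ^ 2) + k))| ≤ 1480 * T ^ 2 + 60 * T ^ 2 := by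
    have hTk : |T * k| ≤ T := by
      rw [abs_mul, abs_of_pos (by linarith : 0 < T)]
      nlinarith [abs_le.2 hk1]
    rw [abs_le] at hTk
    have hkk : k ^ 2 ≤ 1 := by nlinarith
    rw [e1, abs_le]; constructor <;> nlinarith
  have := pert_bound T p k _ _ hT hA hB hlt
  rw [abs_lt] at this
  linarith

lemma large_bound (t c U Y k : ℝ) (hc : c ^ 2 ≤ 4) (ht : 100 * (1 + U ^ 2 + Y ^ 2) ≤ t ^ 2) :
    (1 + t ^ 2) ^ 3 ≤ 2 * ((t ^ 3 - 3 * c ^ 2 * t + U * t - Y) ^ 2 + k ^ 2) := by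
  set a := |t| with ha
  have ha2 : t ^ 2 = a ^ 2 := (sq_abs t).symm
  have ha0 : 0 ≤ a := abs_nonneg t
  rw [ha2] at ht ⊢
  have ha10 : 10 ≤ a := by nlinarith [sq_nonneg U, sq_nonneg Y]
  have hU : |U| ≤ a ^ 2 / 100 := by
    rw [abs_le]; constructor <;> nlinarith [sq_nonneg (U - 1), sq_nonneg (U + 1), sq_nonneg Y]
  have hY : |Y| ≤ a ^ 2 / 100 := by
    rw [abs_le]; constructor <;> nlinarith [sq_nonneg (Y - 1), sq_nonneg (Y + 1), sq_nonneg U]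
  have h1 : |t ^ 3| = a ^ 3 := by rw [abs_pow]
  have h2 : |3 * c ^ 2 * t - U * t + Y| ≤ 12 * a + a ^ 3 / 100 + a ^ 3 / 1000 := by
    calc |3 * c ^ 2 * t - U * t + Y| ≤ |3 * c ^ 2 * t| + |U * t| + |Y| := by
          exact (abs_add_le _ _).trans (by gcongr; exact abs_sub _ _)
      _ ≤ 12 * a + a ^ 3 / 100 + a ^ 3 / 1000 := by
          rw [abs_mul, abs_mul U, abs_of_nonneg (by positivity : 0 ≤ 3 * c ^ 2)]
          have : |U| * a ≤ a ^ 2 / 100 * a := by gcongr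
          have h3 : 3 * c ^ 2 * a ≤ 12 * a := by gcongr; linarith
          have : a ^ 2 / 100 ≤ a ^ 3 / 1000 := by nlinarith [sq_nonneg a]
          rw [← ha]; nlinarith
  have h3 : a ^ 3 * (4/5) ≤ |t ^ 3 - 3 * c ^ 2 * t + U * t - Y| := by
    have := abs_sub_abs_le_abs_sub (t ^ 3) (3 * c ^ 2 * t - U * t + Y)
    rw [show t ^ 3 - (3 * c ^ 2 * t - U * t + Y) = t ^ 3 - 3 * c ^ 2 * t + U * t - Y by ring] at this
    have : 12 * a ≤ 12 * (a ^ 3 / 100) := by nlinarith [mul_nonneg ha0 (by nlinarith : 0 ≤ a^2-100)]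
    nlinarith [pow_nonneg ha0 3]
  have h4 : (a ^ 3 * (4/5)) ^ 2 ≤ (t ^ 3 - 3 * c ^ 2 * t + U * t - Y) ^ 2 := by
    rw [← sq_abs (t ^ 3 - _ + _ - _)]; gcongr
  have h5 : 1 + a ^ 2 ≤ 101/100 * a ^ 2 := by nlinarith
  have h6 : (1 + a ^ 2) ^ 3 ≤ (101/100 * a ^ 2) ^ 3 := by gcongr
  nlinarith [sq_nonneg k, sq_nonneg (a^3)]

/-- the constant in the lower bound -/
def KK : ℝ := 4200000 * 101 ^ 7

lemma lower_bound (t c U Y : ℝ) (hc : c = 1 ∧ -2 < D2 U Y ∨ c = 2 ∧ D2 U Y < -1) :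
    (1 + t ^ 2) ^ 3 ≤ KK * (1 + U ^ 2 + Y ^ 2) ^ 7 *
      ((t ^ 3 - 3 * c ^ 2 * t + U * t - Y) ^ 2 + (c * (3 * t ^ 2 - c ^ 2 + U)) ^ 2) := by
  have hN : 1 ≤ 1 + U ^ 2 + Y ^ 2 := by nlinarith [sq_nonneg U, sq_nonneg Y]
  have hN7 : 1 ≤ (1 + U ^ 2 + Y ^ 2) ^ 7 := one_le_pow₀ hN
  have hK : 2 ≤ KK * (1 + U ^ 2 + Y ^ 2) ^ 7 := by
    have : 2 ≤ KK := by norm_num [KK]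
    nlinarith
  have hc2 : c ^ 2 ≤ 4 := by rcases hc with ⟨rfl, _⟩ | ⟨rfl, _⟩ <;> norm_num
  by_cases ht : 100 * (1 + U ^ 2 + Y ^ 2) ≤ t ^ 2
  · refine (large_bound t c U Y (c * (3 * t ^ 2 - c ^ 2 + U)) hc2 ht).trans ?_
    gcongr
  · push Not at ht
    have hT : 1 + t ^ 2 ≤ 101 * (1 + U ^ 2 + Y ^ 2) := by linarith
    have hT7 : (1 + t ^ 2) ^ 7 ≤ 101 ^ 7 * (1 + U ^ 2 + Y ^ 2) ^ 7 := by
      rw [← mul_pow]; gcongr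
    have hP : 1 / (4200000 * (1 + t ^ 2) ^ 4) ≤
        ((t ^ 3 - 3 * c ^ 2 * t + U * t - Y) ^ 2 + (c * (3 * t ^ 2 - c ^ 2 + U)) ^ 2) := by
      rcases hc with ⟨rfl, h⟩ | ⟨rfl, h⟩
      · refine (bound_one t U Y h).trans (le_of_eq (by ring))
      · refine (bound_two t U Y h).trans ?_
        nlinarith [sq_nonneg (3 * t ^ 2 - 4 + U)]
    calc (1 + t ^ 2) ^ 3 = 4200000 * (1 + t ^ 2) ^ 7 * (1 / (4200000 * (1 + t ^ 2) ^ 4)) := by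
          field_simp
      _ ≤ 4200000 * (101 ^ 7 * (1 + U ^ 2 + Y ^ 2) ^ 7) *
          ((t ^ 3 - 3 * c ^ 2 * t + U * t - Y) ^ 2 + (c * (3 * t ^ 2 - c ^ 2 + U)) ^ 2) := by
          gcongr
      _ = _ := by rw [KK]; ring

end OST

namespace OST
open scoped ContDiff
open Function MeasureTheory

lemma laplace_integrable (c : ℝ) (hc : 0 < c) (r : ℂ) (hr : r.re = c) (n : ℕ) :
    IntegrableOn (fun s : ℝ => (s : ℂ) ^ n * Complex.exp (-(r * s))) (Set.Ioi 0) := by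
  have h := Real.GammaIntegral_convergent (s := n + 1) (by positivity)
  have h2 : IntegrableOn (fun s : ℝ => s ^ (n : ℝ) * Real.exp (-c * s)) (Set.Ioi 0) :=
    integrableOn_rpow_mul_exp_neg_mul_rpow (p := 1) (s := n) (b := c)
      (lt_of_lt_of_le (by norm_num) (Nat.cast_nonneg n)) one_pos hc |>.congr_fun
        (fun x _ => by simp) measurableSet_Ioi
  refine h2.mono' ?_ ?_
  · exact (Continuous.aestronglyMeasurable (by fun_prop))
  · refine (ae_restrict_iff' measurableSet_Ioi).2 (Eventually.of_forall fun s hs => ?_)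
    rw [norm_mul, norm_pow, Complex.norm_real, Complex.norm_exp, Real.norm_eq_abs,
      abs_of_pos hs, Real.rpow_natCast]
    simp [hr]

lemma laplace (c : ℝ) (hc : 0 < c) (r : ℂ) (hr : r.re = c) (n : ℕ) :
    ∫ s in Set.Ioi (0:ℝ), (s : ℂ) ^ n * Complex.exp (-(r * s)) = n.factorial / r ^ (n + 1) := by
  have hr0 : r ≠ 0 := by rintro rfl; simp at hr; linarith
  have tend : ∀ n : ℕ, Tendsto (fun s : ℝ => -(1 / r) * ((s : ℂ) ^ n * Complex.exp (-(r * s))))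
      atTop (𝓝 0) := by
    intro n
    rw [← mul_zero (-(1/r))]
    refine Tendsto.const_mul _ ?_
    rw [tendsto_zero_iff_norm_tendsto_zero]
    have h := (Real.tendsto_pow_mul_exp_neg_atTop_nhds_zero n).comp
      (tendsto_id.const_mul_atTop hc)
    have h' := h.const_mul ((c ^ n)⁻¹)
    rw [mul_zero] at h'
    refine h'.congr' ?_
    filter_upwards [eventually_gt_atTop 0] with s hs
    rw [norm_mul, norm_pow, Complex.norm_real, Complex.norm_exp, Real.norm_eq_abs, abs_of_pos hs]
    simp [hr, mul_pow]
    field_simp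
  have der : ∀ (n : ℕ) (s : ℝ), HasDerivAt
      (fun s : ℝ => -(1 / r) * ((s : ℂ) ^ n * Complex.exp (-(r * s))))
      ((s : ℂ) ^ n * Complex.exp (-(r * s)) -
        (n / r) * ((s : ℂ) ^ (n-1) * Complex.exp (-(r * s)))) s := by
    intro n s
    have h1 : HasDerivAt (fun s : ℂ => -(1 / r) * (s ^ n * Complex.exp (-(r * s))))
      (-(1/r) * ((n * (s:ℂ) ^ (n-1)) * Complex.exp (-(r * s)) +
        (s : ℂ) ^ n * (Complex.exp (-(r * s)) * -(r * 1)))) (s : ℂ) :=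
      ((hasDerivAt_pow n (s:ℂ)).mul (((hasDerivAt_id (s:ℂ)).const_mul r).neg.cexp)).const_mul _
    convert h1.comp_ofReal using 1
    field_simp
    ring
  induction n with
  | zero =>
    have := integral_Ioi_of_hasDerivAt_of_tendsto' (a := 0) (fun s _ => der 0 s) ?_ (tend 0)
    · simpa using this
    · have := laplace_integrable c hc r hr 0
      simpa using this
  | succ n ih =>
    have I1 := laplace_integrable c hc r hr (n + 1)
    have I2 := (laplace_integrable c hc r hr n).const_mul (((n+1 : ℕ) : ℂ) / r)
    have := integral_Ioi_of_hasDerivAt_of_tendsto' (a := 0) (fun s _ => der (n+1) s)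
      (I1.sub I2) (tend (n+1))
    rw [integral_sub I1 (by simpa using I2)] at this
    simp only [Nat.add_sub_cancel] at this
    rw [integral_const_mul, ih] at this
    simp only [Complex.ofReal_zero, ne_eq, Nat.add_eq_zero_iff, one_ne_zero, and_false,
      not_false_eq_true, zero_pow, zero_mul, mul_zero, sub_zero] at this
    rw [sub_eq_zero.1 this, Nat.factorial_succ]
    push_cast
    field_simp
    ring

lemma norm_pow_inv_le (c : ℝ) (hc : 1 ≤ c) (τ : ℝ) (n : ℕ) :
    ‖((c + Complex.I * τ) ^ (n + 2))⁻¹‖ ≤ (1 + τ ^ 2)⁻¹ := by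
  have h1 : ‖(c : ℂ) + Complex.I * τ‖ ^ 2 = c ^ 2 + τ ^ 2 := by
    rw [← Complex.normSq_eq_norm_sq, Complex.normSq_apply]; simp; ring
  have h2 : 1 ≤ ‖(c : ℂ) + Complex.I * τ‖ := by
    have : (1:ℝ) ^ 2 ≤ ‖(c : ℂ) + Complex.I * τ‖ ^ 2 := by rw [h1]; nlinarith [sq_nonneg τ]
    exact le_of_sq_le_sq this (norm_nonneg _)
  rw [norm_inv, norm_pow]
  gcongr
  calc 1 + τ ^ 2 ≤ ‖(c : ℂ) + Complex.I * τ‖ ^ 2 := by rw [h1]; nlinarith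
    _ ≤ _ := pow_le_pow_right₀ h2 (by omega)

lemma ne_zero_aux (c : ℝ) (hc : 1 ≤ c) (τ : ℝ) : (c + Complex.I * τ : ℂ) ≠ 0 := by
  intro h
  have := congrArg Complex.re h
  simp at this; linarith

lemma cont_aux (c : ℝ) (hc : 1 ≤ c) (n : ℕ) :
    Continuous fun τ : ℝ => ((c + Complex.I * τ : ℂ) ^ n)⁻¹ :=
  Continuous.inv₀ (by fun_prop) (fun τ => pow_ne_zero _ (ne_zero_aux c hc τ))

lemma integrable_aux (c : ℝ) (hc : 1 ≤ c) (n : ℕ) :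
    Integrable fun τ : ℝ => ((c + Complex.I * τ : ℂ) ^ (n + 2))⁻¹ :=
  integrable_inv_one_add_sq.mono' (cont_aux c hc _).aestronglyMeasurable
    (Eventually.of_forall fun τ => norm_pow_inv_le c hc τ n)

lemma fourier_aux (c : ℝ) (hc : 1 ≤ c) (n : ℕ) :
    ∫ τ : ℝ, Complex.exp (Complex.I * τ) * ((c + Complex.I * τ : ℂ) ^ (n + 2))⁻¹ =
      2 * Real.pi * Complex.exp (-c) / (n + 1).factorial := by
  set φ : ℝ → ℂ := fun s => ((max s 0 : ℝ) : ℂ) ^ (n + 1) * Complex.exp (-(c * s)) with hφ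
  have hφ0 : ∀ s, s ∉ Set.Ioi (0:ℝ) → φ s = 0 := by
    intro s hs
    simp only [Set.mem_Ioi, not_lt] at hs
    simp [hφ, max_eq_right hs]
  have hφc : Continuous φ := by fun_prop
  have hφi : Integrable φ := by
    have h1 : IntegrableOn φ (Set.Ioi 0) := by
      refine (laplace_integrable c (by linarith) c (by simp) (n+1)).congr_fun (fun s hs => ?_)
        measurableSet_Ioi
      simp only [hφ, max_eq_left (Set.mem_Ioi.1 hs).le]
    refine (integrableOn_iff_integrable_of_support_subset (s := Set.Ioi 0) ?_).1 h1
    intro s hs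
    by_contra h
    exact hs (hφ0 s h)
  have hF : FourierTransform.fourier φ = fun ξ : ℝ =>
      ((n + 1).factorial : ℂ) * ((c + Complex.I * ((2 * Real.pi * ξ : ℝ) : ℂ)) ^ (n + 2))⁻¹ := by
    ext ξ
    rw [Real.fourier_real_eq_integral_exp_smul,
      ← setIntegral_eq_integral_of_forall_compl_eq_zero (s := Set.Ioi 0)
        (fun s hs => by rw [hφ0 s hs, smul_zero])]
    have := laplace c (by linarith) (c + Complex.I * ((2 * Real.pi * ξ : ℝ) : ℂ)) (by simp) (n+1)
    rw [← div_eq_mul_inv, ← this]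
    refine setIntegral_congr_fun measurableSet_Ioi (fun s hs => ?_)
    simp only [hφ, max_eq_left (Set.mem_Ioi.1 hs).le, smul_eq_mul]
    rw [mul_left_comm, ← Complex.exp_add]
    congr 2
    push_cast; ring
  have hFi : Integrable (FourierTransform.fourier φ) := by
    rw [hF]
    exact ((integrable_aux c hc n).comp_mul_left' (R := 2 * Real.pi) (by positivity)).const_mul _
  have inv := congrFun (hφc.fourierInv_fourier_eq hφi hFi) 1
  rw [Real.fourierInv_eq' , hF] at inv
  have e : ∫ v : ℝ, Complex.exp (↑(2 * Real.pi * inner ℝ v 1) * Complex.I) •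
      (((n + 1).factorial : ℂ) * ((c + Complex.I * ((2 * Real.pi * v : ℝ) : ℂ)) ^ (n + 2))⁻¹) =
      ((n + 1).factorial : ℂ) * ∫ v : ℝ, (fun τ : ℝ => Complex.exp (Complex.I * τ) *
        ((c + Complex.I * τ : ℂ) ^ (n + 2))⁻¹) (2 * Real.pi * v) := by
    rw [← integral_const_mul]
    congr 1; ext v
    simp only [smul_eq_mul]
    rw [mul_left_comm]
    congr 3
    simp; ring
  rw [e, Measure.integral_comp_mul_left (fun τ : ℝ => Complex.exp (Complex.I * τ) *
        ((c + Complex.I * τ : ℂ) ^ (n + 2))⁻¹) (2 * Real.pi)] at inv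
  have hpi : (Real.pi : ℂ) ≠ 0 := by exact_mod_cast Real.pi_ne_zero
  have hf : ((n + 1).factorial : ℂ) ≠ 0 := by exact_mod_cast Nat.factorial_ne_zero _
  simp only [hφ, abs_of_pos (inv_pos.2 Real.two_pi_pos)] at inv
  rw [Complex.real_smul] at inv
  simp at inv
  field_simp at inv ⊢
  rw [mul_comm]
  linear_combination inv

lemma integrable_shift (c : ℝ) (hc : 1 ≤ c) (n : ℕ) (X : ℝ) :
    Integrable fun t : ℝ => Complex.exp (Complex.I * t) *
      ((c + Complex.I * (t - X : ℝ) : ℂ) ^ (n + 2))⁻¹ := by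
  refine (((integrable_aux c hc n).comp_sub_right X).norm).mono' ?_ ?_
  · exact (Continuous.mul (by fun_prop)
      ((cont_aux c hc (n+2)).comp (continuous_id.sub continuous_const))).aestronglyMeasurable
  · refine Eventually.of_forall fun t => ?_
    rw [norm_mul, mul_comm Complex.I, Complex.norm_exp_ofReal_mul_I, one_mul]

lemma fourier_shift (c : ℝ) (hc : 1 ≤ c) (n : ℕ) (X : ℝ) :
    ∫ t : ℝ, Complex.exp (Complex.I * t) * ((c + Complex.I * (t - X : ℝ) : ℂ) ^ (n + 2))⁻¹ =
      2 * Real.pi * Complex.exp (-c) / (n + 1).factorial * Complex.exp (Complex.I * X) := by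
  rw [← fourier_aux c hc n, ← integral_mul_const,
    ← integral_sub_right_eq_self (fun τ : ℝ => Complex.exp (Complex.I * τ) *
      ((c + Complex.I * τ : ℂ) ^ (n + 2))⁻¹ * Complex.exp (Complex.I * X)) X]
  congr 1; ext t
  have : Complex.exp (Complex.I * t) =
      Complex.exp (Complex.I * (t - X : ℝ)) * Complex.exp (Complex.I * X) := by
    rw [← Complex.exp_add]; congr 1; push_cast; ring
  rw [this]; ring

end OST

namespace OST
open scoped ContDiff
open Function MeasureTheory

section temp
variable {D E F : Type*} [NormedAddCommGroup D] [NormedSpace ℝ D]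
    [NormedAddCommGroup E] [NormedSpace ℝ E]
    [NormedAddCommGroup F] [NormedSpace ℝ F]

lemma temp_fst' {f : D → E × F} (hf : f.HasTemperateGrowth) :
    Function.HasTemperateGrowth (fun x => (f x).1) := temp_comp temp_fst hf

lemma temp_snd' {f : D → E × F} (hf : f.HasTemperateGrowth) :
    Function.HasTemperateGrowth (fun x => (f x).2) := temp_comp temp_snd hf

lemma temp_ofReal {f : D → ℝ} (hf : f.HasTemperateGrowth) :
    Function.HasTemperateGrowth (fun x => ((f x : ℝ) : ℂ)) :=
  temp_comp Complex.hasTemperateGrowth_ofReal hf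

lemma temp_psi' {f : D → ℝ} (hf : f.HasTemperateGrowth) :
    Function.HasTemperateGrowth (fun x => psi (f x)) := temp_comp temp_psi hf

lemma temp_st' {f : D → ℝ} (hf : f.HasTemperateGrowth) :
    Function.HasTemperateGrowth (fun x => Real.smoothTransition (f x)) :=
  temp_comp temp_smoothTransition hf

attribute [fun_prop] temp_fst' temp_snd' temp_ofReal temp_psi' temp_st' temp_prodMk

end temp

/-- real part of the homogenized cubic -/
def Pre (c : ℝ) (p : (ℝ × ℝ) × (ℝ × ℝ)) : ℝ :=
  p.1.1 ^ 3 - 3 * p.1.1 * c ^ 2 * p.1.2 ^ 2 + p.2.1 * p.1.1 * p.1.2 ^ 2 - p.2.2 * p.1.2 ^ 3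

/-- imaginary part of the homogenized cubic -/
def Pim (c : ℝ) (p : (ℝ × ℝ) × (ℝ × ℝ)) : ℝ :=
  -3 * p.1.1 ^ 2 * c * p.1.2 + c ^ 3 * p.1.2 ^ 3 - p.2.1 * c * p.1.2 ^ 3

/-- the size bound -/
def Mt (p : (ℝ × ℝ) × (ℝ × ℝ)) : ℝ := KK * (1 + p.2.1 ^ 2 + p.2.2 ^ 2) ^ 7

/-- regularized inverse of the cubic -/
noncomputable def invP (c : ℝ) (p : (ℝ × ℝ) × (ℝ × ℝ)) : ℂ :=
  ((Pre c p : ℂ) - Complex.I * (Pim c p : ℂ)) *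
    ((Mt p * psi (Mt p * (Pre c p ^ 2 + Pim c p ^ 2)) : ℝ) : ℂ)

/-- the rotated variable -/
noncomputable def zet (c : ℝ) (p : (ℝ × ℝ) × (ℝ × ℝ)) : ℂ := (p.1.1 : ℂ) - Complex.I * c * p.1.2

/-- first numerator -/
def alp (z U Y : ℂ) : ℂ := z^10+5*z^8*U+10*z^6*U^2+10*z^4*U^3+60*z^4*Y^2+5*z^2*U^4
  +40*z^2*U*Y^2+20*z*Y^3+U^5+12*U^2*Y^2
/-- second numerator -/
def bet (z U Y : ℂ) : ℂ := 20*z^6-60*z^4*U+80*z^3*Y-20*z^2*U^2-4*U^3+8*Y^2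
/-- third numerator -/
def gam (z U Y : ℂ) : ℂ := 60*z^5+75*z^2*Y+15*U*Y

lemma num_identity (z U X : ℂ) :
    alp z U (X^3+U*X) + bet z U (X^3+U*X) * (3/4*X^4+1/2*U*X^2)
      + gam z U (X^3+U*X) * (3/5*X^5+1/3*U*X^3) =
    (z^2+z*X+X^2+U)^4 * (U+3*X^2-2*(z-X)*X+(z-X)^2) := by
  unfold alp bet gam; ring

lemma temp_Mt : Function.HasTemperateGrowth Mt := by
  unfold Mt; fun_prop

lemma temp_Pre (c : ℝ) : Function.HasTemperateGrowth (Pre c) := by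
  unfold Pre; fun_prop

lemma temp_Pim (c : ℝ) : Function.HasTemperateGrowth (Pim c) := by
  unfold Pim; fun_prop

lemma temp_zet (c : ℝ) : Function.HasTemperateGrowth (zet c) := by
  unfold zet; fun_prop

lemma temp_invP (c : ℝ) : Function.HasTemperateGrowth (invP c) := by
  have h1 := temp_Mt
  have h2 := temp_Pre c
  have h3 := temp_Pim c
  unfold invP; fun_prop

/-- scaling parameter -/
noncomputable def qq (t : ℝ) : ℝ := (Real.sqrt (1 + t ^ 2))⁻¹

lemma qq_pos (t : ℝ) : 0 < qq t := by unfold qq; positivity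

lemma qq_sq (t : ℝ) : qq t ^ 2 = (1 + t ^ 2)⁻¹ := by
  unfold qq; rw [inv_pow, Real.sq_sqrt (by positivity)]

lemma qq_le (t : ℝ) : qq t ≤ 1 := by
  unfold qq
  apply inv_le_one_of_one_le₀
  rw [Real.one_le_sqrt]; nlinarith [sq_nonneg t]

/-- parameter curve -/
noncomputable def rho (t : ℝ) : ℝ × ℝ := (t * qq t, qq t)

lemma cont_qq : Continuous qq := by
  unfold qq
  exact Continuous.inv₀ (by fun_prop) (fun t => by positivity)

lemma cont_rho : Continuous rho := by
  have := cont_qq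
  unfold rho; fun_prop

lemma norm_rho (t : ℝ) : ‖rho t‖ ≤ 1 := by
  have h1 := qq_pos t
  have h2 := qq_sq t
  have h3 : (t * qq t) ^ 2 ≤ 1 := by
    rw [mul_pow, h2, ← div_eq_mul_inv, div_le_one (by positivity)]; linarith
  refine max_le ?_ ?_
  · exact (sq_le_one_iff_abs_le_one _).1 h3
  · show |qq t| ≤ 1
    rw [abs_of_pos h1]; exact qq_le t

/-- weight -/
noncomputable def wt (t : ℝ) : ℂ := Complex.exp (Complex.I * t) * ((qq t ^ 2 : ℝ) : ℂ)

lemma cont_wt : Continuous wt := by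
  have := cont_qq
  unfold wt; fun_prop

lemma int_wt (k : ℕ) : Integrable (fun t => (1 + ‖rho t‖) ^ k * ‖wt t‖) := by
  have hr := cont_rho
  have hw := cont_wt
  refine (integrable_inv_one_add_sq.const_mul (2 ^ k)).mono'
    (Continuous.aestronglyMeasurable (by fun_prop)) (Eventually.of_forall fun t => ?_)
  have h1 : ‖wt t‖ = (1 + t ^ 2)⁻¹ := by
    rw [wt, norm_mul, mul_comm Complex.I, Complex.norm_exp_ofReal_mul_I, one_mul,
      Complex.norm_real, qq_sq, Real.norm_of_nonneg (by positivity)]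
  rw [h1, norm_mul, norm_pow, Real.norm_of_nonneg (by positivity : 0 ≤ 1 + ‖rho t‖),
    Real.norm_of_nonneg (by positivity : 0 ≤ (1 + t ^ 2)⁻¹)]
  gcongr
  linarith [norm_rho t]

lemma invP_eq (t c U Y : ℝ) (hc : c = 1 ∧ -2 < D2 U Y ∨ c = 2 ∧ D2 U Y < -1) :
    invP c (rho t, (U, Y)) * ((qq t : ℂ) ^ 3 * ((t - Complex.I * c) ^ 3 + U * (t - Complex.I * c) - Y)) = 1 := by
  have hlb := lower_bound t c U Y hc
  set q := qq t with hq
  have hq0 : 0 < q := qq_pos t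
  have hq2 : q ^ 2 * (1 + t ^ 2) = 1 := by rw [qq_sq]; field_simp
  set A := t ^ 3 - 3 * c ^ 2 * t + U * t - Y with hA
  set B := c * (3 * t ^ 2 - c ^ 2 + U) with hB
  have e1 : Pre c (rho t, (U, Y)) = q ^ 3 * A := by
    simp only [Pre, rho, ← hq]; ring
  have e2 : Pim c (rho t, (U, Y)) = - (q ^ 3 * B) := by
    simp only [Pim, rho, ← hq]; ring
  have e3 : ((t - Complex.I * c) ^ 3 + U * (t - Complex.I * c) - Y : ℂ) = (A : ℂ) - Complex.I * B := by
    rw [hA, hB]; push_cast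
    linear_combination (3 * t * c ^ 2 - Complex.I * c ^ 3 : ℂ) * Complex.I_sq
  have h1 : 1 ≤ Mt (rho t, (U, Y)) * (Pre c (rho t, (U, Y)) ^ 2 + Pim c (rho t, (U, Y)) ^ 2) := by
    rw [e1, e2, Mt]
    have := mul_le_mul_of_nonneg_left hlb (by positivity : 0 ≤ q ^ 6)
    have e : q ^ 6 * (1 + t ^ 2) ^ 3 = 1 := by
      rw [show q ^ 6 * (1 + t ^ 2) ^ 3 = (q ^ 2 * (1 + t ^ 2)) ^ 3 by ring, hq2, one_pow]
    rw [e] at this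
    refine this.trans (le_of_eq ?_)
    ring
  rw [e3, invP, psi_eq h1, e1, e2]
  rw [e1, e2] at h1
  have hM : Mt (rho t, (U, Y)) ≠ 0 := by rintro h; rw [h] at h1; linarith
  have hN : (q ^ 3 * A) ^ 2 + (-(q ^ 3 * B)) ^ 2 ≠ 0 := by
    rintro h; rw [h] at h1; linarith
  rw [mul_inv, mul_inv_cancel_left₀ hM]
  have hN' : ((q ^ 3 * A) ^ 2 + (-(q ^ 3 * B)) ^ 2 : ℂ) ≠ 0 := by exact_mod_cast hN
  push_cast
  rw [mul_assoc, inv_mul_eq_div, ← mul_div_assoc, div_eq_one_iff_eq hN']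
  linear_combination (-(q:ℂ) ^ 6 * (B:ℂ) ^ 2) * Complex.I_sq

lemma pole_eq (t c U X : ℝ) (h1c : 1 ≤ c)
    (hc : c = 1 ∧ -2 < D2 U (X^3+U*X) ∨ c = 2 ∧ D2 U (X^3+U*X) < -1) :
    wt t * (alp (zet c (rho t, (U, X^3+U*X))) (((rho t).2 : ℂ)^2 * U) (((rho t).2:ℂ)^3 * (X^3+U*X)) *
        invP c (rho t, (U, X^3+U*X)) ^ 4)
      + wt t * (bet (zet c (rho t, (U, X^3+U*X))) (((rho t).2 : ℂ)^2 * U) (((rho t).2:ℂ)^3 * (X^3+U*X)) *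
        ((rho t).2:ℂ)^4 * invP c (rho t, (U, X^3+U*X)) ^ 4) * (3/4*X^4+1/2*U*X^2)
      + wt t * (gam (zet c (rho t, (U, X^3+U*X))) (((rho t).2 : ℂ)^2 * U) (((rho t).2:ℂ)^3 * (X^3+U*X)) *
        ((rho t).2:ℂ)^5 * invP c (rho t, (U, X^3+U*X)) ^ 4) * (3/5*X^5+1/3*U*X^3)
    = (U + 3*X^2 : ℂ) * (Complex.exp (Complex.I * t) * ((c + Complex.I * (t - X : ℝ) : ℂ) ^ (2 + 2))⁻¹)
      + 2 * Complex.I * X * (Complex.exp (Complex.I * t) * ((c + Complex.I * (t - X : ℝ) : ℂ) ^ (1 + 2))⁻¹)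
      - (Complex.exp (Complex.I * t) * ((c + Complex.I * (t - X : ℝ) : ℂ) ^ (0 + 2))⁻¹) := by
  have hinv := invP_eq t c U (X^3+U*X) hc
  generalize invP c (rho t, (U, X^3+U*X)) = ip at *
  have hv : (c + Complex.I * (t - X : ℝ) : ℂ) = Complex.I * ((t - Complex.I * c) - X) := by
    push_cast; linear_combination (c:ℂ) * Complex.I_sq
  have hv0 := ne_zero_aux c h1c (t - X)
  rw [hv] at hv0 ⊢
  have hz : zet c (rho t, (U, X^3+U*X)) = qq t * (t - Complex.I * c) := by
    simp [zet, rho]; ring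
  rw [hz]
  simp only [rho, wt]
  set q : ℂ := (qq t : ℂ) with hq
  have hq0 : q ≠ 0 := by rw [hq]; exact_mod_cast (qq_pos t).ne'
  push_cast
  push_cast at hinv
  rw [← hq]
  set z : ℂ := t - Complex.I * c with hzdef
  have hw0 : z - X ≠ 0 := right_ne_zero_of_mul hv0
  have id := num_identity z U X
  have ha : alp (q * z) (q ^ 2 * U) (q ^ 3 * (X ^ 3 + U * X)) = q ^ 10 * alp z U (X ^ 3 + U * X) := by
    unfold alp; ring
  have hb : bet (q * z) (q ^ 2 * U) (q ^ 3 * (X ^ 3 + U * X)) = q ^ 6 * bet z U (X ^ 3 + U * X) := by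
    unfold bet; ring
  have hg : gam (q * z) (q ^ 2 * U) (q ^ 3 * (X ^ 3 + U * X)) = q ^ 5 * gam z U (X ^ 3 + U * X) := by
    unfold gam; ring
  rw [ha, hb, hg]
  have hQ : z ^ 3 + U * z - (X ^ 3 + U * X) = (z - X) * (z^2+z*X+X^2+U) := by ring
  rw [hQ] at hinv
  have hip : q ^ 12 * (ip ^ 4 * (z^2+z*X+X^2+U) ^ 4) = ((z - X) ^ 4)⁻¹ := by
    apply eq_inv_of_mul_eq_one_left
    calc _ = (ip * (q ^ 3 * ((z - X) * (z^2+z*X+X^2+U)))) ^ 4 := by ring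
      _ = 1 := by rw [hinv, one_pow]
  have e1 : ((Complex.I * (z - X)) ^ 4)⁻¹ = ((z - X) ^ 4)⁻¹ := by
    rw [mul_pow, Complex.I_pow_four, one_mul]
  have e2 : ((Complex.I * (z - X)) ^ 3)⁻¹ = Complex.I * ((z - X) ^ 4)⁻¹ * (z - X) := by
    rw [mul_pow, Complex.I_pow_three]
    field_simp
    simp
  have e3 : ((Complex.I * (z - X)) ^ 2)⁻¹ = - ((z - X) ^ 4)⁻¹ * (z - X) ^ 2 := by
    rw [mul_pow, Complex.I_sq]
    field_simp
  rw [e1, e2, e3, ← hip]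
  linear_combination (Complex.exp (Complex.I * t) * q ^ 12 * ip ^ 4) * id
   - Complex.exp (Complex.I * t) * (2 * X * (q ^ 12 * (ip ^ 4 * (z^2+z*X+X^2+U) ^ 4)) * (z - X)) * Complex.I_sq

/-- The model exponential -/
noncomputable def HH (U X : ℝ) : ℂ :=
  Complex.exp (Complex.I * X) * (U + 3 * X ^ 2 + 6 * Complex.I * X - 6)

lemma piece (c : ℝ) (h1c : 1 ≤ c) (χ : ℝ × ℝ → ℝ) (hχt : χ.HasTemperateGrowth)
    (hχ : ∀ U Y, χ (U, Y) ≠ 0 → (c = 1 ∧ -2 < D2 U Y ∨ c = 2 ∧ D2 U Y < -1)) :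
    ∃ a b g : ℝ × ℝ → ℂ, a.HasTemperateGrowth ∧ b.HasTemperateGrowth ∧ g.HasTemperateGrowth ∧
      ∀ U X : ℝ, a (U, X^3+U*X) + b (U, X^3+U*X) * (3/4*X^4+1/2*U*X^2)
        + g (U, X^3+U*X) * (3/5*X^5+1/3*U*X^3) = χ (U, X^3+U*X) * HH U X := by
  have t1 := temp_zet c
  have t2 := temp_invP c
  let Sa : (ℝ × ℝ) × (ℝ × ℝ) → ℂ := fun p =>
    alp (zet c p) ((p.1.2 : ℂ)^2 * p.2.1) ((p.1.2 : ℂ)^3 * p.2.2) * invP c p ^ 4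
  let Sb : (ℝ × ℝ) × (ℝ × ℝ) → ℂ := fun p =>
    bet (zet c p) ((p.1.2 : ℂ)^2 * p.2.1) ((p.1.2 : ℂ)^3 * p.2.2) * (p.1.2 : ℂ)^4 * invP c p ^ 4
  let Sg : (ℝ × ℝ) × (ℝ × ℝ) → ℂ := fun p =>
    gam (zet c p) ((p.1.2 : ℂ)^2 * p.2.1) ((p.1.2 : ℂ)^3 * p.2.2) * (p.1.2 : ℂ)^5 * invP c p ^ 4
  have ta : Sa.HasTemperateGrowth := by
    simp only [Sa, alp]; fun_prop
  have tb : Sb.HasTemperateGrowth := by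
    simp only [Sb, bet]; fun_prop
  have tg : Sg.HasTemperateGrowth := by
    simp only [Sg, gam]; fun_prop
  have ia := fun x => temp_integrable rho cont_rho wt cont_wt.aestronglyMeasurable int_wt Sa ta x
  have ib := fun x => temp_integrable rho cont_rho wt cont_wt.aestronglyMeasurable int_wt Sb tb x
  have ig := fun x => temp_integrable rho cont_rho wt cont_wt.aestronglyMeasurable int_wt Sg tg x
  have Ta := temp_integral rho cont_rho wt cont_wt.aestronglyMeasurable int_wt Sa ta
  have Tb := temp_integral rho cont_rho wt cont_wt.aestronglyMeasurable int_wt Sb tb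
  have Tg := temp_integral rho cont_rho wt cont_wt.aestronglyMeasurable int_wt Sg tg
  refine ⟨fun x => (χ x : ℂ) * (3 / Real.pi * Complex.exp c) * ∫ t, wt t * Sa (rho t, x),
    fun x => (χ x : ℂ) * (3 / Real.pi * Complex.exp c) * ∫ t, wt t * Sb (rho t, x),
    fun x => (χ x : ℂ) * (3 / Real.pi * Complex.exp c) * ∫ t, wt t * Sg (rho t, x),
    by fun_prop, by fun_prop, by fun_prop, ?_⟩
  intro U X
  by_cases h0 : χ (U, X^3+U*X) = 0
  · simp [h0]
  have hc := hχ _ _ h0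
  have I1 : (∫ t, wt t * Sa (rho t, (U, X^3+U*X))) +
      (∫ t, wt t * Sb (rho t, (U, X^3+U*X))) * (3/4*X^4+1/2*U*X^2)
        + (∫ t, wt t * Sg (rho t, (U, X^3+U*X))) * (3/5*X^5+1/3*U*X^3) =
      (U + 3*X^2 : ℂ) * (2 * Real.pi * Complex.exp (-c) / (2 + 1).factorial * Complex.exp (Complex.I * X))
      + 2 * Complex.I * X * (2 * Real.pi * Complex.exp (-c) / (1 + 1).factorial * Complex.exp (Complex.I * X))
      - (2 * Real.pi * Complex.exp (-c) / (0 + 1).factorial * Complex.exp (Complex.I * X)) := by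
    have J1 : Integrable (fun t => wt t * Sa (rho t, (U, X^3+U*X)) +
        wt t * Sb (rho t, (U, X^3+U*X)) * (3/4*X^4+1/2*U*X^2)) := (ia _).add ((ib _).mul_const _)
    have J2 : Integrable (fun t : ℝ => (U + 3*X^2 : ℂ) *
        (Complex.exp (Complex.I * t) * ((c + Complex.I * (t - X : ℝ) : ℂ) ^ (2 + 2))⁻¹)
      + 2 * Complex.I * X * (Complex.exp (Complex.I * t) *
        ((c + Complex.I * (t - X : ℝ) : ℂ) ^ (1 + 2))⁻¹)) :=
      ((integrable_shift c h1c 2 X).const_mul _).add ((integrable_shift c h1c 1 X).const_mul _)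
    rw [← integral_mul_const, ← integral_mul_const, ← integral_add (ia _) ((ib _).mul_const _),
      ← integral_add J1 ((ig _).mul_const _)]
    rw [← fourier_shift c h1c 2, ← fourier_shift c h1c 1, ← fourier_shift c h1c 0,
      ← integral_const_mul, ← integral_const_mul,
      ← integral_add ((integrable_shift c h1c 2 X).const_mul _) ((integrable_shift c h1c 1 X).const_mul _),
      ← integral_sub J2 (integrable_shift c h1c 0 X)]
    congr 1; ext t
    have := pole_eq t c U X h1c hc
    simp only [Sa, Sb, Sg]
    rw [← this]
    push_cast
    ring
  have hpi : (Real.pi : ℂ) ≠ 0 := by exact_mod_cast Real.pi_ne_zero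
  have hexp : Complex.exp c * Complex.exp (-c) = 1 := by rw [← Complex.exp_add]; simp
  have e : ((χ (U, X^3+U*X) : ℂ) * (3 / Real.pi * Complex.exp c)) * ((∫ t, wt t * Sa (rho t, (U, X^3+U*X))) +
      (∫ t, wt t * Sb (rho t, (U, X^3+U*X))) * (3/4*X^4+1/2*U*X^2)
        + (∫ t, wt t * Sg (rho t, (U, X^3+U*X))) * (3/5*X^5+1/3*U*X^3)) = 
      (χ (U, X^3+U*X) : ℂ) * HH U X := by
    rw [I1, HH]
    generalize χ (U, X^3+U*X) = k
    simp only [Nat.factorial]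
    push_cast
    field_simp
    linear_combination (k : ℂ) * 6 *
      (U + 3 * X ^ 2 + 6 * Complex.I * X - 6) * hexp
  rw [← e]; ring

theorem theoremB :
    ∃ a b g : ℝ × ℝ → ℂ, a.HasTemperateGrowth ∧ b.HasTemperateGrowth ∧ g.HasTemperateGrowth ∧
      ∀ U X : ℝ, a (U, X^3+U*X) + b (U, X^3+U*X) * (3/4*X^4+1/2*U*X^2)
        + g (U, X^3+U*X) * (3/5*X^5+1/3*U*X^3) = HH U X := by
  have hD : Function.HasTemperateGrowth (fun x : ℝ × ℝ => D2 x.1 x.2) := by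
    unfold D2; fun_prop
  obtain ⟨a, b, g, ha, hb, hg, h⟩ := piece 1 le_rfl
    (fun x => Real.smoothTransition (D2 x.1 x.2 + 2)) (by fun_prop) (by
      intro U Y h
      refine Or.inl ⟨rfl, ?_⟩
      by_contra h'
      exact h (Real.smoothTransition.zero_of_nonpos (by simp only; linarith)))
  obtain ⟨a', b', g', ha', hb', hg', h'⟩ := piece 2 (by norm_num)
    (fun x => 1 - Real.smoothTransition (D2 x.1 x.2 + 2)) (by fun_prop) (by
      intro U Y h
      refine Or.inr ⟨rfl, ?_⟩
      by_contra h'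
      exact h (by simp only; rw [Real.smoothTransition.one_of_one_le (by linarith), sub_self]))
  refine ⟨fun x => a x + a' x, fun x => b x + b' x, fun x => g x + g' x, ha.add ha', hb.add hb',
    hg.add hg', fun U X => ?_⟩
  have h1 := h U X
  have h2 := h' U X
  push_cast at h1 h2
  linear_combination h1 + h2

end OST

namespace OST
open scoped ContDiff
open Function MeasureTheory

lemma int_schwartz (f : SchwartzMap ℝ ℂ) (k : ℕ) :
    Integrable (fun t : ℝ => (1 + ‖(id t : ℝ)‖) ^ k * ‖f t‖) := by
  have h0 := f.integrable_pow_mul volume 0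
  have hk := f.integrable_pow_mul volume k
  refine ((h0.add hk).const_mul (2 ^ (k - 1))).mono' ?_ (Eventually.of_forall fun t => ?_)
  · have := f.continuous
    exact Continuous.aestronglyMeasurable (by fun_prop)
  · rw [Real.norm_of_nonneg (by positivity)]
    have := add_pow_le zero_le_one (norm_nonneg t) k
    rw [one_pow] at this
    simp only [id, pow_zero, Pi.add_apply]
    calc _ ≤ (2 ^ (k-1) * (1 + ‖t‖ ^ k)) * ‖f t‖ := by gcongr
      _ = _ := by ring

lemma fourier_deriv_schwartz (f : SchwartzMap ℝ ℂ) (ξ : ℝ) :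
    FourierTransform.fourier (SchwartzMap.derivCLM ℂ ℂ f) ξ =
      2 * Real.pi * Complex.I * ξ * FourierTransform.fourier f ξ := by
  have := congrFun (Real.fourier_deriv f.integrable f.differentiable
    ((SchwartzMap.derivCLM ℂ ℂ f).integrable)) ξ
  rw [SchwartzMap.fourier_coe, SchwartzMap.fourier_coe]
  exact this

lemma inversion (f : SchwartzMap ℝ ℂ) (x : ℝ) :
    f x = ∫ ξ : ℝ, FourierTransform.fourier f ξ *
      Complex.exp (Complex.I * ((2 * Real.pi * ξ * x : ℝ) : ℂ)) := by
  have h := f.continuous.fourierInv_fourier_eq f.integrable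
    (by have := (FourierTransform.fourier f).integrable (μ := volume)
        rw [SchwartzMap.fourier_coe] at this; exact this)
  have h := congrFun h x
  rw [Real.fourierInv_eq'] at h
  rw [← h]
  congr 1; ext ξ
  rw [smul_eq_mul, mul_comm, SchwartzMap.fourier_coe]
  congr 2
  simp; ring

lemma schwartz_mul_integrable (f : SchwartzMap ℝ ℂ) (x : ℝ) (g : ℝ → ℂ)
    (hg : g.HasTemperateGrowth) :
    Integrable (fun ξ : ℝ => f ξ * (g ξ *
      Complex.exp (Complex.I * ((2 * Real.pi * ξ * x : ℝ) : ℂ)))) := by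
  have h := temp_integrable (V := ℝ) (E := ℝ) id continuous_id f f.continuous.aestronglyMeasurable
    (int_schwartz f) (fun p => g p.1) (temp_comp hg temp_fst) 0
  have hgc := hg.1.continuous
  have hfc := f.continuous
  refine h.norm.mono' (Continuous.aestronglyMeasurable (by fun_prop))
    (Eventually.of_forall fun ξ => ?_)
  rw [norm_mul, norm_mul, mul_comm Complex.I, Complex.norm_exp_ofReal_mul_I, mul_one, norm_mul]
  rfl

theorem theoremA_schwartz (J : SchwartzMap ℝ ℂ) :
    ∃ a b g : ℝ × ℝ → ℂ, ContDiff ℝ ∞ a ∧ ContDiff ℝ ∞ b ∧ ContDiff ℝ ∞ g ∧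
      ∀ u x : ℝ, (u + 3 * x ^ 2) * deriv (deriv J) x - 6 * x * deriv J x + 6 * J x =
        a (u, x^3+u*x) + b (u, x^3+u*x) * (3/4*x^4+1/2*u*x^2)
        + g (u, x^3+u*x) * (3/5*x^5+1/3*u*x^3) := by
  obtain ⟨a, b, g, ha, hb, hg, h⟩ := theoremB
  set f := FourierTransform.fourier J with hf
  have om : Function.HasTemperateGrowth (fun p : ℝ × (ℝ × ℝ) => 2 * Real.pi * p.1) := by fun_prop
  let sc : ℝ × (ℝ × ℝ) → ℝ × ℝ := fun p =>
    ((2 * Real.pi * p.1) ^ 2 * p.2.1, (2 * Real.pi * p.1) ^ 3 * p.2.2)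
  have hsc : sc.HasTemperateGrowth := by
    apply temp_prodMk <;> fun_prop
  let Sa : ℝ × (ℝ × ℝ) → ℂ := fun p => a (sc p)
  let Sb : ℝ × (ℝ × ℝ) → ℂ := fun p => ((2 * Real.pi * p.1 : ℝ) : ℂ) ^ 4 * b (sc p)
  let Sg : ℝ × (ℝ × ℝ) → ℂ := fun p => ((2 * Real.pi * p.1 : ℝ) : ℂ) ^ 5 * g (sc p)
  have ta : Sa.HasTemperateGrowth := temp_comp ha hsc
  have tb : Sb.HasTemperateGrowth := by
    have := temp_comp hb hsc
    fun_prop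
  have tg : Sg.HasTemperateGrowth := by
    have := temp_comp hg hsc
    fun_prop
  have ia := fun x => temp_integrable id continuous_id f f.continuous.aestronglyMeasurable (int_schwartz f) Sa ta x
  have ib := fun x => temp_integrable id continuous_id f f.continuous.aestronglyMeasurable (int_schwartz f) Sb tb x
  have ig := fun x => temp_integrable id continuous_id f f.continuous.aestronglyMeasurable (int_schwartz f) Sg tg x
  have Ta := temp_integral id continuous_id f f.continuous.aestronglyMeasurable (int_schwartz f) Sa ta
  have Tb := temp_integral id continuous_id f f.continuous.aestronglyMeasurable (int_schwartz f) Sb tb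
  have Tg := temp_integral id continuous_id f f.continuous.aestronglyMeasurable (int_schwartz f) Sg tg
  refine ⟨fun x => - ∫ t, f t * Sa (id t, x), fun x => - ∫ t, f t * Sb (id t, x),
    fun x => - ∫ t, f t * Sg (id t, x), Ta.1.neg, Tb.1.neg, Tg.1.neg, fun u x => ?_⟩
  -- representation of J and derivatives
  have e0 : J x = ∫ ξ : ℝ, f ξ * ((fun _ => (1:ℂ)) ξ *
      Complex.exp (Complex.I * ((2 * Real.pi * ξ * x : ℝ) : ℂ))) := by
    rw [inversion J x]; simp only [one_mul]; rfl
  have e1 : deriv J x = ∫ ξ : ℝ, f ξ * ((fun ξ : ℝ => (2 * Real.pi * Complex.I * ξ : ℂ)) ξ *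
      Complex.exp (Complex.I * ((2 * Real.pi * ξ * x : ℝ) : ℂ))) := by
    have := inversion (SchwartzMap.derivCLM ℂ ℂ J) x
    rw [SchwartzMap.derivCLM_apply] at this
    rw [this]; congr 1; ext ξ
    rw [fourier_deriv_schwartz]; ring
  have e2 : deriv (deriv J) x = ∫ ξ : ℝ, f ξ * ((fun ξ : ℝ => (2 * Real.pi * Complex.I * ξ : ℂ) ^ 2) ξ *
      Complex.exp (Complex.I * ((2 * Real.pi * ξ * x : ℝ) : ℂ))) := by
    have := inversion (SchwartzMap.derivCLM ℂ ℂ (SchwartzMap.derivCLM ℂ ℂ J)) x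
    rw [SchwartzMap.derivCLM_apply] at this
    rw [show deriv (deriv J) x = deriv (SchwartzMap.derivCLM ℂ ℂ J) x from rfl]
    rw [this]; congr 1; ext ξ
    rw [fourier_deriv_schwartz, fourier_deriv_schwartz]; ring
  have i0 := schwartz_mul_integrable f x (fun _ => 1) (by fun_prop)
  have i1 := schwartz_mul_integrable f x (fun ξ : ℝ => (2 * Real.pi * Complex.I * ξ : ℂ)) (by fun_prop)
  have i2 := schwartz_mul_integrable f x (fun ξ : ℝ => (2 * Real.pi * Complex.I * ξ : ℂ) ^ 2) (by fun_prop)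
  rw [e0, e1, e2, ← integral_const_mul, ← integral_const_mul, ← integral_const_mul,
    ← integral_sub (i2.const_mul _) (i1.const_mul _)]
  have J1 := (i2.const_mul (u + 3 * x ^ 2 : ℂ)).sub (i1.const_mul (6 * x : ℂ))
  simp only [neg_mul]
  rw [← integral_add (by exact J1) (i0.const_mul _), ← integral_mul_const, ← integral_mul_const,
    ← integral_neg, ← integral_neg, ← integral_neg,
    ← integral_add (by exact (ia (u, x^3+u*x)).neg) (by exact ((ib (u, x^3+u*x)).mul_const (3/4*x^4+1/2*u*x^2 : ℂ)).neg)]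
  have J2 := ((ia (u, x^3+u*x)).neg.add ((ib (u, x^3+u*x)).mul_const (3/4*x^4+1/2*u*x^2 : ℂ)).neg)
  rw [← integral_add (by exact J2) (by exact ((ig (u, x^3+u*x)).mul_const (3/5*x^5+1/3*u*x^3 : ℂ)).neg)]
  congr 1; ext ξ
  have hh := h ((2 * Real.pi * ξ) ^ 2 * u) (2 * Real.pi * ξ * x)
  have ey : (2 * Real.pi * ξ * x) ^ 3 + (2 * Real.pi * ξ) ^ 2 * u * (2 * Real.pi * ξ * x) =
    (2 * Real.pi * ξ) ^ 3 * (x ^ 3 + u * x) := by ring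
  rw [ey, HH] at hh
  simp only [Sa, Sb, Sg, sc, id]
  push_cast at hh ⊢
  linear_combination (f ξ) * hh + f ξ * (2 * Real.pi * ξ) ^ 2 * (u + 3 * x ^ 2) * 
     Complex.exp (Complex.I * (2 * Real.pi * ξ * x)) * Complex.I_sq

lemma exists_bump (s : Set ℝ) (hs : s ∈ 𝓝 (0:ℝ)) : ∃ χ : ℝ → ℝ, ContDiff ℝ ∞ χ ∧ HasCompactSupport χ ∧
    tsupport χ ⊆ s ∧ χ =ᶠ[𝓝 0] fun _ => 1 := by
  obtain ⟨r, hr, h⟩ := Metric.nhds_basis_closedBall.mem_iff.1 hs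
  let χ : ContDiffBump (0:ℝ) := ⟨r/2, r, by positivity, by linarith⟩
  exact ⟨χ, χ.contDiff, χ.hasCompactSupport, by rw [χ.tsupport_eq]; exact h, χ.eventuallyEq_one⟩

theorem theoremA_real (J : ℝ → ℝ) (hJ : ContDiff ℝ ∞ J) :
    ∃ a b g : ℝ × ℝ → ℝ, ContDiff ℝ ∞ a ∧ ContDiff ℝ ∞ b ∧ ContDiff ℝ ∞ g ∧
      ∀ᶠ x in 𝓝 (0:ℝ), ∀ u : ℝ, (u + 3 * x ^ 2) * deriv (deriv J) x - 6 * x * deriv J x + 6 * J x =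
        a (u, x^3+u*x) + b (u, x^3+u*x) * (3/4*x^4+1/2*u*x^2)
        + g (u, x^3+u*x) * (3/5*x^5+1/3*u*x^3) := by
  obtain ⟨χ, hχ, hχc, -, hχ1⟩ := exists_bump Set.univ univ_mem
  have hs : ContDiff ℝ ∞ (fun x => χ x * J x) := hχ.mul hJ
  have hsc : ContDiff ℝ ∞ (fun x => ((χ x * J x : ℝ) : ℂ)) := Complex.ofRealCLM.contDiff.comp hs
  have hc : HasCompactSupport (fun x => ((χ x * J x : ℝ) : ℂ)) := by
    have : HasCompactSupport (fun x => χ x * J x) := hχc.mul_right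
    exact this.comp_left (g := fun x : ℝ => (x:ℂ)) (by simp)
  obtain ⟨a, b, g, ha, hb, hg, h⟩ := theoremA_schwartz (hc.toSchwartzMap hsc)
  have hre : ∀ {f : ℝ × ℝ → ℂ}, ContDiff ℝ ∞ f → ContDiff ℝ ∞ (fun x => (f x).re) :=
    fun hf => Complex.reCLM.contDiff.comp hf
  refine ⟨fun x => (a x).re, fun x => (b x).re, fun x => (g x).re, hre ha, hre hb, hre hg, ?_⟩
  have c0 : (fun x => χ x * J x) =ᶠ[𝓝 0] J := by
    filter_upwards [hχ1] with x hx; rw [hx, one_mul]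
  have c1 := c0.deriv
  have c2 := c1.deriv
  have dr : ∀ {k : ℝ → ℝ}, Differentiable ℝ k → deriv (fun x => ((k x : ℝ) : ℂ)) = 
      fun x => ((deriv k x : ℝ) : ℂ) := by
    intro k hk
    ext x
    exact (hk x).hasDerivAt.ofReal_comp.deriv
  have hd1 : Differentiable ℝ (fun x => χ x * J x) := hs.differentiable (by simp)
  have hd2 : Differentiable ℝ (deriv (fun x => χ x * J x)) :=
    ((contDiff_infty_iff_deriv.1 hs).2).differentiable (by simp)
  filter_upwards [c0, c1, c2] with x h0 h1 h2 u
  have := congrArg Complex.re (h u x)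
  have ee : ⇑(hc.toSchwartzMap hsc) = fun x => ((χ x * J x : ℝ) : ℂ) := rfl
  rw [ee, dr hd1, dr hd2] at this
  simp only [h0, h1, h2] at this
  have r1 : (3 / 4 * (x:ℂ) ^ 4 + 1 / 2 * u * x ^ 2) = ((3 / 4 * x ^ 4 + 1 / 2 * u * x ^ 2 : ℝ) : ℂ) := by
    push_cast; rfl
  have r2 : (3 / 5 * (x:ℂ) ^ 5 + 1 / 3 * u * x ^ 3) = ((3 / 5 * x ^ 5 + 1 / 3 * u * x ^ 3 : ℝ) : ℂ) := by
    push_cast; rfl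
  have r3 : ((u + 3 * x ^ 2) * ((deriv (deriv J) x : ℝ) : ℂ) - 6 * x * ((deriv J x : ℝ) : ℂ) + 6 * ((J x : ℝ) : ℂ) : ℂ) =
    (((u + 3 * x ^ 2) * deriv (deriv J) x - 6 * x * deriv J x + 6 * J x : ℝ) : ℂ) := by push_cast; rfl
  rw [r1, r2, r3, Complex.ofReal_re, Complex.add_re, Complex.add_re, Complex.re_mul_ofReal,
    Complex.re_mul_ofReal] at this
  exact this

lemma exists_prim (K : ℝ → ℝ) (hK : ContDiff ℝ ∞ K) :
    ∃ J : ℝ → ℝ, ContDiff ℝ ∞ J ∧ deriv J = K := by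
  have hd : ∀ x, HasDerivAt (fun x => ∫ t in (0:ℝ)..x, K t) (K x) x := fun x =>
    intervalIntegral.integral_hasDerivAt_right (hK.continuous.intervalIntegrable _ _)
      (hK.continuous.stronglyMeasurableAtFilter _ _) hK.continuous.continuousAt
  have he : deriv (fun x => ∫ t in (0:ℝ)..x, K t) = K := funext fun x => (hd x).deriv
  refine ⟨_, contDiff_infty_iff_deriv.2 ⟨fun x => (hd x).differentiableAt, ?_⟩, he⟩
  rw [he]; exact hK

theorem theoremA (K Γ : ℝ → ℝ) (hK : ContDiff ℝ ∞ K)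
    (hΓ : ∀ᶠ x in 𝓝 (0:ℝ), HasDerivAt Γ (-6 * x * K x) x) :
    ∃ a b g : ℝ × ℝ → ℝ, ContDiff ℝ ∞ a ∧ ContDiff ℝ ∞ b ∧ ContDiff ℝ ∞ g ∧
      ∀ᶠ x in 𝓝 (0:ℝ), ∀ u : ℝ, (u + 3 * x ^ 2) * K x + Γ x =
        a (u, x^3+u*x) + b (u, x^3+u*x) * (3/4*x^4+1/2*u*x^2)
        + g (u, x^3+u*x) * (3/5*x^5+1/3*u*x^3) := by
  obtain ⟨J1, hJ1, rfl⟩ := exists_prim K hK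
  obtain ⟨J, hJ, rfl⟩ := exists_prim J1 hJ1
  obtain ⟨a, b, g, ha, hb, hg, h⟩ := theoremA_real J hJ
  have hd1 : Differentiable ℝ J := hJ.differentiable (by simp)
  have hd2 : Differentiable ℝ (deriv J) := hJ1.differentiable (by simp)
  set D : ℝ → ℝ := fun x => Γ x - (-(6 * x * deriv J x) + 6 * J x) with hD
  have hDd : ∀ᶠ x in 𝓝 (0:ℝ), HasDerivAt D 0 x := by
    filter_upwards [hΓ] with x hx
    have hx2 : HasDerivAt D _ x :=
      hx.sub (((((hasDerivAt_id x).const_mul 6).mul (hd2 x).hasDerivAt).neg).add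
        ((hd1 x).hasDerivAt.const_mul 6))
    refine hx2.congr_deriv ?_
    simp only [id, mul_one]
    ring
  have hDc : ∀ᶠ x in 𝓝 (0:ℝ), D x = D 0 := by
    obtain ⟨r, hr, hb⟩ := Metric.eventually_nhds_iff_ball.1 hDd
    filter_upwards [Metric.ball_mem_nhds (0:ℝ) hr] with x hx
    refine (convex_ball (0:ℝ) r).is_const_of_fderivWithin_eq_zero (𝕜 := ℝ)
      (fun y hy => (hb y hy).differentiableAt.differentiableWithinAt) (fun y hy => ?_) hx
      (Metric.mem_ball_self hr)
    rw [fderivWithin_of_isOpen Metric.isOpen_ball hy, (hb y hy).hasFDerivAt.fderiv]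
    ext; simp
  refine ⟨fun p => a p + D 0, b, g, ha.add contDiff_const, hb, hg, ?_⟩
  filter_upwards [h, hDc] with x h1 h2 u
  have := h1 u
  have h3 : Γ x = D 0 + (-(6 * x * deriv J x) + 6 * J x) := by rw [← h2]; simp [hD]
  rw [h3]
  linear_combination this

end OST

namespace OST
open scoped ContDiff
open Function MeasureTheory

lemma hasDeriv_param (R : ℝ → ℝ) (hR : ContDiff ℝ ∞ R) (n : ℕ) (x : ℝ) :
    HasDerivAt (fun x => ∫ r in (0:ℝ)..1, r ^ n * R (x * r))
      (∫ r in (0:ℝ)..1, r ^ (n+1) * deriv R (x * r)) x := by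
  have hRc := hR.continuous
  have hRd : Differentiable ℝ R := hR.differentiable (by simp)
  have hdc : Continuous (deriv R) := (contDiff_infty_iff_deriv.1 hR).2.continuous
  have hcK : Continuous (fun p : ℝ × ℝ => p.2 ^ (n+1) * deriv R (p.1 * p.2)) := by fun_prop
  obtain ⟨C, hC⟩ := ((isCompact_closedBall x 1).prod (isCompact_Icc (a := (0:ℝ)) (b := 1))).exists_bound_of_continuousOn
    hcK.continuousOn
  refine (intervalIntegral.hasDerivAt_integral_of_dominated_loc_of_deriv_le (bound := fun _ => C)
    (F := fun x r => r ^ n * R (x * r))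
    (F' := fun x r => r ^ (n+1) * deriv R (x * r))
    (Metric.ball_mem_nhds x one_pos) ?_ ?_ ?_ ?_ ?_ ?_).2
  · exact Eventually.of_forall fun y => Continuous.aestronglyMeasurable (by fun_prop)
  · exact Continuous.intervalIntegrable (by fun_prop) _ _
  · exact Continuous.aestronglyMeasurable (by fun_prop)
  · refine Eventually.of_forall fun r hr y hy => ?_
    rw [Set.uIoc_of_le zero_le_one] at hr
    exact hC (y, r) ⟨Metric.ball_subset_closedBall hy, hr.1.le, hr.2⟩
  · exact intervalIntegrable_const
  · refine Eventually.of_forall fun r hr y hy => ?_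
    have h1 : HasDerivAt (fun y => R (y * r)) _ y :=
      HasDerivAt.comp (h₂ := R) y (hRd (y * r)).hasDerivAt ((hasDerivAt_id y).mul_const r)
    refine (h1.const_mul (r ^ n)).congr_deriv ?_
    ring

lemma contDiff_param (R : ℝ → ℝ) (hR : ContDiff ℝ ∞ R) (n : ℕ) :
    ContDiff ℝ ∞ (fun x => ∫ r in (0:ℝ)..1, r ^ n * R (x * r)) := by
  rw [contDiff_infty]
  intro k
  induction k generalizing R n with
  | zero =>
    have : Differentiable ℝ (fun x => ∫ r in (0:ℝ)..1, r ^ n * R (x * r)) :=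
      fun x => (hasDeriv_param R hR n x).differentiableAt
    exact contDiff_zero.2 this.continuous
  | succ k ih =>
    have he : deriv (fun x => ∫ r in (0:ℝ)..1, r ^ n * R (x * r)) =
      fun x => ∫ r in (0:ℝ)..1, r ^ (n+1) * deriv R (x * r) :=
      funext fun x => (hasDeriv_param R hR n x).deriv
    push_cast
    rw [contDiff_succ_iff_deriv]
    refine ⟨fun x => (hasDeriv_param R hR n x).differentiableAt, by simp, ?_⟩
    rw [he]
    exact ih _ (contDiff_infty_iff_deriv.1 hR).2 _

lemma had' (R : ℝ → ℝ) (hR : ContDiff ℝ ∞ R) (n : ℕ) :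
    ∃ ψ : ℝ → ℝ, ContDiff ℝ ∞ ψ ∧ ψ 0 = R 0 / (n + 1) ∧
      ∀ x, HasDerivAt (fun x => x ^ (n+1) * ψ x) (x ^ n * R x) x := by
  refine ⟨_, contDiff_param R hR n, ?_, fun x => ?_⟩
  · simp [div_eq_inv_mul]
  have hRc := hR.continuous
  have hc : Continuous (fun r => r ^ n * R r) := by fun_prop
  have he : (fun x : ℝ => x ^ (n+1) * ∫ r in (0:ℝ)..1, r ^ n * R (x * r)) =
    fun x => ∫ r in (0:ℝ)..x, r ^ n * R r := by
    ext x
    have h := intervalIntegral.mul_integral_comp_mul_left (a := 0) (b := 1) (f := fun r => r ^ n * R r) (c := x)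
    rw [mul_zero, mul_one] at h
    rw [← h, pow_succ', mul_assoc, ← intervalIntegral.integral_const_mul]
    congr 2; ext r; ring
  rw [he]
  exact intervalIntegral.integral_hasDerivAt_right (hc.intervalIntegrable _ _)
      (hc.stronglyMeasurableAtFilter _ _) hc.continuousAt

lemma had (R : ℝ → ℝ) (hR : ContDiff ℝ ∞ R) (n : ℕ) :
    ∃ ψ : ℝ → ℝ, ContDiff ℝ ∞ ψ ∧ ∀ x, HasDerivAt (fun x => x ^ (n+1) * ψ x) (x ^ n * R x) x := by
  obtain ⟨ψ, h1, -, h2⟩ := had' R hR n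
  exact ⟨ψ, h1, h2⟩

lemma eq_of_deriv {F : Type*} [NormedAddCommGroup F] [NormedSpace ℝ F] (f g f' : ℝ → F)
    (hf : ∀ᶠ x in 𝓝 (0:ℝ), HasDerivAt f (f' x) x) (hg : ∀ᶠ x in 𝓝 (0:ℝ), HasDerivAt g (f' x) x) :
    ∀ᶠ x in 𝓝 (0:ℝ), f x - f 0 = g x - g 0 := by
  have hd : ∀ᶠ x in 𝓝 (0:ℝ), HasDerivAt (fun x => f x - g x) 0 x := by
    filter_upwards [hf, hg] with x h1 h2
    have : HasDerivAt (fun x => f x - g x) _ x := h1.sub h2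
    exact this.congr_deriv (sub_self _)
  obtain ⟨r, hr, hb⟩ := Metric.eventually_nhds_iff_ball.1 hd
  filter_upwards [Metric.ball_mem_nhds (0:ℝ) hr] with x hx
  have := (convex_ball (0:ℝ) r).is_const_of_fderivWithin_eq_zero (𝕜 := ℝ)
      (fun y hy => (hb y hy).differentiableAt.differentiableWithinAt) (fun y hy => by
      rw [fderivWithin_of_isOpen Metric.isOpen_ball hy, (hb y hy).hasFDerivAt.fderiv]
      ext; simp) hx (Metric.mem_ball_self hr)
  rw [sub_eq_sub_iff_sub_eq_sub]; exact this

/-- Hadamard: a smooth function vanishing at zero is divisible by `x`. -/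
lemma had0 (f : ℝ → ℝ) (hf : ContDiff ℝ ∞ f) (h0 : f 0 = 0) :
    ∃ ψ : ℝ → ℝ, ContDiff ℝ ∞ ψ ∧ ∀ᶠ x in 𝓝 (0:ℝ), f x = x * ψ x := by
  obtain ⟨ψ, hψ, h⟩ := had (deriv f) (contDiff_infty_iff_deriv.1 hf).2 0
  refine ⟨ψ, hψ, ?_⟩
  have hd : Differentiable ℝ f := hf.differentiable (by simp)
  filter_upwards [eq_of_deriv f _ (deriv f) (Eventually.of_forall fun x => (hd x).hasDerivAt)
    (Eventually.of_forall fun x => by have := h x; rwa [pow_zero, one_mul] at this)] with x hx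
  simpa [h0] using hx

lemma cutoff {F : Type*} [NormedAddCommGroup F] [NormedSpace ℝ F] (f : ℝ → F)
    (hf : ∀ᶠ x in 𝓝 (0:ℝ), ContDiffAt ℝ ∞ f x) :
    ∃ f' : ℝ → F, ContDiff ℝ ∞ f' ∧ f' =ᶠ[𝓝 0] f := by
  obtain ⟨χ, hχ, -, hs, h1⟩ := exists_bump _ hf
  refine ⟨fun x => χ x • f x, contDiff_iff_contDiffAt.2 fun x => ?_, ?_⟩
  · by_cases hx : x ∈ tsupport χ
    · exact hχ.contDiffAt.smul (hs hx)
    · have : (fun x => χ x • f x) =ᶠ[𝓝 x] fun _ => 0 := by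
        filter_upwards [(isClosed_tsupport χ).isOpen_compl.mem_nhds hx] with y hy
        rw [image_eq_zero_of_notMem_tsupport hy, zero_smul]
      exact contDiffAt_const.congr_of_eventuallyEq this
  · filter_upwards [h1] with x hx
    rw [hx, one_smul]

lemma invfun (g : ℝ → ℝ) (hg : ContDiff ℝ ∞ g) (h0 : g 0 = 0) (h1 : deriv g 0 ≠ 0) :
    ∃ h : ℝ → ℝ, ContDiff ℝ ∞ h ∧ h 0 = 0 ∧ (∀ᶠ x in 𝓝 (0:ℝ), g (h x) = x) ∧
      ∀ᶠ t in 𝓝 (0:ℝ), h (g t) = t := by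
  have hd : Differentiable ℝ g := hg.differentiable (by simp)
  have hdc : Continuous (deriv g) := (contDiff_infty_iff_deriv.1 hg).2.continuous
  have hfd : HasFDerivAt g (ContinuousLinearEquiv.unitsEquivAut ℝ (Units.mk0 _ h1) : ℝ →L[ℝ] ℝ) 0 :=
    (hd 0).hasDerivAt.hasFDerivAt_equiv h1
  let e := hg.contDiffAt.toOpenPartialHomeomorph g hfd (by simp)
  have he : ⇑e = g := ContDiffAt.toOpenPartialHomeomorph_coe _ hfd _
  have hs : (0:ℝ) ∈ e.source := ContDiffAt.mem_toOpenPartialHomeomorph_source _ hfd _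
  have ht : (0:ℝ) ∈ e.target := by
    have := e.map_source hs
    rwa [he, h0] at this
  have hz : e.symm 0 = 0 := by
    have := e.left_inv hs
    rwa [he, h0] at this
  have hsc : ContinuousAt e.symm 0 := e.continuousAt_symm ht
  have hne : ∀ᶠ x in 𝓝 (0:ℝ), deriv g (e.symm x) ≠ 0 := by
    have : ContinuousAt (fun x => deriv g (e.symm x)) 0 :=
      hdc.continuousAt.comp hsc
    exact this.eventually_ne (by rw [hz]; exact h1)
  have hcd : ∀ᶠ x in 𝓝 (0:ℝ), ContDiffAt ℝ ∞ e.symm x := by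
    filter_upwards [hne, e.open_target.mem_nhds ht] with x hx hxt
    exact e.contDiffAt_symm_deriv hx hxt (by rw [he]; exact (hd _).hasDerivAt)
      (by rw [he]; exact hg.contDiffAt)
  obtain ⟨h, hh, heq⟩ := cutoff _ hcd
  have hgt : Tendsto g (𝓝 0) (𝓝 0) := by
    have := hg.continuous.tendsto 0
    rwa [h0] at this
  refine ⟨h, hh, heq.eq_of_nhds.trans hz, ?_, ?_⟩
  · filter_upwards [heq, e.open_target.mem_nhds ht] with x hx hxt
    rw [hx, ← he]; exact e.right_inv hxt
  · filter_upwards [hgt.eventually heq, e.open_source.mem_nhds hs] with x hx hxs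
    rw [hx, ← he]; exact e.left_inv hxs

lemma iter_smul {F : Type*} [NormedAddCommGroup F] [NormedSpace ℝ F] (h : ℝ → F)
    (hh : ContDiff ℝ ∞ h) (n : ℕ) (t : ℝ) :
    iteratedDeriv (n+1) (fun t => t • h t) t =
      ((n:ℝ)+1) • iteratedDeriv n h t + t • iteratedDeriv (n+1) h t := by
  have hI : ∀ k t, HasDerivAt (iteratedDeriv k h) (iteratedDeriv (k+1) h t) t := fun k t => by
    rw [iteratedDeriv_succ]
    exact ((hh.differentiable_iteratedDeriv k (mod_cast (ENat.natCast_lt_top k))) t).hasDerivAt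
  induction n generalizing t with
  | zero =>
    rw [iteratedDeriv_succ, iteratedDeriv_zero]
    have := (hasDerivAt_id t).smul (hI 0 t)
    rw [iteratedDeriv_zero] at this
    have h2 : HasDerivAt (fun t => t • h t) _ t := this
    rw [h2.deriv]
    simp [add_comm]
  | succ n ih =>
    rw [iteratedDeriv_succ, funext ih]
    have h2 : HasDerivAt (fun t => ((n:ℝ)+1) • iteratedDeriv n h t + t • iteratedDeriv (n+1) h t) _ t :=
      ((hI n t).const_smul ((n:ℝ)+1)).add ((hasDerivAt_id t).smul (hI (n+1) t))
    rw [h2.deriv]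
    simp only [id]
    push_cast
    module

lemma iter_pow (j k : ℕ) (hk : k < j) (Ψ : ℝ → ℝ) (hΨ : ContDiff ℝ ∞ Ψ) :
    iteratedDeriv k (fun t => t ^ j * Ψ t) 0 = 0 := by
  induction j generalizing k with
  | zero => omega
  | succ j ih =>
    have he : (fun t : ℝ => t ^ (j+1) * Ψ t) = fun t => t • (t ^ j * Ψ t) := by
      ext t; rw [smul_eq_mul]; ring
    rw [he]
    cases k with
    | zero => simp
    | succ k =>
      rw [iter_smul _ (by fun_prop), ih k (by omega)]
      simp

end OST

namespace OST
open scoped ContDiff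
open Function MeasureTheory

lemma flat (A B C : ℝ × ℝ → ℝ) (hA : ContDiff ℝ ∞ A) (hB : ContDiff ℝ ∞ B) (hC : ContDiff ℝ ∞ C)
    (κ G : ℝ → ℝ) (hκ : ContDiff ℝ ∞ κ)
    (hG : ∀ᶠ x in 𝓝 (0:ℝ), HasDerivAt G (-6 * x * κ x) x)
    (hid : ∀ᶠ x in 𝓝 (0:ℝ), ∀ u : ℝ, (u + 3 * x ^ 2) * κ x + G x =
        A (u, x^3+u*x) + B (u, x^3+u*x) * (3/4*x^4+1/2*u*x^2)
        + C (u, x^3+u*x) * (3/5*x^5+1/3*u*x^3))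
    (hA1 : fderiv ℝ A 0 (1, 0) = 0) (hA2 : fderiv ℝ A 0 (0, 1) = 0) (hB0 : B 0 = 0) (hC0 : C 0 = 0) :
    ∃ ψ : ℝ → ℝ, ContDiff ℝ ∞ ψ ∧ ∀ᶠ x in 𝓝 (0:ℝ), κ x = x ^ 4 * ψ x := by
  have hAd : Differentiable ℝ A := hA.differentiable (by simp)
  have hκ0 : κ 0 = 0 := by
    have h := hid.self_of_nhds
    have h1 : (fun u => u * κ 0 + G 0) = fun u => A (u, 0) := by
      ext u; have := h u; simpa using this
    have h2 : HasDerivAt (fun u => u * κ 0 + G 0) _ 0 :=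
      ((hasDerivAt_id (0:ℝ)).mul_const (κ 0)).add_const (G 0)
    have h3 : HasDerivAt (fun u : ℝ => A (u, 0)) (fderiv ℝ A 0 (1, 0)) 0 :=
      HasFDerivAt.comp_hasDerivAt (f := fun u : ℝ => (u, (0:ℝ))) (0:ℝ) (hAd (0,0)).hasFDerivAt
        ((hasDerivAt_id (0:ℝ)).prodMk (hasDerivAt_const (0:ℝ) (0:ℝ)))
    rw [← h1] at h3
    have := h2.unique h3
    rw [hA1] at this
    simpa using this
  set α : ℝ → ℝ := fun y => A (0, y) with hα
  set β : ℝ → ℝ := fun y => B (0, y) with hβ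
  set c : ℝ → ℝ := fun y => C (0, y) with hc
  have sα : ContDiff ℝ ∞ α := by fun_prop
  have sβ : ContDiff ℝ ∞ β := by fun_prop
  have sc : ContDiff ℝ ∞ c := by fun_prop
  have sα' := (contDiff_infty_iff_deriv.1 sα).2
  have sβ' := (contDiff_infty_iff_deriv.1 sβ).2
  have sc' := (contDiff_infty_iff_deriv.1 sc).2
  have sκ' := (contDiff_infty_iff_deriv.1 hκ).2
  have dα : Differentiable ℝ α := sα.differentiable (by simp)
  have dβ : Differentiable ℝ β := sβ.differentiable (by simp)
  have dc : Differentiable ℝ c := sc.differentiable (by simp)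
  have dκ : Differentiable ℝ κ := hκ.differentiable (by simp)
  have hα0 : deriv α 0 = 0 := by
    have h3 : HasDerivAt (fun u : ℝ => A (0, u)) (fderiv ℝ A 0 (0, 1)) 0 :=
      HasFDerivAt.comp_hasDerivAt (f := fun u : ℝ => ((0:ℝ), u)) (0:ℝ) (hAd (0,0)).hasFDerivAt
        ((hasDerivAt_const (0:ℝ) (0:ℝ)).prodMk (hasDerivAt_id (0:ℝ)))
    rw [h3.deriv, hA2]
  obtain ⟨α1, sα1, eα⟩ := had0 _ sα' hα0
  obtain ⟨β1, sβ1, eβ⟩ := had0 _ sβ hB0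
  obtain ⟨c1, sc1, ec⟩ := had0 _ sc hC0
  set R : ℝ → ℝ := fun x => α1 (x^3) + x * β1 (x^3) + 3/4 * x * deriv β (x^3) + x^2 * c1 (x^3)
    + 3/5 * x^2 * deriv c (x^3) with hR
  have sR : ContDiff ℝ ∞ R := by fun_prop
  have t3 : Tendsto (fun x : ℝ => x ^ 3) (𝓝 0) (𝓝 0) := by
    have : Continuous (fun x : ℝ => x ^ 3) := by fun_prop
    simpa using this.tendsto 0
  have hid0 : (fun x => 3 * x ^ 2 * κ x + G x) =ᶠ[𝓝 0]
      fun x => α (x^3) + β (x^3) * (3/4*x^4) + c (x^3) * (3/5*x^5) := by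
    filter_upwards [hid] with x hx
    simpa using hx 0
  have hκ' : ∀ᶠ x in 𝓝 (0:ℝ), x ^ 2 * deriv κ x = x ^ 2 * (x ^ 3 * R x) := by
    filter_upwards [hid0.eventuallyEq_nhds, hG, t3.eventually eα, t3.eventually eβ, t3.eventually ec]
      with x h1 h2 h3 h4 h5
    have p2 : HasDerivAt (fun x : ℝ => 3 * x ^ 2) (3 * (2 * x)) x := by
      simpa using (hasDerivAt_pow 2 x).const_mul 3
    have p3 : HasDerivAt (fun x : ℝ => x ^ 3) (3 * x ^ 2) x := by
      simpa using (hasDerivAt_pow 3 x)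
    have p4 : HasDerivAt (fun x : ℝ => 3/4 * x ^ 4) (3/4 * (4 * x ^ 3)) x := by
      simpa using (hasDerivAt_pow 4 x).const_mul (3/4)
    have p5 : HasDerivAt (fun x : ℝ => 3/5 * x ^ 5) (3/5 * (5 * x ^ 4)) x := by
      simpa using (hasDerivAt_pow 5 x).const_mul (3/5)
    have q1 : HasDerivAt (fun x => 3 * x ^ 2 * κ x + G x) _ x :=
      (p2.mul (dκ x).hasDerivAt).add h2
    have ca : HasDerivAt (fun x => α (x^3)) _ x := HasDerivAt.comp (h₂ := α) x (dα (x^3)).hasDerivAt p3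
    have cb : HasDerivAt (fun x => β (x^3)) _ x := HasDerivAt.comp (h₂ := β) x (dβ (x^3)).hasDerivAt p3
    have cc : HasDerivAt (fun x => c (x^3)) _ x := HasDerivAt.comp (h₂ := c) x (dc (x^3)).hasDerivAt p3
    have q2 : HasDerivAt (fun x => α (x^3) + β (x^3) * (3/4*x^4) + c (x^3) * (3/5*x^5)) _ x :=
      (ca.add (cb.mul p4)).add (cc.mul p5)
    have := q1.unique (q2.congr_of_eventuallyEq h1)
    rw [h3, h4, h5] at this
    simp only [hR]
    linear_combination this / 3
  have hκ'' : deriv κ =ᶠ[𝓝 0] fun x => x ^ 3 * R x := by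
    refine (ContinuousAt.eventuallyEq_nhds_iff_eventuallyEq_nhdsNE ?_ ?_).1 ?_
    · exact sκ'.continuous.continuousAt
    · have := sR.continuous
      exact Continuous.continuousAt (by fun_prop)
    · filter_upwards [nhdsWithin_le_nhds hκ', self_mem_nhdsWithin] with x h1 h2
      exact mul_left_cancel₀ (pow_ne_zero 2 h2) h1
  obtain ⟨ψ, sψ, hψ⟩ := had R sR 3
  refine ⟨ψ, sψ, ?_⟩
  filter_upwards [eq_of_deriv κ _ (fun x => x ^ 3 * R x)
    (hκ''.mono fun x hx => (dκ x).hasDerivAt.congr_deriv hx)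
    (Eventually.of_forall hψ)] with x hx
  simpa [hκ0] using hx

end OST

namespace OST
open scoped ContDiff
open Function MeasureTheory

lemma param {m : ℕ} (γ δ : ℝ → Fin m → ℝ) (hγ : ContDiff ℝ ∞ γ) (hδ : ContDiff ℝ ∞ δ)
    (hd : ∀ t, HasDerivAt γ (t • δ t) t) (h0 : δ 0 ≠ 0) :
    ∃ (p d S h : ℝ → ℝ) (K : ℝ → Fin m → ℝ), ContDiff ℝ ∞ p ∧ ContDiff ℝ ∞ d ∧ ContDiff ℝ ∞ S ∧
      ContDiff ℝ ∞ h ∧ ContDiff ℝ ∞ K ∧ d 0 ≠ 0 ∧ h 0 = 0 ∧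
      (∀ᶠ x in 𝓝 (0:ℝ), h x * S (h x) = x) ∧ (∀ᶠ t in 𝓝 (0:ℝ), h (t * S t) = t) ∧
      (∀ᶠ t in 𝓝 (0:ℝ), p t = -3 * (t * S t) ^ 2) ∧
      (∀ᶠ x in 𝓝 (0:ℝ), d (h x) • K x = δ (h x)) ∧
      ∀ᶠ x in 𝓝 (0:ℝ), HasDerivAt (fun x => γ (h x)) ((-6 * x) • K x) x := by
  obtain ⟨i, hi⟩ := Function.ne_iff.1 h0
  simp only [Pi.zero_apply] at hi
  set d : ℝ → ℝ := fun t => -6 / δ 0 i * δ t i with hdd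
  set p : ℝ → ℝ := fun t => -6 / δ 0 i * (γ t i - γ 0 i) with hp
  have hδi : ContDiff ℝ ∞ (fun t => δ t i) := contDiff_pi.1 hδ i
  have hγi : ContDiff ℝ ∞ (fun t => γ t i) := contDiff_pi.1 hγ i
  have sd : ContDiff ℝ ∞ d := contDiff_const.mul hδi
  have sp : ContDiff ℝ ∞ p := contDiff_const.mul (hγi.sub contDiff_const)
  have d0 : d 0 = -6 := by simp only [hdd]; field_simp
  have p0 : p 0 = 0 := by simp [hp]
  have hpd : ∀ t, HasDerivAt p (t * d t) t := fun t => by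
    have h1 : HasDerivAt (fun t => γ t i) (t * δ t i) t := by
      simpa using (hasDerivAt_pi.1 (hd t)) i
    refine ((h1.sub_const (γ 0 i)).const_mul (-6 / δ 0 i)).congr_deriv ?_
    simp only [hdd]; ring
  obtain ⟨q, sq, q0, hq⟩ := had' d sd 1
  have q0' : q 0 = -3 := by rw [q0, d0]; norm_num
  have hpq : ∀ᶠ t in 𝓝 (0:ℝ), p t = t ^ 2 * q t := by
    filter_upwards [eq_of_deriv p _ (fun t => t ^ 1 * d t) (Eventually.of_forall fun t => by
      simpa using hpd t) (Eventually.of_forall hq)] with t ht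
    simpa [p0] using ht
  have hqpos : ∀ᶠ t in 𝓝 (0:ℝ), 0 < - q t / 3 := by
    have : Continuous (fun t => - q t / 3) := by
      have := sq.continuous
      fun_prop
    exact this.continuousAt.eventually_const_lt (by simp only [q0']; norm_num)
  obtain ⟨S, sS, hS⟩ := cutoff (fun t => Real.sqrt (- q t / 3)) (by
    filter_upwards [hqpos] with t ht
    exact ContDiffAt.sqrt (by have := sq.contDiffAt (x := t); fun_prop) ht.ne')
  have S0 : S 0 = 1 := by rw [hS.eq_of_nhds, q0']; norm_num
  have sg : ContDiff ℝ ∞ (fun t => t * S t) := by fun_prop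
  have dS : Differentiable ℝ S := sS.differentiable (by simp)
  have g1 : deriv (fun t => t * S t) 0 ≠ 0 := by
    have : HasDerivAt (fun t => t * S t) _ 0 := (hasDerivAt_id (0:ℝ)).mul (dS 0).hasDerivAt
    rw [this.deriv]; simp [S0]
  obtain ⟨h, sh, hh0, hgh, hhg⟩ := invfun _ sg (by simp) g1
  have ht : Tendsto h (𝓝 0) (𝓝 0) := by
    have := sh.continuous.tendsto 0; rwa [hh0] at this
  have dh : Differentiable ℝ h := sh.differentiable (by simp)
  have hpg : ∀ᶠ t in 𝓝 (0:ℝ), p t = -3 * (t * S t) ^ 2 := by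
    filter_upwards [hpq, hS, hqpos] with t h1 h2 h3
    rw [h1, h2, mul_pow, Real.sq_sqrt h3.le]; ring
  have hdne : ∀ᶠ x in 𝓝 (0:ℝ), d (h x) ≠ 0 := by
    have : ContinuousAt (fun x => d (h x)) 0 := (sd.continuous.comp sh.continuous).continuousAt
    exact this.eventually_ne (by rw [hh0, d0]; norm_num)
  obtain ⟨K, sK, hK⟩ := cutoff (fun x => (d (h x))⁻¹ • δ (h x)) (by
    filter_upwards [hdne] with x hx
    exact ((sd.comp sh).contDiffAt.inv hx).smul (hδ.comp sh).contDiffAt)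
  have hKd : ∀ᶠ x in 𝓝 (0:ℝ), d (h x) • K x = δ (h x) := by
    filter_upwards [hK, hdne] with x h1 h2
    rw [h1, smul_inv_smul₀ h2]
  refine ⟨p, d, S, h, K, sp, sd, sS, sh, sK, by rw [d0]; norm_num, hh0, hgh, hhg, hpg, hKd, ?_⟩
  have hph : (fun x => p (h x)) =ᶠ[𝓝 0] fun x => -3 * x ^ 2 := by
    filter_upwards [ht.eventually hpg, hgh] with x h1 h2
    rw [h1, h2]
  filter_upwards [hph.eventuallyEq_nhds, hKd] with x h1 h2
  have e1 : HasDerivAt (fun x => p (h x)) _ x :=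
    HasDerivAt.comp (h₂ := p) x (hpd (h x)) (dh x).hasDerivAt
  have e2 : HasDerivAt (fun x : ℝ => -3 * x ^ 2) (-3 * (2 * x)) x := by
    simpa using (hasDerivAt_pow 2 x).const_mul (-3)
  have e3 := e1.unique (e2.congr_of_eventuallyEq h1)
  have e4 : HasDerivAt (fun x => γ (h x)) _ x := HasDerivAt.scomp x (hd (h x)) (dh x).hasDerivAt
  refine e4.congr_deriv ?_
  rw [← h2, smul_smul, smul_smul]
  congr 1
  linear_combination e3

end OST

namespace OST
open scoped ContDiff
open Function MeasureTheory

lemma vecA {m : ℕ} (K Γ : ℝ → Fin m → ℝ) (hK : ContDiff ℝ ∞ K)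
    (hΓ : ∀ᶠ x in 𝓝 (0:ℝ), HasDerivAt Γ ((-6 * x) • K x) x) :
    ∃ a b g : ℝ × ℝ → Fin m → ℝ, ContDiff ℝ ∞ a ∧ ContDiff ℝ ∞ b ∧ ContDiff ℝ ∞ g ∧
      ∀ᶠ x in 𝓝 (0:ℝ), ∀ u : ℝ, (u + 3 * x ^ 2) • K x + Γ x =
        a (u, x^3+u*x) + (3/4*x^4+1/2*u*x^2) • b (u, x^3+u*x)
        + (3/5*x^5+1/3*u*x^3) • g (u, x^3+u*x) := by
  have H := fun i => theoremA (fun x => K x i) (fun x => Γ x i) (contDiff_pi.1 hK i) (by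
    filter_upwards [hΓ] with x hx
    simpa using (hasDerivAt_pi.1 hx) i)
  choose a b g ha hb hg h using H
  refine ⟨fun q i => a i q, fun q i => b i q, fun q i => g i q, contDiff_pi.2 ha, contDiff_pi.2 hb,
    contDiff_pi.2 hg, ?_⟩
  filter_upwards [eventually_all.2 h] with x hx u
  ext i
  have := hx i u
  simp only [Pi.add_apply, Pi.smul_apply, smul_eq_mul]
  linear_combination this

lemma iter_clm {m : ℕ} (L : (Fin m → ℝ) →L[ℝ] ℝ) (δ : ℝ → Fin m → ℝ) (hδ : ContDiff ℝ ∞ δ) (k : ℕ)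
    (t : ℝ) : iteratedDeriv k (fun t => L (δ t)) t = L (iteratedDeriv k δ t) := by
  induction k generalizing t with
  | zero => simp
  | succ k ih =>
    rw [iteratedDeriv_succ, iteratedDeriv_succ, funext ih]
    exact (L.hasFDerivAt.comp_hasDerivAt t
      ((hδ.differentiable_iteratedDeriv k (mod_cast (ENat.natCast_lt_top k))) t).hasDerivAt).deriv

lemma mem_span {m : ℕ} (K Γ δ : ℝ → Fin m → ℝ) (hK : ContDiff ℝ ∞ K) (hδ : ContDiff ℝ ∞ δ)
    (hΓ : ∀ᶠ x in 𝓝 (0:ℝ), HasDerivAt Γ ((-6 * x) • K x) x)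
    (a b g : ℝ × ℝ → Fin m → ℝ) (ha : ContDiff ℝ ∞ a) (hb : ContDiff ℝ ∞ b) (hg : ContDiff ℝ ∞ g)
    (hid : ∀ᶠ x in 𝓝 (0:ℝ), ∀ u : ℝ, (u + 3 * x ^ 2) • K x + Γ x =
        a (u, x^3+u*x) + (3/4*x^4+1/2*u*x^2) • b (u, x^3+u*x)
        + (3/5*x^5+1/3*u*x^3) • g (u, x^3+u*x))
    (d S : ℝ → ℝ) (hd : ContDiff ℝ ∞ d) (hS : ContDiff ℝ ∞ S)
    (hdK : ∀ᶠ t in 𝓝 (0:ℝ), d t • K (t * S t) = δ t) (k : ℕ) (hk : k < 4) :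
    iteratedDeriv k δ 0 ∈ Submodule.span ℝ (Set.range
      ![fderiv ℝ a 0 (1, 0), fderiv ℝ a 0 (0, 1), b 0, g 0]) := by
  by_contra hc
  obtain ⟨l, hl, hker⟩ := Submodule.exists_le_ker_of_notMem hc
  set L : (Fin m → ℝ) →L[ℝ] ℝ := LinearMap.toContinuousLinearMap l with hL
  have hv : ∀ j, L (![fderiv ℝ a 0 (1, 0), fderiv ℝ a 0 (0, 1), b 0, g 0] j) = 0 := fun j =>
    hker (Submodule.subset_span ⟨j, rfl⟩)
  have hda : fderiv ℝ (fun q => L (a q)) 0 = L.comp (fderiv ℝ a 0) :=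
    (L.hasFDerivAt.comp (0 : ℝ × ℝ) ((ha.differentiable (by simp)) 0).hasFDerivAt).fderiv
  obtain ⟨ψ, sψ, hψ⟩ := flat (fun q => L (a q)) (fun q => L (b q)) (fun q => L (g q))
    (L.contDiff.comp ha) (L.contDiff.comp hb) (L.contDiff.comp hg) (fun x => L (K x))
    (fun x => L (Γ x)) (L.contDiff.comp hK)
    (by filter_upwards [hΓ] with x hx
        exact (L.hasFDerivAt.comp_hasDerivAt x hx).congr_deriv (by simp))
    (by filter_upwards [hid] with x hx u
        have := congrArg L (hx u)
        simp only [map_add, map_smul, smul_eq_mul] at this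
        linear_combination this)
    (by rw [hda]; exact hv 0) (by rw [hda]; exact hv 1) (hv 2) (hv 3)
  have ht : Tendsto (fun t => t * S t) (𝓝 0) (𝓝 0) := by
    have : Continuous (fun t => t * S t) := by
      have := hS.continuous
      fun_prop
    simpa using this.tendsto 0
  have he : (fun t => L (δ t)) =ᶠ[𝓝 0] fun t => t ^ 4 * (d t * S t ^ 4 * ψ (t * S t)) := by
    filter_upwards [hdK, ht.eventually hψ] with t h1 h2
    rw [← h1, map_smul, h2, smul_eq_mul]; ring
  have h0 := he.iteratedDeriv_eq k
  rw [iter_pow 4 k hk _ (by fun_prop), iter_clm L δ hδ] at h0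
  exact hl h0

end OST

namespace OST
open scoped ContDiff
open Function MeasureTheory

lemma ext_basis {n : ℕ} (W : Fin 4 → Fin (4+n) → ℝ) (hW : LinearIndependent ℝ W) :
    ∃ B : Module.Basis (Fin (4+n)) ℝ (Fin (4+n) → ℝ), ∀ j, B (Fin.castAdd n j) = W j := by
  have b0 := Module.Basis.sumExtend hW
  have : Finite (Fin 4 ⊕ Module.Basis.sumExtendIndex hW) := Module.Finite.finite_basis b0
  have : Finite (Module.Basis.sumExtendIndex hW) := Finite.of_injective (β := Fin 4 ⊕ Module.Basis.sumExtendIndex hW) _ Sum.inr_injective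
  let _ : Fintype (Module.Basis.sumExtendIndex hW) := Fintype.ofFinite _
  have hcard : Fintype.card (Module.Basis.sumExtendIndex hW) = n := by
    have := Module.finrank_eq_card_basis b0
    simp only [Module.finrank_fin_fun, Fintype.card_sum, Fintype.card_fin] at this
    omega
  let e := (Equiv.sumCongr (Equiv.refl (Fin 4)) (Fintype.equivFinOfCardEq hcard)).trans finSumFinEquiv
  refine ⟨(Module.Basis.sumExtend hW).reindex e, fun j => ?_⟩
  rw [Module.Basis.reindex_apply]
  have : e.symm (Fin.castAdd n j) = Sum.inl j := by
    rw [Equiv.symm_apply_eq]; simp [e]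
  rw [this]
  simp only [Module.Basis.sumExtend, Module.Basis.reindex_apply, Module.Basis.coe_extend]
  rfl

def Phi {n : ℕ} (a b c : ℝ × ℝ → Fin (4+n) → ℝ) (B : Fin (4+n) → Fin (4+n) → ℝ)
    (w : Fin (4+n) → ℝ) : Fin (4+n) → ℝ :=
  a (w (Fin.castAdd n 0), w (Fin.castAdd n 1)) +
  w (Fin.castAdd n 2) • b (w (Fin.castAdd n 0), w (Fin.castAdd n 1)) +
  w (Fin.castAdd n 3) • c (w (Fin.castAdd n 0), w (Fin.castAdd n 1)) +
  ∑ k : Fin n, w (Fin.natAdd 4 k) • B (Fin.natAdd 4 k)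

lemma contDiff_Phi {n : ℕ} (a b c : ℝ × ℝ → Fin (4+n) → ℝ) (B : Fin (4+n) → Fin (4+n) → ℝ)
    (ha : ContDiff ℝ ∞ a) (hb : ContDiff ℝ ∞ b) (hc : ContDiff ℝ ∞ c) :
    ContDiff ℝ ∞ (Phi a b c B) := by
  have ev : ∀ i, ContDiff ℝ ∞ (fun w : Fin (4+n) → ℝ => w i) := fun i => contDiff_apply ℝ ℝ i
  have e2 : ContDiff ℝ ∞ (fun w : Fin (4+n) → ℝ => (w (Fin.castAdd n 0), w (Fin.castAdd n 1))) :=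
    (ev _).prodMk (ev _)
  exact (((ha.comp e2).add ((ev _).smul (hb.comp e2))).add ((ev _).smul (hc.comp e2))).add
    (ContDiff.sum fun k _ => (ev _).smul contDiff_const)

lemma hasFDerivAt_Phi {n : ℕ} (a b c : ℝ × ℝ → Fin (4+n) → ℝ)
    (B : Module.Basis (Fin (4+n)) ℝ (Fin (4+n) → ℝ))
    (ha : ContDiff ℝ ∞ a) (hb : ContDiff ℝ ∞ b) (hc : ContDiff ℝ ∞ c)
    (hB : ∀ j, B (Fin.castAdd n j) = ![fderiv ℝ a 0 (1, 0), fderiv ℝ a 0 (0, 1), b 0, c 0] j) :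
    HasFDerivAt (Phi a b c B) (B.equivFun.symm.toContinuousLinearEquiv :
      (Fin (4+n) → ℝ) →L[ℝ] (Fin (4+n) → ℝ)) 0 := by
  have ev : ∀ i, HasFDerivAt (fun w : Fin (4+n) → ℝ => w i) (ContinuousLinearMap.proj (R := ℝ) i) 0 :=
    fun i => hasFDerivAt_apply i _
  have e2 : HasFDerivAt (fun w : Fin (4+n) → ℝ => (w (Fin.castAdd n 0), w (Fin.castAdd n 1))) _ 0 :=
    (ev (Fin.castAdd n 0)).prodMk (ev (Fin.castAdd n 1))
  have cmp : ∀ f : ℝ × ℝ → Fin (4+n) → ℝ, ContDiff ℝ ∞ f →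
      HasFDerivAt (fun w : Fin (4+n) → ℝ => f (w (Fin.castAdd n 0), w (Fin.castAdd n 1))) _ 0 :=
    fun f hf => HasFDerivAt.comp (g := f) (0 : Fin (4+n) → ℝ) ((hf.differentiable (by simp)) (0,0)).hasFDerivAt e2
  have h : HasFDerivAt (Phi a b c B) _ 0 := 
    (((cmp a ha).add ((ev (Fin.castAdd n 2)).smul (cmp b hb))).add
      ((ev (Fin.castAdd n 3)).smul (cmp c hc))).add
      (HasFDerivAt.fun_sum (u := Finset.univ) fun (k : Fin n) _ => (ev (Fin.natAdd 4 k)).smul_const (B (Fin.natAdd 4 k)))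
  refine h.congr_fderiv ?_
  refine ContinuousLinearMap.ext fun v => ?_
  have hv : ((v (Fin.castAdd n 0), v (Fin.castAdd n 1)) : ℝ × ℝ) =
    v (Fin.castAdd n 0) • (1, 0) + v (Fin.castAdd n 1) • (0, 1) := by simp
  have hE : (B.equivFun.symm.toContinuousLinearEquiv :
      (Fin (4+n) → ℝ) →L[ℝ] (Fin (4+n) → ℝ)) v = ∑ i, v i • B i := B.equivFun_symm_apply v
  rw [hE, Fin.sum_univ_add, Fin.sum_univ_four, hB, hB, hB, hB]
  simp only [add_apply, ContinuousLinearMap.comp_apply,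
    ContinuousLinearMap.prod_apply, ContinuousLinearMap.proj_apply, 
    ContinuousLinearMap.smulRight_apply, sum_apply, Pi.zero_apply, zero_smul, zero_add]
  rw [hv, map_add, map_smul, map_smul]
  simp [add_assoc]
  rfl

end OST

namespace OST
open scoped ContDiff
open Function MeasureTheory

lemma model_lin {n : ℕ} (γ δ : ℝ → Fin (4+n) → ℝ) (hδ : ContDiff ℝ ∞ δ)
    (hδγ : ∀ t : ℝ, deriv γ t = t • δ t) (k : ℕ) :
    iteratedDeriv (k+2) γ 0 = ((k:ℝ)+1) • iteratedDeriv k δ 0 := by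
  rw [iteratedDeriv_succ', funext hδγ, iter_smul δ hδ, zero_smul, add_zero]

noncomputable def model (m : ℕ) (p : ℝ × ℝ) : Fin m → ℝ := fun i : Fin m =>
        if (i : ℕ) = 0 then p.1
        else if (i : ℕ) = 1 then p.2 ^ 3 + p.1 * p.2
        else if (i : ℕ) = 2 then (3/4) * p.2 ^ 4 + (1/2) * p.1 * p.2 ^ 2
        else if (i : ℕ) = 3 then (3/5) * p.2 ^ 5 + (1/3) * p.1 * p.2 ^ 3
        else 0

lemma continuous_model (m : ℕ) : Continuous (model m) := by
  refine continuous_pi fun i => ?_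
  unfold model
  split_ifs <;> fun_prop

lemma Phi_model {n : ℕ} (a b c : ℝ × ℝ → Fin (4+n) → ℝ) (B : Fin (4+n) → Fin (4+n) → ℝ) (u x : ℝ) :
    Phi a b c B (model (4+n) (u, x)) = a (u, x^3+u*x) + (3/4*x^4+1/2*u*x^2) • b (u, x^3+u*x)
        + (3/5*x^5+1/3*u*x^3) • c (u, x^3+u*x) := by
  have h4 : ∀ k : Fin n, model (4+n) (u, x) (Fin.natAdd 4 k) = 0 := fun k => by
    simp only [model, Fin.val_natAdd]
    rw [if_neg (by omega), if_neg (by omega), if_neg (by omega), if_neg (by omega)]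
  have h0 : model (4+n) (u, x) (Fin.castAdd n 0) = u := by simp [model]
  have h1 : model (4+n) (u, x) (Fin.castAdd n 1) = x^3+u*x := by simp [model]
  have h2 : model (4+n) (u, x) (Fin.castAdd n 2) = 3/4*x^4+1/2*u*x^2 := by simp [model]
  have h3 : model (4+n) (u, x) (Fin.castAdd n 3) = 3/5*x^5+1/3*u*x^3 := by simp [model]
  simp only [Phi, h0, h1, h2, h3, h4, zero_smul, Finset.sum_const_zero, add_zero]

theorem main {n : ℕ} (γ δ : ℝ → Fin (4+n) → ℝ) (hγ : ContDiff ℝ ∞ γ) (hδ : ContDiff ℝ ∞ δ)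
    (h2 : iteratedDeriv 2 γ 0 ≠ 0)
    (h5 : Module.finrank ℝ ↥(Submodule.span ℝ
      ({iteratedDeriv 2 γ 0, iteratedDeriv 3 γ 0, iteratedDeriv 4 γ 0,
        iteratedDeriv 5 γ 0} : Set (Fin (4+n) → ℝ))) = 4)
    (hδγ : ∀ t : ℝ, deriv γ t = t • δ t) :
    GermEquiv (fun p : ℝ × ℝ => γ p.2 + p.1 • δ p.2) (0 : ℝ × ℝ) (model (4+n)) (0 : ℝ × ℝ) := by
  have hd : ∀ t, HasDerivAt γ (t • δ t) t := fun t => by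
    rw [← hδγ]; exact ((hγ.differentiable (by simp)) t).hasDerivAt
  have h0 : δ 0 ≠ 0 := by
    intro h
    apply h2
    rw [model_lin γ δ hδ hδγ 0]
    simp [h]
  obtain ⟨p, d, S, h, K, sp, sd, sS, sh, sK, d0, hh0, hgh, hhg, hpg, hKd, hΓ⟩ := param γ δ hγ hδ hd h0
  obtain ⟨a, b, c, sa, sb, sc, hid⟩ := vecA K (fun x => γ (h x)) sK hΓ
  have ht : Tendsto h (𝓝 0) (𝓝 0) := by
    have := sh.continuous.tendsto 0; rwa [hh0] at this
  have hgt : Tendsto (fun t => t * S t) (𝓝 0) (𝓝 0) := by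
    have : Continuous (fun t => t * S t) := by
      have := sS.continuous
      fun_prop
    simpa using this.tendsto 0
  have hdK : ∀ᶠ t in 𝓝 (0:ℝ), d t • K (t * S t) = δ t := by
    filter_upwards [hgt.eventually hKd, hhg] with t h1 h2
    rwa [h2] at h1
  have hmem : ∀ k, k < 4 → iteratedDeriv (k+2) γ 0 ∈ Submodule.span ℝ (Set.range
      ![fderiv ℝ a 0 (1, 0), fderiv ℝ a 0 (0, 1), b 0, c 0]) := fun k hk => by
    rw [model_lin γ δ hδ hδγ k]
    exact Submodule.smul_mem _ _
      (mem_span K _ δ sK hδ hΓ a b c sa sb sc hid d S sd sS hdK k hk)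
  have hLI : LinearIndependent ℝ ![fderiv ℝ a 0 (1, 0), fderiv ℝ a 0 (0, 1), b 0, c 0] := by
    rw [linearIndependent_iff_card_le_finrank_span, Fintype.card_fin]
    refine h5.ge.trans (Submodule.finrank_mono (Submodule.span_le.2 ?_))
    rintro v (rfl | rfl | rfl | rfl)
    · exact hmem 0 (by norm_num)
    · exact hmem 1 (by norm_num)
    · exact hmem 2 (by norm_num)
    · exact hmem 3 (by norm_num)
  obtain ⟨B, hB⟩ := ext_basis _ hLI
  have sPhi := contDiff_Phi a b c B sa sb sc
  have dPhi := hasFDerivAt_Phi a b c B sa sb sc hB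
  have stPhi := sPhi.contDiffAt.hasStrictFDerivAt' (x := 0) dPhi (by simp)
  have m0 : model (4+n) 0 = 0 := by
    ext i
    simp only [model]
    split_ifs <;> simp
  have t1 : Tendsto (fun q : ℝ × ℝ => q.2) (𝓝 0) (𝓝 0) := continuous_snd.tendsto 0
  have hσc : ContDiff ℝ ∞ (fun q : ℝ × ℝ => (p q.2 + q.1 * d q.2, q.2 * S q.2)) := by fun_prop
  have p0 : p 0 = 0 := by simpa using hpg.self_of_nhds
  have hσt : Tendsto (fun q : ℝ × ℝ => (p q.2 + q.1 * d q.2, q.2 * S q.2)) (𝓝 0) (𝓝 0) := by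
    have := hσc.continuous.tendsto 0
    simpa [p0, Prod.mk_zero_zero] using this
  have hdne : ∀ᶠ t in 𝓝 (0:ℝ), d t ≠ 0 := sd.continuous.continuousAt.eventually_ne d0
  have key : ∀ᶠ q : ℝ × ℝ in 𝓝 0, Phi a b c B (model (4+n) (p q.2 + q.1 * d q.2, q.2 * S q.2)) =
      γ q.2 + q.1 • δ q.2 := by
    filter_upwards [t1.eventually (hgt.eventually hid), t1.eventually hhg, t1.eventually hpg,
      t1.eventually hdK] with q k1 k2 k3 k4
    rw [Phi_model, ← k1, k2, k3, ← k4, smul_smul]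
    module
  have f0 : γ (0 : ℝ × ℝ).2 + (0 : ℝ × ℝ).1 • δ (0 : ℝ × ℝ).2 = Phi a b c B 0 := by
    rw [← key.self_of_nhds]
    congr 1
    rw [← m0]
    simp [p0, Prod.mk_zero_zero]
  refine ⟨fun q => (p q.2 + q.1 * d q.2, q.2 * S q.2),
    fun q => ((q.1 + 3 * q.2 ^ 2) / d (h q.2), h q.2), stPhi.localInverse _ _ _, Phi a b c B,
    by simp [p0], ?_, hσc.contDiffAt, ?_, ?_, sPhi.contDiffAt, ?_, ?_, ?_, ?_, ?_⟩
  · simp only [f0]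
    rw [stPhi.localInverse_apply_image, m0]
  · refine ContDiffAt.prodMk (ContDiffAt.div ?_ ?_ ?_) ?_
    · exact ContDiff.contDiffAt (by fun_prop)
    · exact ContDiff.contDiffAt (by fun_prop)
    · simpa [hh0] using d0
    · exact ContDiff.contDiffAt (by fun_prop)
  · simp only [f0]
    exact sPhi.contDiffAt.to_localInverse dPhi (by simp)
  · filter_upwards [t1.eventually hhg, t1.eventually hpg, t1.eventually hdne] with q k1 k2 k3
    ext
    · simp only [k1, k2]
      field_simp
      ring
    · exact k1
  · filter_upwards [t1.eventually hgh, t1.eventually (ht.eventually hpg),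
      t1.eventually (ht.eventually hdne)] with q k1 k2 k3
    ext
    · simp only [k1, k2]
      field_simp
      ring
    · exact k1
  · simp only [f0]
    exact stPhi.eventually_right_inverse
  · rw [m0]
    exact stPhi.eventually_left_inverse
  · have hm : Tendsto (fun q : ℝ × ℝ => model (4+n) (p q.2 + q.1 * d q.2, q.2 * S q.2)) (𝓝 0) (𝓝 0) := by
      have := (continuous_model (4+n)).tendsto 0
      rw [m0] at this
      exact this.comp hσt
    filter_upwards [key, hm.eventually stPhi.eventually_left_inverse] with q k1 k2
    rw [← k1, k2]

end OST

/-- In `ℝ^m`, `m ≥ 4`, the tangent variety to a finite-type curve `γ` of type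
`(2,3,4,5,a₅,…,a_m)` at `0` is locally diffeomorphic to the open swallowtail
`(u, x) ↦ (u, x³ + ux, (3/4)x⁴ + (1/2)ux², (3/5)x⁵ + (1/3)ux³, 0, …, 0)`. -/
theorem tangent_variety_type_2345_open_swallowtail
    (m : ℕ) (hm : 4 ≤ m)
    (γ δ : ℝ → Fin m → ℝ) (hγ : ContDiff ℝ (⊤ : ℕ∞) γ) (hδ : ContDiff ℝ (⊤ : ℕ∞) δ)
    (hfin : Submodule.span ℝ
      (Set.range fun k : ℕ => iteratedDeriv (k + 1) γ 0) = (⊤ : Submodule ℝ (Fin m → ℝ)))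
    (h1 : deriv γ 0 = 0) (h2 : iteratedDeriv 2 γ 0 ≠ 0)
    (h3 : Module.finrank ℝ ↥(Submodule.span ℝ
      ({iteratedDeriv 2 γ 0, iteratedDeriv 3 γ 0} : Set (Fin m → ℝ))) = 2)
    (h4 : Module.finrank ℝ ↥(Submodule.span ℝ
      ({iteratedDeriv 2 γ 0, iteratedDeriv 3 γ 0, iteratedDeriv 4 γ 0} : Set (Fin m → ℝ))) = 3)
    (h5 : Module.finrank ℝ ↥(Submodule.span ℝ
      ({iteratedDeriv 2 γ 0, iteratedDeriv 3 γ 0, iteratedDeriv 4 γ 0,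
        iteratedDeriv 5 γ 0} : Set (Fin m → ℝ))) = 4)
    (hδγ : ∀ t : ℝ, deriv γ t = t • δ t) :
    GermEquiv (fun p : ℝ × ℝ => γ p.2 + p.1 • δ p.2) (0 : ℝ × ℝ)
      (fun p : ℝ × ℝ => fun i : Fin m =>
        if (i : ℕ) = 0 then p.1
        else if (i : ℕ) = 1 then p.2 ^ 3 + p.1 * p.2
        else if (i : ℕ) = 2 then (3/4) * p.2 ^ 4 + (1/2) * p.1 * p.2 ^ 2
        else if (i : ℕ) = 3 then (3/5) * p.2 ^ 5 + (1/3) * p.1 * p.2 ^ 3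
        else 0) (0 : ℝ × ℝ) := by
  obtain ⟨n, rfl⟩ := Nat.exists_eq_add_of_le hm
  exact OST.main γ δ hγ hδ h2 h5 hδγ
end

section
/- Let m ≥ 4 and let γ : ℝ → ℝ^m be a C^∞ curve of finite type at 0 such that γ'(0) and γ''(0) are linearly independent, γ'''(0) ∈ span{γ'(0), γ''(0)}, dim span{γ'(0), …, γ⁽⁴⁾(0)} = 3, and dim span{γ'(0), …, γ⁽⁵⁾(0)} = 4 (i.e. γ has type (1,2,4,5,a₅,…,a_m) at 0). Then the tangent map-germ Tan(γ)(s,t) = γ(t) + s·γ'(t) at (0,0) is diffeomorphic (right–left equivalent) to the open folded umbrella map-germ (u,x) ↦ (u, x² + ux, (1/2)x⁴ + (1/3)ux³, (2/5)x⁵ + (1/4)ux⁴, 0, …, 0) : (ℝ², 0) → (ℝ^m, 0). -/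
open Filter Topology

open MeasureTheory

/-- smooth with all derivatives bounded -/
def BD (a : ℝ → ℂ) : Prop :=
  ContDiff ℝ (⊤ : ℕ∞) a ∧ ∀ n : ℕ, ∃ C : ℝ, ∀ y, ‖iteratedDeriv n a y‖ ≤ C

/-- all moments are integrable -/
def Mom (μ : Measure ℝ) (F : ℝ → ℂ) : Prop :=
  ∀ n : ℕ, Integrable (fun ξ : ℝ => (ξ : ℂ) ^ n * F ξ) μ

theorem BD.deriv {a : ℝ → ℂ} (h : BD a) : BD (deriv a) := by
  refine ⟨?_, fun n => ?_⟩
  · have h1 : ContDiff ℝ ((⊤ : ℕ∞) + 1 : WithTop ℕ∞) a := by simpa using h.1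
    exact (contDiff_succ_iff_deriv.1 h1).2.2
  · obtain ⟨C, hC⟩ := h.2 (n + 1)
    exact ⟨C, fun y => by rw [← iteratedDeriv_succ']; exact hC y⟩

theorem BD.bound {a : ℝ → ℂ} (h : BD a) : ∃ C : ℝ, 0 ≤ C ∧ ∀ y, ‖a y‖ ≤ C := by
  obtain ⟨C, hC⟩ := h.2 0
  simp only [iteratedDeriv_zero] at hC
  exact ⟨C, (norm_nonneg _).trans (hC 0), hC⟩

theorem BD.hasDerivAt {a : ℝ → ℂ} (h : BD a) (y : ℝ) : HasDerivAt a (_root_.deriv a y) y :=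
  (h.1.differentiable (by simp) y).hasDerivAt

theorem BD.const (c : ℂ) : BD (fun _ => c) := by
  refine ⟨contDiff_const, fun n => ?_⟩
  refine ⟨‖c‖, fun y => ?_⟩
  rw [iteratedDeriv_const]
  split_ifs <;> simp

theorem Mom.mul {μ : Measure ℝ} {F : ℝ → ℂ} (h : Mom μ F) (k : ℕ) :
    Mom μ (fun ξ => (ξ : ℂ) ^ k * F ξ) := by
  intro n
  refine (h (n + k)).congr (Eventually.of_forall fun ξ => ?_)
  simp only [pow_add]; ring

theorem Mom.constMul {μ : Measure ℝ} {F : ℝ → ℂ} (h : Mom μ F) (c : ℂ) :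
    Mom μ (fun ξ => c * F ξ) := by
  intro n
  refine ((h n).const_mul c).congr (Eventually.of_forall fun ξ => ?_)
  simp only []; ring

theorem Mom.int {μ : Measure ℝ} {F : ℝ → ℂ} (h : Mom μ F) : Integrable F μ := by
  simpa using h 0

/-- the basic oscillatory integral -/
noncomputable def GG (μ : Measure ℝ) (F : ℝ → ℂ) (a b : ℝ → ℂ) (p : ℝ × ℝ) : ℂ :=
  ∫ ξ, F ξ * a (p.1 * ξ) * b (p.2 * ξ ^ 2) ∂μ

theorem GG_integrable {μ : Measure ℝ} {F : ℝ → ℂ} {a b : ℝ → ℂ} (hF : Mom μ F) (ha : BD a)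
    (hb : BD b) (p : ℝ × ℝ) :
    Integrable (fun ξ => F ξ * a (p.1 * ξ) * b (p.2 * ξ ^ 2)) μ := by
  obtain ⟨C, hC0, hC⟩ := ha.bound
  obtain ⟨D, hD0, hD⟩ := hb.bound
  have ca := ha.1.continuous
  have cb := hb.1.continuous
  refine (hF.int.mul_bdd (c := C) ?_ (Eventually.of_forall fun ξ => hC _)).mul_bdd (c := D) ?_
    (Eventually.of_forall fun ξ => hD _)
  · exact (by fun_prop : Continuous fun ξ : ℝ => a (p.1 * ξ)).aestronglyMeasurable
  · exact (by fun_prop : Continuous fun ξ : ℝ => b (p.2 * ξ ^ 2)).aestronglyMeasurable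

theorem GG_hasFDerivAt {μ : Measure ℝ} {F : ℝ → ℂ} {a b : ℝ → ℂ} (hF : Mom μ F) (ha : BD a)
    (hb : BD b) (p : ℝ × ℝ) :
    HasFDerivAt (GG μ F a b)
      ((ContinuousLinearMap.fst ℝ ℝ ℝ).smulRight
          (GG μ (fun ξ => (ξ : ℂ) ^ 1 * F ξ) (deriv a) b p) +
        (ContinuousLinearMap.snd ℝ ℝ ℝ).smulRight
          (GG μ (fun ξ => (ξ : ℂ) ^ 2 * F ξ) a (deriv b) p)) p := by
  obtain ⟨C, hC0, hC⟩ := ha.bound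
  obtain ⟨D, hD0, hD⟩ := hb.bound
  obtain ⟨C', hC0', hC'⟩ := ha.deriv.bound
  obtain ⟨D', hD0', hD'⟩ := hb.deriv.bound
  have i1 := GG_integrable (hF.mul 1) ha.deriv hb p
  have i2 := GG_integrable (hF.mul 2) ha hb.deriv p
  let T1 : ℂ →L[ℝ] (ℝ × ℝ →L[ℝ] ℂ) :=
    ContinuousLinearMap.smulRightL ℝ (ℝ × ℝ) ℂ (ContinuousLinearMap.fst ℝ ℝ ℝ)
  let T2 : ℂ →L[ℝ] (ℝ × ℝ →L[ℝ] ℂ) :=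
    ContinuousLinearMap.smulRightL ℝ (ℝ × ℝ) ℂ (ContinuousLinearMap.snd ℝ ℝ ℝ)
  let F' : ℝ × ℝ → ℝ → (ℝ × ℝ →L[ℝ] ℂ) := fun q ξ =>
    T1 ((ξ : ℂ) ^ 1 * F ξ * deriv a (q.1 * ξ) * b (q.2 * ξ ^ 2)) +
    T2 ((ξ : ℂ) ^ 2 * F ξ * a (q.1 * ξ) * deriv b (q.2 * ξ ^ 2))
  have key : HasFDerivAt (GG μ F a b) (∫ ξ, F' p ξ ∂μ) p := by
    refine hasFDerivAt_integral_of_dominated_of_fderiv_le (s := Set.univ)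
      (bound := fun ξ : ℝ => ‖T1‖ * (‖(ξ : ℂ) ^ 1 * F ξ‖ * C' * D) + ‖T2‖ * (‖(ξ : ℂ) ^ 2 * F ξ‖ * C * D'))
      univ_mem ?_ (GG_integrable hF ha hb p) ?_ ?_ ?_ ?_
    · exact Eventually.of_forall fun q => (GG_integrable hF ha hb q).aestronglyMeasurable
    · exact ((T1.integrable_comp i1).add (T2.integrable_comp i2)).aestronglyMeasurable
    · refine Eventually.of_forall fun ξ q _ => ?_
      refine (norm_add_le _ _).trans (add_le_add ?_ ?_)
      · refine (T1.le_opNorm _).trans (mul_le_mul_of_nonneg_left ?_ (norm_nonneg _))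
        rw [norm_mul, norm_mul]
        have := hC' (q.1 * ξ)
        have := hD (q.2 * ξ ^ 2)
        gcongr
      · refine (T2.le_opNorm _).trans (mul_le_mul_of_nonneg_left ?_ (norm_nonneg _))
        rw [norm_mul, norm_mul]
        have := hC (q.1 * ξ)
        have := hD' (q.2 * ξ ^ 2)
        gcongr
    · exact ((((hF 1).norm.mul_const C').mul_const D).const_mul _).add
        ((((hF 2).norm.mul_const C).mul_const D').const_mul _)
    · refine Eventually.of_forall fun ξ q _ => ?_
      have h1 : HasFDerivAt (fun q : ℝ × ℝ => a (q.1 * ξ))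
          ((ContinuousLinearMap.toSpanSingleton ℝ (deriv a (q.1 * ξ))).comp
            (ξ • ContinuousLinearMap.fst ℝ ℝ ℝ)) q :=
        (ha.hasDerivAt (q.1 * ξ)).hasFDerivAt.comp q (hasFDerivAt_fst.mul_const ξ)
      have h2 : HasFDerivAt (fun q : ℝ × ℝ => b (q.2 * ξ ^ 2))
          ((ContinuousLinearMap.toSpanSingleton ℝ (deriv b (q.2 * ξ ^ 2))).comp
            (ξ ^ 2 • ContinuousLinearMap.snd ℝ ℝ ℝ)) q :=
        (hb.hasDerivAt (q.2 * ξ ^ 2)).hasFDerivAt.comp q (hasFDerivAt_snd.mul_const (ξ ^ 2))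
      have h3 := (h1.const_mul (F ξ)).mul h2
      refine h3.congr_fderiv ?_
      ext
      · simp [F', T1, T2]; ring
      · simp [F', T1, T2]; ring
  refine key.congr_fderiv ?_
  have : ∫ ξ, F' p ξ ∂μ = T1 (GG μ (fun ξ => (ξ : ℂ) ^ 1 * F ξ) (deriv a) b p) +
      T2 (GG μ (fun ξ => (ξ : ℂ) ^ 2 * F ξ) a (deriv b) p) := by
    unfold GG
    rw [← T1.integral_comp_comm i1, ← T2.integral_comp_comm i2]
    exact integral_add (T1.integrable_comp i1) (T2.integrable_comp i2)
  rw [this]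
  rfl

theorem GG_contDiff {μ : Measure ℝ} {F : ℝ → ℂ} {a b : ℝ → ℂ} (hF : Mom μ F) (ha : BD a)
    (hb : BD b) : ContDiff ℝ (⊤ : ℕ∞) (GG μ F a b) := by
  rw [contDiff_infty]
  intro n
  induction n generalizing F a b with
  | zero =>
    exact contDiff_zero.2 (continuous_iff_continuousAt.2
      fun p => (GG_hasFDerivAt hF ha hb p).continuousAt)
  | succ n ih =>
    rw [Nat.cast_add, Nat.cast_one, contDiff_succ_iff_hasFDerivAt]
    refine ⟨_, ?_, fun p => GG_hasFDerivAt hF ha hb p⟩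
    exact (contDiff_const.smulRight (ih (hF.mul 1) ha.deriv hb)).add
      (contDiff_const.smulRight (ih (hF.mul 2) ha hb.deriv))

/-- the one-variable integral -/
theorem GG_hasDerivAt {μ : Measure ℝ} {F : ℝ → ℂ} {a : ℝ → ℂ} (hF : Mom μ F) (ha : BD a) (t : ℝ) :
    HasDerivAt (fun t => ∫ ξ, F ξ * a (t * ξ) ∂μ)
      (∫ ξ, ((ξ : ℂ) ^ 1 * F ξ) * deriv a (t * ξ) ∂μ) t := by
  have h := (GG_hasFDerivAt hF ha (BD.const 1) (t, 0)).comp_hasDerivAt t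
    (f := fun t : ℝ => ((t, 0) : ℝ × ℝ)) (f' := (1, 0))
    ((hasDerivAt_id t).prodMk (hasDerivAt_const t 0))
  simpa [GG, Function.comp_def] using h

theorem HH_iteratedDeriv {μ : Measure ℝ} {F : ℝ → ℂ} {a : ℝ → ℂ} (hF : Mom μ F) (ha : BD a)
    (n : ℕ) : ∃ C, ∀ t, ‖iteratedDeriv n (fun t => ∫ ξ, F ξ * a (t * ξ) ∂μ) t‖ ≤ C := by
  induction n generalizing F a with
  | zero =>
    obtain ⟨C, hC0, hC⟩ := ha.bound
    refine ⟨∫ ξ, ‖F ξ‖ * C ∂μ, fun t => ?_⟩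
    simp only [iteratedDeriv_zero]
    refine norm_integral_le_of_norm_le (hF.int.norm.mul_const C) (Eventually.of_forall fun ξ => ?_)
    rw [norm_mul]
    exact mul_le_mul_of_nonneg_left (hC _) (norm_nonneg _)
  | succ n ih =>
    obtain ⟨C, hC⟩ := ih (hF.mul 1) ha.deriv
    refine ⟨C, fun t => ?_⟩
    rw [iteratedDeriv_succ']
    have : deriv (fun t => ∫ ξ, F ξ * a (t * ξ) ∂μ) =
      (fun t => ∫ ξ, ((ξ : ℂ) ^ 1 * F ξ) * deriv a (t * ξ) ∂μ) :=
      funext fun t => (GG_hasDerivAt hF ha t).deriv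
    rw [this]
    exact hC t

theorem HH_BD {μ : Measure ℝ} {F : ℝ → ℂ} {a : ℝ → ℂ} (hF : Mom μ F) (ha : BD a) :
    BD (fun t => ∫ ξ, F ξ * a (t * ξ) ∂μ) := by
  refine ⟨?_, HH_iteratedDeriv hF ha⟩
  have h := (GG_contDiff hF ha (BD.const 1)).comp
    (contDiff_id.prodMk contDiff_const : ContDiff ℝ (⊤ : ℕ∞) fun t : ℝ => ((t, 0) : ℝ × ℝ))
  simpa [GG, Function.comp_def] using h

theorem BD.hadamard {a : ℝ → ℂ} (ha : BD a) :
    ∃ k : ℝ → ℂ, BD k ∧ k 0 = _root_.deriv a 0 ∧ ∀ y : ℝ, a y = a 0 + y * k y := by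
  have hF : Mom (volume.restrict (Set.Ioc (0 : ℝ) 1)) (fun _ => 1) := by
    intro n
    have : Continuous fun ξ : ℝ => (ξ : ℂ) ^ n * 1 := by fun_prop
    exact (this.integrableOn_Icc (a := 0) (b := 1)).mono_set Set.Ioc_subset_Icc_self
  refine ⟨_, HH_BD hF ha.deriv, by simp, fun y => ?_⟩
  simp only [one_mul]
  rw [← intervalIntegral.integral_of_le zero_le_one, ← intervalIntegral.integral_const_mul]
  have h : ∀ θ : ℝ, HasDerivAt (fun θ : ℝ => a (y * θ)) ((y : ℂ) * _root_.deriv a (y * θ)) θ := by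
    intro θ
    have := (ha.hasDerivAt (y * θ)).scomp θ ((hasDerivAt_id θ).const_mul y)
    simpa [Function.comp_def] using this
  have hc := ha.deriv.1.continuous
  rw [intervalIntegral.integral_eq_sub_of_hasDerivAt (fun θ _ => h θ)
    (by apply Continuous.intervalIntegrable; fun_prop)]
  simp

theorem exists_cosSqrt : ∃ c : ℝ → ℝ, ContDiff ℝ (⊤ : ℕ∞) c ∧ ∀ x, c (x ^ 2) = Real.cos x := by
  let k : ℕ → ℝ := fun n => (-1) ^ n / ((2 * n).factorial : ℝ)
  have hk : ∀ n, k n ≠ 0 := fun n => by simp [k, Nat.factorial_ne_zero]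
  have hr : (FormalMultilinearSeries.ofScalars ℝ k).radius = ⊤ := by
    refine FormalMultilinearSeries.ofScalars_radius_eq_top_of_tendsto ℝ k
      (Eventually.of_forall hk) ?_
    have : ∀ n, ‖k n.succ‖ / ‖k n‖ ≤ 1 / ((n : ℝ) + 1) := by
      intro n
      have h1 : (2 * n.succ).factorial = (2 * n + 2) * ((2 * n + 1) * (2 * n).factorial) := by
        rw [Nat.succ_eq_add_one, show 2 * (n + 1) = 2 * n + 1 + 1 by ring, Nat.factorial_succ,
          Nat.factorial_succ]
      have h0 : ((2 * n).factorial : ℝ) ≠ 0 := by positivity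
      simp only [k, norm_div, norm_pow, norm_neg, norm_one, one_pow, h1]
      push_cast
      simp only [norm_mul, RCLike.norm_natCast]
      rw [Real.norm_of_nonneg (by positivity), Real.norm_of_nonneg (by positivity)]
      rw [div_div_eq_mul_div, div_one, div_mul_eq_mul_div, one_mul, div_le_div_iff₀ (by positivity) (by positivity)]
      have : (0:ℝ) < ((2 * n).factorial : ℝ) := by positivity
      have hn : (0:ℝ) ≤ n := by positivity
      nlinarith [mul_nonneg hn hn, mul_nonneg (mul_nonneg hn hn) this.le, mul_nonneg hn this.le]
    exact squeeze_zero (fun n => by positivity) this tendsto_one_div_add_atTop_nhds_zero_nat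
  refine ⟨FormalMultilinearSeries.ofScalarsSum k, ?_, fun x => ?_⟩
  · have h := (FormalMultilinearSeries.ofScalars ℝ k).hasFPowerSeriesOnBall (by rw [hr]; simp)
    rw [hr] at h
    have h2 : AnalyticOnNhd ℝ (FormalMultilinearSeries.ofScalars ℝ k).sum Set.univ := by
      have := h.analyticOnNhd
      simpa using this
    exact (contDiffOn_univ.1 (h2.contDiffOn uniqueDiffOn_univ))
  · rw [FormalMultilinearSeries.ofScalars_sum_eq]
    rw [← (Real.hasSum_cos x).tsum_eq]
    refine tsum_congr fun n => ?_
    simp only [k, smul_eq_mul, ← pow_mul]; ring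

theorem exists_E0 : ∃ E : ℝ → ℂ, ContDiff ℝ (⊤ : ℕ∞) E ∧ (∀ x : ℝ, E (x ^ 2) = Complex.cos x) ∧
    ∀ y, y ≤ -2 → E y = 0 := by
  obtain ⟨c, hc, hcos⟩ := exists_cosSqrt
  refine ⟨fun y => ((Real.smoothTransition (y + 2) * c y : ℝ) : ℂ), ?_, fun x => ?_, fun y hy => ?_⟩
  · refine Complex.ofRealCLM.contDiff.comp (ContDiff.mul ?_ hc)
    exact Real.smoothTransition.contDiff.comp (contDiff_id.add contDiff_const)
  · simp only []
    rw [Real.smoothTransition.one_of_one_le (by nlinarith [sq_nonneg x]), hcos]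
    simp
  · simp only []
    rw [Real.smoothTransition.zero_of_nonpos (by linarith)]
    simp

theorem smooth_iter {E : ℝ → ℂ} (hE : ContDiff ℝ (⊤ : ℕ∞) E) (n : ℕ) :
    ContDiff ℝ (⊤ : ℕ∞) (iteratedDeriv n E) := by
  induction n with
  | zero => simpa using hE
  | succ n ih =>
    rw [iteratedDeriv_succ]
    have h1 : ContDiff ℝ ((⊤ : ℕ∞) + 1 : WithTop ℕ∞) (iteratedDeriv n E) := by simpa using ih
    exact (contDiff_succ_iff_deriv.1 h1).2.2

theorem smooth_iter_hasDeriv {E : ℝ → ℂ} (hE : ContDiff ℝ (⊤ : ℕ∞) E) (n : ℕ) (y : ℝ) :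
    HasDerivAt (iteratedDeriv n E) (iteratedDeriv (n + 1) E y) y := by
  rw [iteratedDeriv_succ]
  exact ((smooth_iter hE n).differentiable (by simp) y).hasDerivAt

theorem E_d1 {E : ℝ → ℂ} (hE : ContDiff ℝ (⊤ : ℕ∞) E)
    (hcos : ∀ x : ℝ, E (x ^ 2) = Complex.cos x) (x : ℝ) :
    2 * x * iteratedDeriv 1 E (x ^ 2) = - Complex.sin x := by
  have h1 : HasDerivAt (fun x : ℝ => E (x ^ 2)) (2 * x * iteratedDeriv 1 E (x ^ 2)) x := by
    have := (smooth_iter_hasDeriv hE 0 (x ^ 2)).scomp x (hasDerivAt_pow 2 x)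
    simpa [Function.comp_def] using this
  have h2 : HasDerivAt (fun x : ℝ => E (x ^ 2)) (- Complex.sin x) x := by
    simp only [hcos]
    exact (Complex.hasDerivAt_cos x).comp_ofReal
  exact h1.unique h2

theorem E_d2 {E : ℝ → ℂ} (hE : ContDiff ℝ (⊤ : ℕ∞) E)
    (hcos : ∀ x : ℝ, E (x ^ 2) = Complex.cos x) (x : ℝ) :
    2 * iteratedDeriv 1 E (x ^ 2) + 4 * x ^ 2 * iteratedDeriv 2 E (x ^ 2) = - Complex.cos x := by
  have h1 : HasDerivAt (fun x : ℝ => (2 * x : ℂ) * iteratedDeriv 1 E (x ^ 2))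
      (2 * iteratedDeriv 1 E (x ^ 2) + 2 * x * (2 * x * iteratedDeriv 2 E (x ^ 2))) x := by
    have h := (smooth_iter_hasDeriv hE 1 (x ^ 2)).scomp x (hasDerivAt_pow 2 x)
    have h' : HasDerivAt (fun x : ℝ => (2 * x : ℂ)) 2 x := by
      simpa using ((hasDerivAt_id (x : ℂ)).comp_ofReal).const_mul (2 : ℂ)
    have h3 := h'.mul h
    refine h3.congr_deriv ?_
    simp
  have h2 : HasDerivAt (fun x : ℝ => (2 * x : ℂ) * iteratedDeriv 1 E (x ^ 2)) (- Complex.cos x) x := by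
    simp only [E_d1 hE hcos]
    exact (Complex.hasDerivAt_sin x).comp_ofReal.neg
  rw [← h1.unique h2]; ring

theorem E_ode {E : ℝ → ℂ} (hE : ContDiff ℝ (⊤ : ℕ∞) E)
    (hcos : ∀ x : ℝ, E (x ^ 2) = Complex.cos x) (n : ℕ) : ∀ y : ℝ, 0 ≤ y →
    4 * (y : ℂ) * iteratedDeriv (n + 2) E y + (4 * n + 2) * iteratedDeriv (n + 1) E y
      + iteratedDeriv n E y = 0 := by
  induction n with
  | zero =>
    intro y hy
    have h := E_d2 hE hcos (Real.sqrt y)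
    rw [← hcos, Real.sq_sqrt hy, ← Complex.ofReal_pow, Real.sq_sqrt hy] at h
    simp only [zero_add, iteratedDeriv_zero, Nat.cast_zero, mul_zero]
    linear_combination h
  | succ n ih =>
    have pos : ∀ y : ℝ, 0 < y →
        4 * (y : ℂ) * iteratedDeriv (n + 1 + 2) E y
          + (4 * ((n + 1 : ℕ) : ℂ) + 2) * iteratedDeriv (n + 1 + 1) E y
          + iteratedDeriv (n + 1) E y = 0 := by
      intro y hy
      have h' : HasDerivAt (fun x : ℝ => (4 * x : ℂ)) 4 y := by
        simpa using ((hasDerivAt_id (y : ℂ)).comp_ofReal).const_mul (4 : ℂ)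
      have h1 := ((h'.mul (smooth_iter_hasDeriv hE (n + 2) y)).add
        ((smooth_iter_hasDeriv hE (n + 1) y).const_mul (4 * (n : ℂ) + 2))).add
        (smooth_iter_hasDeriv hE n y)
      have h2 := h1.congr_of_eventuallyEq (f₁ := fun _ => (0 : ℂ)) (by
        filter_upwards [lt_mem_nhds hy] with z hz
        exact (ih z hz.le).symm)
      have := h2.unique (hasDerivAt_const y (0 : ℂ))
      rw [show n + 1 + 2 = n + 2 + 1 by ring, show n + 1 + 1 = n + 2 by ring]
      push_cast
      linear_combination this
    have hcl : IsClosed {y : ℝ | 4 * (y : ℂ) * iteratedDeriv (n + 1 + 2) E y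
          + (4 * ((n + 1 : ℕ) : ℂ) + 2) * iteratedDeriv (n + 1 + 1) E y
          + iteratedDeriv (n + 1) E y = 0} := by
      have c1 := (smooth_iter hE (n + 1 + 2)).continuous
      have c2 := (smooth_iter hE (n + 1 + 1)).continuous
      have c3 := (smooth_iter hE (n + 1)).continuous
      exact isClosed_eq (by fun_prop) continuous_const
    intro y hy
    have hsub := hcl.closure_subset_iff.2 (fun y (hy : y ∈ Set.Ioi (0 : ℝ)) => pos y hy)
    rw [closure_Ioi] at hsub
    exact hsub hy

theorem exists_E : ∃ E : ℝ → ℂ, BD E ∧ (∀ x : ℝ, E (x ^ 2) = Complex.cos x) := by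
  obtain ⟨E, hE, hcos, hz⟩ := exists_E0
  refine ⟨E, ⟨hE, ?_⟩, hcos⟩
  -- bound on `[1, ∞)`
  have hb : ∀ n : ℕ, (∃ C : ℝ, ∀ y, 1 ≤ y → ‖iteratedDeriv n E y‖ ≤ C) ∧
      (∃ C : ℝ, ∀ y, 1 ≤ y → ‖iteratedDeriv (n + 1) E y‖ ≤ C) := by
    intro n
    induction n with
    | zero =>
      constructor
      · refine ⟨1, fun y hy => ?_⟩
        have h := hcos (Real.sqrt y)
        rw [Real.sq_sqrt (by linarith)] at h
        rw [iteratedDeriv_zero, h, ← Complex.ofReal_cos, Complex.norm_real]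
        exact Real.abs_cos_le_one _
      · refine ⟨1, fun y hy => ?_⟩
        have h := E_d1 hE hcos (Real.sqrt y)
        rw [Real.sq_sqrt (by linarith)] at h
        have h2 := congrArg norm h
        rw [norm_neg, norm_mul, norm_mul, ← Complex.ofReal_sin, Complex.norm_real,
          Complex.norm_real, Real.norm_of_nonneg (Real.sqrt_nonneg y)] at h2
        have h3 : (1 : ℝ) ≤ Real.sqrt y := by rw [Real.one_le_sqrt]; exact hy
        have h4 := Real.abs_sin_le_one (Real.sqrt y)
        rw [Real.norm_eq_abs] at h2
        simp only [Complex.norm_ofNat] at h2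
        simp only [zero_add]
        nlinarith [norm_nonneg (iteratedDeriv 1 E y)]
    | succ n ih =>
      refine ⟨ih.2, ?_⟩
      obtain ⟨⟨C, hC⟩, ⟨D, hD⟩⟩ := ih
      refine ⟨(4 * n + 2) * D + C, fun y hy => ?_⟩
      have h := E_ode hE hcos n y (by linarith)
      have h1 : 4 * (y : ℂ) * iteratedDeriv (n + 2) E y =
        - ((4 * n + 2) * iteratedDeriv (n + 1) E y + iteratedDeriv n E y) := by
        linear_combination h
      have h2 := congrArg norm h1
      rw [norm_neg, norm_mul, norm_mul, Complex.norm_real, Real.norm_of_nonneg (by linarith)] at h2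
      have h3 : ‖(4 * (n : ℂ) + 2) * iteratedDeriv (n + 1) E y + iteratedDeriv n E y‖ ≤
          (4 * n + 2) * D + C := by
        refine (norm_add_le _ _).trans (add_le_add ?_ (hC y hy))
        rw [norm_mul]
        have : ‖(4 * (n : ℂ) + 2)‖ = 4 * n + 2 := by
          have : (4 * (n : ℂ) + 2) = ((4 * n + 2 : ℝ) : ℂ) := by push_cast; ring
          rw [this, Complex.norm_real, Real.norm_of_nonneg (by positivity)]
        rw [this]
        exact mul_le_mul_of_nonneg_left (hD y hy) (by positivity)
      rw [← h2] at h3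
      simp only [Complex.norm_ofNat] at h3
      rw [show n + 1 + 1 = n + 2 by ring]
      nlinarith [norm_nonneg (iteratedDeriv (n + 2) E y)]
  intro n
  obtain ⟨C, hC⟩ := (hb n).1
  obtain ⟨D, hD⟩ := (isCompact_Icc (a := (-2 : ℝ)) (b := 1)).exists_bound_of_continuousOn
    (smooth_iter hE n).continuous.continuousOn
  refine ⟨max C D, fun y => ?_⟩
  rcases le_or_gt 1 y with h1 | h1
  · exact (hC y h1).trans (le_max_left _ _)
  rcases le_or_gt (-2) y with h2 | h2
  · exact (hD y ⟨h2, h1.le⟩).trans (le_max_right _ _)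
  · have : E =ᶠ[𝓝 y] fun _ => 0 := by
      filter_upwards [gt_mem_nhds h2] with z hz'
      exact hz z (le_of_lt hz')
    rw [this.iteratedDeriv_eq n]
    have h0 : iteratedDeriv n (fun _ : ℝ => (0 : ℂ)) y = 0 := by
      rw [iteratedDeriv_const]; split_ifs <;> rfl
    rw [h0, norm_zero]
    exact (norm_nonneg _).trans ((hD 0 (by norm_num)).trans (le_max_right _ _))

theorem exp_BD : BD (fun y : ℝ => Complex.exp (y * Complex.I)) := by
  have hd : ∀ n : ℕ, iteratedDeriv n (fun y : ℝ => Complex.exp (y * Complex.I)) =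
      fun y : ℝ => Complex.I ^ n * Complex.exp (y * Complex.I) := by
    intro n
    induction n with
    | zero => simp
    | succ n ih =>
      rw [iteratedDeriv_succ, ih]
      funext y
      have h : HasDerivAt (fun y : ℝ => Complex.exp (y * Complex.I))
          (Complex.exp (y * Complex.I) * Complex.I) y := by
        have := (((hasDerivAt_id (y : ℂ)).mul_const Complex.I).cexp).comp_ofReal
        simpa using this
      rw [(h.const_mul (Complex.I ^ n)).deriv]
      ring
  refine ⟨Complex.contDiff_exp.comp (Complex.ofRealCLM.contDiff.mul contDiff_const), fun n => ⟨1, fun y => ?_⟩⟩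
  rw [hd]
  simp [Complex.norm_exp_ofReal_mul_I]

/-- the exponential kernel -/
noncomputable def ek (y : ℝ) : ℂ := Complex.exp (y * Complex.I)

theorem ek_BD : BD ek := exp_BD

theorem ek_deriv (y : ℝ) : deriv ek y = Complex.I * ek y := by
  have h : HasDerivAt (fun y : ℝ => Complex.exp (y * Complex.I))
      (Complex.exp (y * Complex.I) * Complex.I) y := by
    have := (((hasDerivAt_id (y : ℂ)).mul_const Complex.I).cexp).comp_ofReal
    simpa using this
  have h2 : HasDerivAt ek (Complex.exp (y * Complex.I) * Complex.I) y := h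
  rw [h2.deriv, ek]; ring

theorem ek_zero : ek 0 = 1 := by simp [ek]

theorem exists_rep (h : ℝ → ℝ) (hh : ContDiff ℝ (⊤ : ℕ∞) h) :
    ∃ F : ℝ → ℂ, Mom volume F ∧ ∀ᶠ t in 𝓝 (0 : ℝ), (h t : ℂ) = ∫ ξ, F ξ * ek (t * ξ) := by
  let χ : ContDiffBump (0 : ℝ) := ⟨1, 2, by norm_num, by norm_num⟩
  let g : ℝ → ℂ := fun t => ((χ t * h (2 * Real.pi * t) : ℝ) : ℂ)
  have hg : ContDiff ℝ (⊤ : ℕ∞) g := by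
    refine Complex.ofRealCLM.contDiff.comp (χ.contDiff.mul ?_)
    exact hh.comp (contDiff_const.mul contDiff_id)
  have hs : HasCompactSupport g := by
    refine HasCompactSupport.intro (K := tsupport χ) χ.hasCompactSupport fun x hx => ?_
    simp [g, image_eq_zero_of_notMem_tsupport hx]
  let G : SchwartzMap ℝ ℂ := hs.toSchwartzMap hg
  refine ⟨FourierTransform.fourier G, fun n => ?_, ?_⟩
  · have h1 := SchwartzMap.integrable_pow_mul volume (FourierTransform.fourier G) n
    refine (integrable_norm_iff ?_).1 (h1.congr (Eventually.of_forall fun ξ => ?_))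
    · have := (FourierTransform.fourier G).continuous
      exact (by fun_prop : Continuous fun ξ : ℝ => (ξ : ℂ) ^ n * (FourierTransform.fourier G) ξ).aestronglyMeasurable
    · simp
  · have hev : ∀ᶠ t in 𝓝 (0 : ℝ), χ (t / (2 * Real.pi)) = 1 := by
      have : Tendsto (fun t : ℝ => t / (2 * Real.pi)) (𝓝 0) (𝓝 0) := by
        have : Continuous fun t : ℝ => t / (2 * Real.pi) := by fun_prop
        simpa using this.tendsto 0
      exact this.eventually χ.eventuallyEq_one
    filter_upwards [hev] with t ht
    have h1 : FourierTransformInv.fourierInv (FourierTransform.fourier G) = G :=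
      FourierTransform.fourierInv_fourier_eq G
    have h2 : g (t / (2 * Real.pi)) = (h t : ℂ) := by
      simp only [g, ht, one_mul]
      rw [mul_div_cancel₀ _ (by positivity)]
    have h3 : G (t / (2 * Real.pi)) = g (t / (2 * Real.pi)) := rfl
    rw [← h2, ← h3]
    conv_lhs => rw [← h1]
    rw [SchwartzMap.fourierInv_coe, Real.fourierInv_eq]
    refine integral_congr_ae (Eventually.of_forall fun ξ => ?_)
    simp only [Circle.smul_def, Real.fourierChar_apply, smul_eq_mul, ek, mul_comm ((FourierTransform.fourier G) ξ)]
    congr 3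
    simp only [RCLike.inner_apply, conj_trivial]
    push_cast
    have : (Real.pi : ℂ) ≠ 0 := by exact_mod_cast Real.pi_ne_zero
    field_simp

theorem rep_derivs (h : ℝ → ℝ) (hh : ContDiff ℝ (⊤ : ℕ∞) h) {F : ℝ → ℂ} (hF : Mom volume F)
    (hrep : ∀ᶠ t in 𝓝 (0 : ℝ), (h t : ℂ) = ∫ ξ, F ξ * ek (t * ξ)) (k : ℕ) :
    ∀ᶠ t in 𝓝 (0 : ℝ), ((iteratedDeriv k h t : ℝ) : ℂ) =
      Complex.I ^ k * ∫ ξ : ℝ, ((ξ : ℂ) ^ k * F ξ) * ek (t * ξ) := by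
  induction k with
  | zero => simpa using hrep
  | succ k ih =>
    filter_upwards [eventually_eventually_nhds.2 ih] with t ht
    have hd : HasDerivAt (iteratedDeriv k h) (iteratedDeriv (k + 1) h t) t := by
      rw [iteratedDeriv_succ]
      exact (hh.differentiable_iteratedDeriv k (by exact_mod_cast WithTop.coe_lt_top k) t).hasDerivAt
    have h1 := hd.ofReal_comp
    have h2 := (GG_hasDerivAt (hF.mul k) ek_BD t).const_mul (Complex.I ^ k)
    have h3 := h1.congr_of_eventuallyEq (f₁ := fun t =>
      Complex.I ^ k * ∫ ξ : ℝ, ((ξ : ℂ) ^ k * F ξ) * ek (t * ξ)) (by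
        filter_upwards [ht] with s hs; exact hs.symm)
    rw [h3.unique h2, pow_succ, mul_assoc, ← integral_const_mul Complex.I]
    congr 2
    funext ξ
    rw [ek_deriv, pow_succ]; ring

theorem key_kernel {E : ℝ → ℂ} (hE : ContDiff ℝ (⊤ : ℕ∞) E)
    (hcos : ∀ x : ℝ, E (x ^ 2) = Complex.cos x) (x : ℝ) :
    ek (-x) * (1 + Complex.I * x) =
      E (x ^ 2) - 2 * x ^ 2 * iteratedDeriv 1 E (x ^ 2)
        - 4 * Complex.I * x ^ 3 * iteratedDeriv 2 E (x ^ 2) := by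
  have h1 := E_d1 hE hcos x
  have h2 := E_d2 hE hcos x
  have h0 := hcos x
  have h3 : ek (-x) = Complex.cos x - Complex.sin x * Complex.I := by
    rw [ek, Complex.exp_mul_I]; simp; ring
  rw [h3, h0]
  have hI := Complex.I_sq
  linear_combination ((x:ℂ) - Complex.I) * h1 + Complex.I * x * h2 - Complex.sin x * x * hI

theorem int5 {f₁ f₂ f₃ f₄ f₅ : ℝ → ℂ} (h₁ : Integrable f₁) (h₂ : Integrable f₂)
    (h₃ : Integrable f₃) (h₄ : Integrable f₄) (h₅ : Integrable f₅) :
    (∫ x, f₁ x) - (∫ x, f₂ x) + (∫ x, f₃ x) + (∫ x, f₄ x) + (∫ x, f₅ x) =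
      ∫ x, (f₁ x - f₂ x + f₃ x + f₄ x + f₅ x) := by
  rw [← integral_sub' h₁ h₂, ← integral_add' (h₁.sub h₂) h₃, ← integral_add' ((h₁.sub h₂).add h₃) h₄,
    ← integral_add' (((h₁.sub h₂).add h₃).add h₄) h₅]
  rfl

theorem scalar_key (h : ℝ → ℝ) (hh : ContDiff ℝ (⊤ : ℕ∞) h) (h3 : iteratedDeriv 3 h 0 = 0) :
    ∃ (A Q : ℝ × ℝ → ℝ) (P : ℝ → ℝ), ContDiff ℝ (⊤ : ℕ∞) A ∧ ContDiff ℝ (⊤ : ℕ∞) Q ∧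
      ContDiff ℝ (⊤ : ℕ∞) P ∧ A 0 = h 0 ∧
      HasFDerivAt A ((ContinuousLinearMap.fst ℝ ℝ ℝ).smulRight (iteratedDeriv 1 h 0) +
        (ContinuousLinearMap.snd ℝ ℝ ℝ).smulRight (- iteratedDeriv 2 h 0 / 2)) 0 ∧
      P 0 = iteratedDeriv 4 h 0 / 3 ∧ Q 0 = iteratedDeriv 5 h 0 / 30 ∧
      ∀ᶠ p : ℝ × ℝ in 𝓝 0, h (p.1 - p.2) + p.2 * deriv h (p.1 - p.2) =
        A (p.1, p.2 ^ 2) + p.1 * p.2 ^ 3 * P p.1 + p.2 ^ 5 * Q (p.1, p.2 ^ 2) := by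
  obtain ⟨F, hF, hrep⟩ := exists_rep h hh
  have hD := rep_derivs h hh hF hrep
  obtain ⟨E, hEB, hcos⟩ := exists_E
  have hE := hEB.1
  have hker := key_kernel hE hcos
  have e0 : E 0 = 1 := by simpa using hcos 0
  have ode := E_ode hE hcos
  have e1 : iteratedDeriv 1 E 0 = -1 / 2 := by
    have := ode 0 0 le_rfl
    simp only [zero_add, Complex.ofReal_zero, mul_zero, zero_mul, Nat.cast_zero, iteratedDeriv_zero, e0] at this
    linear_combination this / 2
  have e2 : iteratedDeriv 2 E 0 = 1 / 12 := by
    have := ode 1 0 le_rfl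
    norm_num [e1] at this
    linear_combination this / 6
  have e3 : iteratedDeriv 3 E 0 = -1 / 120 := by
    have := ode 2 0 le_rfl
    norm_num [e2] at this
    linear_combination this / 10
  have d1 : deriv E = iteratedDeriv 1 E := by rw [iteratedDeriv_one]
  have B1 : BD (iteratedDeriv 1 E) := by rw [iteratedDeriv_one]; exact hEB.deriv
  have B2 : BD (iteratedDeriv 2 E) := by rw [iteratedDeriv_succ]; exact B1.deriv
  obtain ⟨K3, K3B, K30, hK3⟩ := B2.hadamard
  rw [← iteratedDeriv_succ, e3] at K30
  obtain ⟨κ, κB, κ0, hκ⟩ := ek_BD.hadamard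
  rw [ek_deriv, ek_zero, mul_one] at κ0
  let Mo : ℕ → ℂ := fun k => ∫ ξ : ℝ, (ξ : ℂ) ^ k * F ξ
  have hM : ∀ k, ((iteratedDeriv k h 0 : ℝ) : ℂ) = Complex.I ^ k * Mo k := by
    intro k
    have := (hD k).self_of_nhds
    simpa [ek_zero] using this
  have hM3 : Mo 3 = 0 := by
    have := hM 3
    rw [h3] at this
    simpa using this.symm
  let A1 := GG volume F ek E
  let A2 := GG volume (fun ξ => (ξ : ℂ) ^ 2 * F ξ) ek (iteratedDeriv 1 E)
  let AA : ℝ × ℝ → ℂ := fun p => A1 p - ((2 * p.2 : ℝ) : ℂ) * A2 p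
  let PP : ℝ → ℂ := fun u => ∫ ξ : ℝ, (-(Complex.I / 3) * ((ξ : ℂ) ^ 4 * F ξ)) * κ (u * ξ)
  let QQ : ℝ × ℝ → ℂ := GG volume (fun ξ => (-4 * Complex.I) * ((ξ : ℂ) ^ 5 * F ξ)) ek K3
  have hA1 : ContDiff ℝ (⊤ : ℕ∞) A1 := GG_contDiff hF ek_BD hEB
  have hA2 : ContDiff ℝ (⊤ : ℕ∞) A2 := GG_contDiff (hF.mul 2) ek_BD B1
  have hlin : ContDiff ℝ (⊤ : ℕ∞) (fun p : ℝ × ℝ => ((2 * p.2 : ℝ) : ℂ)) :=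
    Complex.ofRealCLM.contDiff.comp (contDiff_const.mul contDiff_snd)
  have hAA : ContDiff ℝ (⊤ : ℕ∞) AA := hA1.sub (hlin.mul hA2)
  have hPP : ContDiff ℝ (⊤ : ℕ∞) PP := (HH_BD ((hF.mul 4).constMul _) κB).1
  have hQQ : ContDiff ℝ (⊤ : ℕ∞) QQ := GG_contDiff ((hF.mul 5).constMul _) ek_BD K3B
  have hAd : HasFDerivAt AA ((ContinuousLinearMap.fst ℝ ℝ ℝ).smulRight ((iteratedDeriv 1 h 0 : ℝ) : ℂ) +
        (ContinuousLinearMap.snd ℝ ℝ ℝ).smulRight ((- iteratedDeriv 2 h 0 / 2 : ℝ) : ℂ)) 0 := by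
    have a1 := GG_hasFDerivAt hF ek_BD hEB 0
    have a2 := GG_hasFDerivAt (hF.mul 2) ek_BD B1 0
    have a3 : HasFDerivAt (fun p : ℝ × ℝ => ((2 * p.2 : ℝ) : ℂ))
        (Complex.ofRealCLM.comp ((2 : ℝ) • ContinuousLinearMap.snd ℝ ℝ ℝ)) 0 :=
      Complex.ofRealCLM.hasFDerivAt.comp 0 (hasFDerivAt_snd.const_mul (2 : ℝ))
    have a4 := a1.sub (a3.mul a2)
    refine a4.congr_fderiv ?_
    have hm1 := hM 1
    have hm2 := hM 2
    rw [Complex.I_sq] at hm2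
    have g1 : GG volume (fun ξ => (ξ : ℂ) ^ 1 * F ξ) (deriv ek) E 0 = Complex.I * Mo 1 := by
      simp only [GG, Prod.fst_zero, Prod.snd_zero, zero_mul, e0, ek_deriv, ek_zero, mul_one, Mo]
      rw [integral_mul_const, mul_comm]
    have g2 : GG volume (fun ξ => (ξ : ℂ) ^ 2 * F ξ) ek (iteratedDeriv 1 E) 0 = - Mo 2 / 2 := by
      simp only [GG, Prod.fst_zero, Prod.snd_zero, zero_mul, e1, ek_zero, mul_one, Mo]
      rw [integral_mul_const]; ring
    rw [d1, g1, g2, hm1]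
    push_cast
    rw [hm2]
    ext
    · simp
    · simp; ring
  refine ⟨fun p => (AA p).re, fun p => (QQ p).re, fun u => (PP u).re,
    Complex.reCLM.contDiff.comp hAA, Complex.reCLM.contDiff.comp hQQ,
    Complex.reCLM.contDiff.comp hPP, ?_, ?_, ?_, ?_, ?_⟩
  · have h0 := hM 0
    simp only [iteratedDeriv_zero, pow_zero, one_mul] at h0
    have : AA 0 = Mo 0 := by
      simp [AA, A1, GG, Mo, e0, ek_zero]
    simp only [this, ← h0, Complex.ofReal_re]
  · have := Complex.reCLM.hasFDerivAt.comp (0 : ℝ × ℝ) hAd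
    refine this.congr_fderiv ?_
    ext
    · simp
    · simp
  · have h4 := hM 4
    rw [Complex.I_pow_four, one_mul] at h4
    have : PP 0 = Mo 4 / 3 := by
      simp only [PP, zero_mul, κ0, Mo]
      rw [integral_mul_const, integral_const_mul]
      linear_combination (-(∫ ξ : ℝ, (ξ : ℂ) ^ 4 * F ξ) / 3) * Complex.I_sq
    simp only [this, ← h4]
    norm_cast
  · have h5 := hM 5
    rw [show Complex.I ^ 5 = Complex.I ^ 4 * Complex.I by ring, Complex.I_pow_four, one_mul] at h5
    have : QQ 0 = Complex.I * Mo 5 / 30 := by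
      simp only [QQ, GG, Prod.fst_zero, Prod.snd_zero, zero_mul, K30, ek_zero, mul_one, Mo]
      rw [integral_mul_const, integral_const_mul]
      ring
    simp only [this, ← h5]
    norm_cast
  · have hsub : Tendsto (fun p : ℝ × ℝ => p.1 - p.2) (𝓝 0) (𝓝 0) := by
      have : Continuous fun p : ℝ × ℝ => p.1 - p.2 := by fun_prop
      simpa using this.tendsto 0
    filter_upwards [hsub.eventually (hD 0), hsub.eventually (hD 1)] with p hp0 hp1
    obtain ⟨u, s⟩ := p
    simp only [iteratedDeriv_zero, pow_zero, one_mul, iteratedDeriv_one, pow_one] at hp0 hp1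
    have main : (h (u - s) : ℂ) + s * (deriv h (u - s) : ℝ) =
        AA (u, s ^ 2) + u * s ^ 3 * PP u + s ^ 5 * QQ (u, s ^ 2) := by
      rw [hp0, hp1]
      have j0 := GG_integrable hF ek_BD (BD.const 1) (u - s, 0)
      have j1 := GG_integrable (hF.mul 1) ek_BD (BD.const 1) (u - s, 0)
      have i1 := GG_integrable hF ek_BD hEB (u, s ^ 2)
      have i2 := GG_integrable (hF.mul 2) ek_BD B1 (u, s ^ 2)
      have i3 := GG_integrable ((hF.mul 4).constMul (-(Complex.I / 3))) κB (BD.const 1) (u, 0)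
      have i4 := GG_integrable ((hF.mul 5).constMul (-4 * Complex.I)) ek_BD K3B (u, s ^ 2)
      have i5 := hF 3
      simp only [mul_one, pow_one] at j0 j1 i3
      have hz : (0 : ℂ) = -(Complex.I / 3) * s ^ 3 * ∫ ξ : ℝ, (ξ : ℂ) ^ 3 * F ξ := by
        have : ∫ ξ : ℝ, (ξ : ℂ) ^ 3 * F ξ = 0 := hM3
        rw [this, mul_zero]
      rw [← add_zero (AA (u, s ^ 2) + u * s ^ 3 * PP u + s ^ 5 * QQ (u, s ^ 2)), hz]
      simp only [AA, A1, A2, PP, QQ, GG]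
      rw [← mul_assoc, ← integral_const_mul (_ * Complex.I), ← integral_const_mul,
        ← integral_const_mul, ← integral_const_mul, ← integral_const_mul]
      rw [← integral_add j0 (j1.const_mul _),
        int5 i1 (i2.const_mul _) (i3.const_mul _) (i4.const_mul _) (i5.const_mul _)]
      refine integral_congr_ae (Eventually.of_forall fun ξ => ?_)
      have hk := hker (s * ξ)
      have hk3 := hK3 ((s * ξ) ^ 2)
      have hkk := hκ (u * ξ)
      have hadd : ek ((u - s) * ξ) = ek (u * ξ) * ek (-(s * ξ)) := by
        simp only [ek]
        rw [← Complex.exp_add]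
        congr 1
        push_cast; ring
      rw [e2] at hk3
      rw [ek_zero] at hkk
      rw [hk3] at hk
      rw [mul_pow] at hk
      push_cast at hk hkk
      simp only []
      rw [hadd]
      push_cast
      linear_combination F ξ * ek (u * ξ) * hk - (Complex.I / 3) * s ^ 3 * ξ ^ 3 * F ξ * hkk
    have := congrArg Complex.re main
    simp only [Complex.add_re, Complex.ofReal_re] at this
    have r1 : ((s : ℂ) * (deriv h (u - s) : ℝ)).re = s * deriv h (u - s) := by
      rw [← Complex.ofReal_mul, Complex.ofReal_re]
    have r2 : ((u : ℂ) * s ^ 3 * PP u).re = u * s ^ 3 * (PP u).re := by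
      rw [← Complex.ofReal_pow, ← Complex.ofReal_mul, Complex.re_ofReal_mul]
    have r3 : ((s : ℂ) ^ 5 * QQ (u, s ^ 2)).re = s ^ 5 * (QQ (u, s ^ 2)).re := by
      rw [← Complex.ofReal_pow, Complex.re_ofReal_mul]
    rw [r1, r2, r3] at this
    exact this

theorem exists_local_inv {X : Type*} [NormedAddCommGroup X] [NormedSpace ℝ X] [CompleteSpace X]
    (f : X → X) (a : X) (f' : X ≃L[ℝ] X) (hf : ContDiffAt ℝ (⊤ : ℕ∞) f a)
    (hf' : HasFDerivAt f (f' : X →L[ℝ] X) a) :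
    ∃ g : X → X, ContDiffAt ℝ (⊤ : ℕ∞) g (f a) ∧ (∀ᶠ x in 𝓝 a, g (f x) = x) ∧
      ∀ᶠ y in 𝓝 (f a), f (g y) = y :=
  ⟨hf.localInverse hf' (by simp), hf.to_localInverse hf' (by simp),
    (hf.hasStrictFDerivAt' hf' (by simp)).eventually_left_inverse,
    (hf.hasStrictFDerivAt' hf' (by simp)).eventually_right_inverse⟩

section germs
variable {E F : Type*} [NormedAddCommGroup E] [NormedSpace ℝ E]
    [NormedAddCommGroup F] [NormedSpace ℝ F]

theorem GermEquiv.ofDerivs [CompleteSpace E] [CompleteSpace F] (f : E → F) (a : E) (g : E → F)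
    (b : E) (σ : E → E) (τ : F → F) (σ' : E ≃L[ℝ] E) (τ' : F ≃L[ℝ] F)
    (hσ : ContDiffAt ℝ (⊤ : ℕ∞) σ a) (hτ : ContDiffAt ℝ (⊤ : ℕ∞) τ (f a))
    (hσ' : HasFDerivAt σ (σ' : E →L[ℝ] E) a) (hτ' : HasFDerivAt τ (τ' : F →L[ℝ] F) (f a))
    (hab : σ a = b) (h : ∀ᶠ x in 𝓝 a, g (σ x) = τ (f x)) : GermEquiv f a g b := by
  obtain ⟨σi, s1, s2, s3⟩ := exists_local_inv σ a σ' hσ hσ'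
  obtain ⟨τi, t1, t2, t3⟩ := exists_local_inv τ (f a) τ' hτ hτ'
  have h0 := h.self_of_nhds
  rw [hab] at h0 s1 s3
  rw [← h0] at t1 t3
  exact ⟨σ, σi, τ, τi, hab, h0.symm, hσ, s1, hτ, t1, s2, s3, t2, t3, h⟩

theorem GermEquiv.symm' {f g : E → F} {a b : E} (h : GermEquiv f a g b) (hf : ContinuousAt f a) :
    GermEquiv g b f a := by
  obtain ⟨σ, σi, τ, τi, h1, h2, h3, h4, h5, h6, h7, h8, h9, h10, h11⟩ := h
  have hb : σi b = a := by rw [← h1]; exact h7.self_of_nhds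
  have hg : τi (g b) = f a := by rw [← h2]; exact h9.self_of_nhds
  refine ⟨σi, σ, τi, τ, hb, hg, h4, h3, h6, h5, h8, h7, h10, h9, ?_⟩
  have ht : Tendsto σi (𝓝 b) (𝓝 a) := by
    have := h4.continuousAt.tendsto
    rwa [hb] at this
  filter_upwards [h8, ht.eventually h11, (hf.tendsto.comp ht).eventually h9] with y e1 e2 e3
  rw [e1] at e2
  rw [e2]
  exact e3.symm

theorem GermEquiv.trans' {f g h : E → F} {a b c : E} (H : GermEquiv f a g b)
    (K : GermEquiv g b h c) : GermEquiv f a h c := by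
  obtain ⟨σ, σi, τ, τi, h1, h2, h3, h4, h5, h6, h7, h8, h9, h10, h11⟩ := H
  obtain ⟨ρ, ρi, ω, ωi, k1, k2, k3, k4, k5, k6, k7, k8, k9, k10, k11⟩ := K
  have hb : ρi c = b := by rw [← k1]; exact k7.self_of_nhds
  have hg : ωi (h c) = g b := by rw [← k2]; exact k9.self_of_nhds
  have tσ : Tendsto σ (𝓝 a) (𝓝 b) := by
    have := h3.continuousAt.tendsto; rwa [h1] at this
  have tτ : Tendsto τ (𝓝 (f a)) (𝓝 (g b)) := by
    have := h5.continuousAt.tendsto; rwa [h2] at this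
  have tρ : Tendsto ρi (𝓝 c) (𝓝 b) := by
    have := k4.continuousAt.tendsto; rwa [hb] at this
  have tω : Tendsto ωi (𝓝 (h c)) (𝓝 (g b)) := by
    have := k6.continuousAt.tendsto; rwa [hg] at this
  refine ⟨ρ ∘ σ, σi ∘ ρi, ω ∘ τ, τi ∘ ωi, by simp [h1, k1], by simp [h2, k2], ?_, ?_, ?_, ?_,
    ?_, ?_, ?_, ?_, ?_⟩
  · exact ContDiffAt.comp a (by rwa [h1]) h3
  · exact ContDiffAt.comp c (by rwa [hb]) k4
  · exact ContDiffAt.comp _ (by rwa [h2]) h5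
  · exact ContDiffAt.comp _ (by rwa [hg]) k6
  · filter_upwards [h7, tσ.eventually k7] with x e1 e2
    simp [e1, e2]
  · filter_upwards [k8, tρ.eventually h8] with x e1 e2
    simp [e1, e2]
  · filter_upwards [h9, tτ.eventually k9] with x e1 e2
    simp [e1, e2]
  · filter_upwards [k10, tω.eventually h10] with x e1 e2
    simp [e1, e2]
  · filter_upwards [h11, tσ.eventually k11] with x e1 e2
    simp [← e1, e2]
end germs

theorem exists_basis_ext {k : ℕ} (v : Fin 4 → (Fin (4 + k) → ℝ)) (hv : LinearIndependent ℝ v) :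
    ∃ b : Module.Basis (Fin (4 + k)) ℝ (Fin (4 + k) → ℝ), ∀ i, b (Fin.castAdd k i) = v i := by
  let B := Module.Basis.sumExtend hv
  have : Finite (Fin 4 ⊕ (Module.Basis.sumExtendIndex hv)) := Module.Finite.finite_basis B
  have : Finite (Module.Basis.sumExtendIndex hv) := Finite.of_injective (β := Fin 4 ⊕ _) Sum.inr Sum.inr_injective
  have hc : Nat.card (Module.Basis.sumExtendIndex hv) = k := by
    have h1 := Module.finrank_eq_nat_card_basis B
    rw [Nat.card_sum, Module.finrank_fin_fun, Nat.card_eq_fintype_card (α := Fin 4), Fintype.card_fin] at h1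
    omega
  let e : Module.Basis.sumExtendIndex hv ≃ Fin k := Finite.equivFinOfCardEq hc
  refine ⟨B.reindex ((Equiv.sumCongr (Equiv.refl _) e).trans finSumFinEquiv), fun i => ?_⟩
  rw [Module.Basis.reindex_apply]
  have : ((Equiv.sumCongr (Equiv.refl (Fin 4)) e).trans finSumFinEquiv).symm (Fin.castAdd k i) = Sum.inl i := by
    rw [Equiv.symm_apply_eq]; simp
  rw [this]
  simp [B, Module.Basis.sumExtend]
  rfl

theorem repar_derivs (g : ℝ → ℝ) (hg : ContDiff ℝ (⊤ : ℕ∞) g) (a b : ℝ) :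
    let δ : ℝ → ℝ := fun r => g (r + a * r ^ 2 / 2 + b * r ^ 3 / 6)
    (∀ r, deriv δ r = (1 + a * r + b * r ^ 2 / 2) * deriv g (r + a * r ^ 2 / 2 + b * r ^ 3 / 6)) ∧
    iteratedDeriv 1 δ 0 = iteratedDeriv 1 g 0 ∧
    iteratedDeriv 2 δ 0 = a * iteratedDeriv 1 g 0 + iteratedDeriv 2 g 0 ∧
    iteratedDeriv 3 δ 0 = b * iteratedDeriv 1 g 0 + 3 * a * iteratedDeriv 2 g 0
      + iteratedDeriv 3 g 0 ∧
    iteratedDeriv 4 δ 0 = (3 * a ^ 2 + 4 * b) * iteratedDeriv 2 g 0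
      + 6 * a * iteratedDeriv 3 g 0 + iteratedDeriv 4 g 0 ∧
    iteratedDeriv 5 δ 0 = 10 * a * b * iteratedDeriv 2 g 0
      + (15 * a ^ 2 + 10 * b) * iteratedDeriv 3 g 0 + 10 * a * iteratedDeriv 4 g 0
      + iteratedDeriv 5 g 0 := by
  intro δ
  let φ : ℝ → ℝ := fun r => r + a * r ^ 2 / 2 + b * r ^ 3 / 6
  let φ1 : ℝ → ℝ := fun r => 1 + a * r + b * r ^ 2 / 2
  let φ2 : ℝ → ℝ := fun r => a + b * r
  have hφ : ∀ r, HasDerivAt φ (φ1 r) r := by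
    intro r
    have := ((hasDerivAt_id r).add (((hasDerivAt_pow 2 r).const_mul a).div_const 2)).add
      (((hasDerivAt_pow 3 r).const_mul b).div_const 6)
    refine this.congr_deriv ?_
    simp [φ1]; ring
  have hφ1 : ∀ r, HasDerivAt φ1 (φ2 r) r := by
    intro r
    have := (((hasDerivAt_id r).const_mul a).const_add 1).add
      (((hasDerivAt_pow 2 r).const_mul b).div_const 2)
    refine this.congr_deriv ?_
    simp [φ2]; ring
  have hφ2 : ∀ r, HasDerivAt φ2 b r := by
    intro r
    have := ((hasDerivAt_id r).const_mul b).const_add a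
    refine this.congr_deriv ?_
    simp
  have G : ∀ n r, HasDerivAt (fun r => iteratedDeriv n g (φ r)) (iteratedDeriv (n + 1) g (φ r) * φ1 r) r := by
    intro n r
    have : HasDerivAt (iteratedDeriv n g) (iteratedDeriv (n + 1) g (φ r)) (φ r) := by
      rw [iteratedDeriv_succ]
      exact (hg.differentiable_iteratedDeriv n (by exact_mod_cast WithTop.coe_lt_top n) _).hasDerivAt
    exact this.comp r (hφ r)
  have D1 : iteratedDeriv 1 δ = fun r => φ1 r * iteratedDeriv 1 g (φ r) := by
    rw [iteratedDeriv_one]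
    funext r
    have := G 0 r
    simp only [iteratedDeriv_zero] at this
    refine this.deriv.trans (mul_comm _ _)
  have D2 : iteratedDeriv 2 δ = fun r => φ2 r * iteratedDeriv 1 g (φ r)
      + φ1 r ^ 2 * iteratedDeriv 2 g (φ r) := by
    rw [iteratedDeriv_succ, D1]
    funext r
    refine ((hφ1 r).mul (G 1 r)).deriv.trans ?_
    ring
  have D3 : iteratedDeriv 3 δ = fun r => b * iteratedDeriv 1 g (φ r)
      + (3 * φ1 r * φ2 r) * iteratedDeriv 2 g (φ r) + φ1 r ^ 3 * iteratedDeriv 3 g (φ r) := by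
    rw [iteratedDeriv_succ, D2]
    funext r
    refine (((hφ2 r).mul (G 1 r)).add (((hφ1 r).pow 2).mul (G 2 r))).deriv.trans ?_
    simp; ring
  have D4 : iteratedDeriv 4 δ = fun r => (3 * φ2 r ^ 2 + 4 * b * φ1 r) * iteratedDeriv 2 g (φ r)
      + (6 * φ1 r ^ 2 * φ2 r) * iteratedDeriv 3 g (φ r) + φ1 r ^ 4 * iteratedDeriv 4 g (φ r) := by
    rw [iteratedDeriv_succ, D3]
    funext r
    refine ((((G 1 r).const_mul b).add ((((hφ1 r).const_mul 3).mul (hφ2 r)).mul (G 2 r))).add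
      (((hφ1 r).pow 3).mul (G 3 r))).deriv.trans ?_
    simp; ring
  have D5 : iteratedDeriv 5 δ = fun r => (10 * b * φ2 r) * iteratedDeriv 2 g (φ r)
      + (15 * φ1 r * φ2 r ^ 2 + 10 * b * φ1 r ^ 2) * iteratedDeriv 3 g (φ r)
      + 10 * φ1 r ^ 3 * φ2 r * iteratedDeriv 4 g (φ r)
      + φ1 r ^ 5 * iteratedDeriv 5 g (φ r) := by
    rw [iteratedDeriv_succ, D4]
    funext r
    refine (((((((hφ2 r).pow 2).const_mul 3).add ((hφ1 r).const_mul (4 * b))).mul (G 2 r)).add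
      (((((hφ1 r).pow 2).const_mul 6).mul (hφ2 r)).mul (G 3 r))).add
      (((hφ1 r).pow 4).mul (G 4 r))).deriv.trans ?_
    simp; ring
  refine ⟨fun r => ?_, ?_, ?_, ?_, ?_, ?_⟩
  · rw [← iteratedDeriv_one, D1, iteratedDeriv_one]
  · rw [D1]; simp [φ, φ1]
  · rw [D2]; simp [φ, φ1, φ2]
  · rw [D3]; simp [φ, φ1, φ2]
  · rw [D4]; simp [φ, φ1, φ2]
  · rw [D5]; simp [φ, φ1, φ2]; left; ring

/-- The normal form. -/
def nform (m : ℕ) (p : ℝ × ℝ) : Fin m → ℝ := fun i =>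
  if (i : ℕ) = 0 then p.1
  else if (i : ℕ) = 1 then p.2 ^ 2
  else if (i : ℕ) = 2 then p.1 * p.2 ^ 3
  else if (i : ℕ) = 3 then p.2 ^ 5
  else 0

theorem nform_contDiff (m : ℕ) : ContDiff ℝ (⊤ : ℕ∞) (nform m) := by
  rw [contDiff_pi]
  intro i
  unfold nform
  split_ifs <;> fun_prop

theorem nform_model (m : ℕ) (hm : 4 ≤ m) : GermEquiv (nform m) 0
      (fun p : ℝ × ℝ => fun i : Fin m =>
        if (i : ℕ) = 0 then p.1
        else if (i : ℕ) = 1 then p.2 ^ 2 + p.1 * p.2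
        else if (i : ℕ) = 2 then (1/2) * p.2 ^ 4 + (1/3) * p.1 * p.2 ^ 3
        else if (i : ℕ) = 3 then (2/5) * p.2 ^ 5 + (1/4) * p.1 * p.2 ^ 4
        else 0) (0 : ℝ × ℝ) := by
  let e0 : Fin m := ⟨0, by omega⟩
  let e1 : Fin m := ⟨1, by omega⟩
  let e2 : Fin m := ⟨2, by omega⟩
  let e3 : Fin m := ⟨3, by omega⟩
  let τ : (Fin m → ℝ) → Fin m → ℝ := fun z i =>
    if (i : ℕ) = 0 then z e0
    else if (i : ℕ) = 1 then z e1 - z e0 ^ 2 / 4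
    else if (i : ℕ) = 2 then z e1 ^ 2 / 2 - (2/3) * z e2 + z e0 ^ 2 * z e1 / 4 - z e0 ^ 4 / 96
    else if (i : ℕ) = 3 then (2/5) * z e3 - (3/4) * z e0 * z e1 ^ 2 + z e0 * z e2 / 2
      - z e0 ^ 3 * z e1 / 8 + z e0 ^ 5 / 320
    else z i
  let y1 : (Fin m → ℝ) → ℝ := fun w => w e1 + w e0 ^ 2 / 4
  let y2 : (Fin m → ℝ) → ℝ := fun w =>
    (3/2) * (y1 w ^ 2 / 2 + w e0 ^ 2 * y1 w / 4 - w e0 ^ 4 / 96 - w e2)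
  let ρ : (Fin m → ℝ) → Fin m → ℝ := fun w i =>
    if (i : ℕ) = 0 then w e0
    else if (i : ℕ) = 1 then y1 w
    else if (i : ℕ) = 2 then y2 w
    else if (i : ℕ) = 3 then (5/2) * (w e3 + (3/4) * w e0 * y1 w ^ 2 - w e0 * y2 w / 2
      + w e0 ^ 3 * y1 w / 8 - w e0 ^ 5 / 320)
    else w i
  have hτ : ContDiff ℝ (⊤ : ℕ∞) τ := by
    rw [contDiff_pi]
    intro i
    simp only [τ]
    split_ifs <;> fun_prop
  have hρ : ContDiff ℝ (⊤ : ℕ∞) ρ := by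
    rw [contDiff_pi]
    intro i
    simp only [ρ, y1, y2]
    split_ifs <;> fun_prop
  have e : ∀ i : Fin m, i = e0 ∨ i = e1 ∨ i = e2 ∨ i = e3 ∨ ((i : ℕ) ≠ 0 ∧ (i : ℕ) ≠ 1 ∧ (i : ℕ) ≠ 2 ∧ (i : ℕ) ≠ 3) := by
    intro i
    simp only [Fin.ext_iff, e0, e1, e2, e3]
    omega
  have a1 : ∀ z, ρ (τ z) = z := by
    intro z
    funext i
    rcases e i with h | h | h | h | ⟨g0, g1, g2, g3⟩
    · subst h; simp [ρ, τ, e0]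
    · subst h; simp [ρ, τ, e0, e1, y1]
    · subst h; simp [ρ, τ, e0, e1, e2, y1, y2]; ring
    · subst h; simp [ρ, τ, e0, e1, e2, e3, y1, y2]; ring
    · simp [ρ, τ, g0, g1, g2, g3]
  have a2 : ∀ z, τ (ρ z) = z := by
    intro z
    funext i
    rcases e i with h | h | h | h | ⟨g0, g1, g2, g3⟩
    · subst h; simp [ρ, τ, e0]
    · subst h; simp [ρ, τ, e0, e1, y1]
    · subst h; simp [ρ, τ, e0, e1, e2, y1, y2]; ring
    · subst h; simp [ρ, τ, e0, e1, e2, e3, y1, y2]; ring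
    · simp [ρ, τ, g0, g1, g2, g3]
  have key : ∀ p : ℝ × ℝ, (fun i : Fin m =>
        if (i : ℕ) = 0 then p.1
        else if (i : ℕ) = 1 then (p.2 - p.1 / 2) ^ 2 + p.1 * (p.2 - p.1 / 2)
        else if (i : ℕ) = 2 then (1/2) * (p.2 - p.1 / 2) ^ 4 + (1/3) * p.1 * (p.2 - p.1 / 2) ^ 3
        else if (i : ℕ) = 3 then (2/5) * (p.2 - p.1 / 2) ^ 5 + (1/4) * p.1 * (p.2 - p.1 / 2) ^ 4
        else 0) = τ (nform m p) := by
    intro p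
    funext i
    rcases e i with h | h | h | h | ⟨g0, g1, g2, g3⟩
    · subst h; simp [nform, τ, e0]
    · subst h; simp [nform, τ, e0, e1]; ring
    · subst h; simp [nform, τ, e0, e1, e2]; ring
    · subst h; simp [nform, τ, e0, e1, e2, e3]; ring
    · simp [nform, τ, g0, g1, g2, g3]
  refine ⟨fun p => (p.1, p.2 - p.1 / 2), fun p => (p.1, p.2 + p.1 / 2), τ, ρ, by simp, ?_,
    ContDiff.contDiffAt (by fun_prop), ContDiff.contDiffAt (by fun_prop), hτ.contDiffAt,
    hρ.contDiffAt, Eventually.of_forall fun p => by simp, Eventually.of_forall fun p => by simp,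
    Eventually.of_forall a1, Eventually.of_forall a2, Eventually.of_forall key⟩
  rw [← key]
  simp

theorem iteratedDeriv_comp_pi {m : ℕ} (γ : ℝ → Fin m → ℝ) (hγ : ContDiff ℝ (⊤ : ℕ∞) γ) (l : Fin m)
    (n : ℕ) : ∀ t, iteratedDeriv n γ t l = iteratedDeriv n (fun t => γ t l) t := by
  induction n with
  | zero => intro t; simp
  | succ n ih =>
    intro t
    rw [iteratedDeriv_succ, iteratedDeriv_succ]
    have : HasDerivAt (iteratedDeriv n γ) (deriv (iteratedDeriv n γ) t) t :=
      (hγ.differentiable_iteratedDeriv n (by exact_mod_cast WithTop.coe_lt_top n) _).hasDerivAt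
    have h := (hasDerivAt_pi.1 this l).deriv
    rw [← h]
    congr 1
    funext s
    exact ih s

theorem indep_of_h5 {m : ℕ} (c1 c2 c3 c4 c5 : Fin m → ℝ)
    (h3 : c3 ∈ Submodule.span ℝ ({c1, c2} : Set (Fin m → ℝ)))
    (h5 : Module.finrank ℝ ↥(Submodule.span ℝ ({c1, c2, c3, c4, c5} : Set (Fin m → ℝ))) = 4)
    (v : Fin 4 → Fin m → ℝ) (h1' : c1 ∈ Submodule.span ℝ (Set.range v))
    (h2' : c2 ∈ Submodule.span ℝ (Set.range v)) (h4' : c4 ∈ Submodule.span ℝ (Set.range v))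
    (h5' : c5 ∈ Submodule.span ℝ (Set.range v)) : LinearIndependent ℝ v := by
  rw [linearIndependent_iff_card_le_finrank_span, Fintype.card_fin]
  refine h5.symm.le.trans ?_
  refine Submodule.finrank_mono (Submodule.span_le.2 ?_)
  have h3' : c3 ∈ Submodule.span ℝ (Set.range v) := by
    refine Submodule.span_le.2 ?_ h3
    rintro x (rfl | rfl) <;> assumption
  rintro x (rfl | rfl | rfl | rfl | rfl) <;> assumption

theorem nform_tan (k : ℕ) (γ : ℝ → Fin (4 + k) → ℝ) (hγ : ContDiff ℝ (⊤ : ℕ∞) γ)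
    (h3 : iteratedDeriv 3 γ 0 ∈ Submodule.span ℝ
      ({iteratedDeriv 1 γ 0, iteratedDeriv 2 γ 0} : Set (Fin (4 + k) → ℝ)))
    (h5 : Module.finrank ℝ ↥(Submodule.span ℝ
      ({iteratedDeriv 1 γ 0, iteratedDeriv 2 γ 0, iteratedDeriv 3 γ 0,
        iteratedDeriv 4 γ 0, iteratedDeriv 5 γ 0} : Set (Fin (4 + k) → ℝ))) = 4) :
    GermEquiv (nform (4 + k)) 0 (fun p : ℝ × ℝ => γ p.2 + p.1 • deriv γ p.2) (0 : ℝ × ℝ) := by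
  obtain ⟨α, β, hαβ⟩ := Submodule.mem_span_pair.1 h3
  obtain ⟨a, ha⟩ : ∃ a : ℝ, a = - β / 3 := ⟨_, rfl⟩
  obtain ⟨b, hb⟩ : ∃ b : ℝ, b = - α := ⟨_, rfl⟩
  have hγl : ∀ l, ContDiff ℝ (⊤ : ℕ∞) (fun t => γ t l) := fun l => contDiff_pi.1 hγ l
  have hφ : ContDiff ℝ (⊤ : ℕ∞) (fun r : ℝ => r + a * r ^ 2 / 2 + b * r ^ 3 / 6) := by fun_prop
  have hδ : ∀ l, ContDiff ℝ (⊤ : ℕ∞)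
      (fun r : ℝ => γ (r + a * r ^ 2 / 2 + b * r ^ 3 / 6) l) := fun l => (hγl l).comp hφ
  have H := fun l => repar_derivs (fun t => γ t l) (hγl l) a b
  simp only [← iteratedDeriv_comp_pi γ hγ] at H
  choose H0 H1 H2 H3 H4 H5 using H
  have H3' : ∀ l, iteratedDeriv 3 (fun r : ℝ => γ (r + a * r ^ 2 / 2 + b * r ^ 3 / 6) l) 0 = 0 := by
    intro l
    rw [H3, ← hαβ, ha, hb]
    simp only [Pi.add_apply, Pi.smul_apply, smul_eq_mul]
    ring
  choose A Q P hA hQ hP hA0 hA' hP0 hQ0 hkey using fun l => scalar_key _ (hδ l) (H3' l)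
  let v : Fin 4 → Fin (4 + k) → ℝ := ![iteratedDeriv 1 γ 0,
    fun l => - iteratedDeriv 2 (fun r : ℝ => γ (r + a * r ^ 2 / 2 + b * r ^ 3 / 6) l) 0 / 2,
    fun l => iteratedDeriv 4 (fun r : ℝ => γ (r + a * r ^ 2 / 2 + b * r ^ 3 / 6) l) 0 / 3,
    fun l => iteratedDeriv 5 (fun r : ℝ => γ (r + a * r ^ 2 / 2 + b * r ^ 3 / 6) l) 0 / 30]
  have mem : ∀ i, v i ∈ Submodule.span ℝ (Set.range v) := fun i => Submodule.subset_span ⟨i, rfl⟩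
  have m1 : iteratedDeriv 1 γ 0 ∈ Submodule.span ℝ (Set.range v) := mem 0
  have m2 : iteratedDeriv 2 γ 0 ∈ Submodule.span ℝ (Set.range v) := by
    have : iteratedDeriv 2 γ 0 = (-2 : ℝ) • v 1 - a • iteratedDeriv 1 γ 0 := by
      funext l
      simp [v, H2]; ring
    rw [this]
    exact Submodule.sub_mem _ (Submodule.smul_mem _ _ (mem 1)) (Submodule.smul_mem _ _ m1)
  have m3 : iteratedDeriv 3 γ 0 ∈ Submodule.span ℝ (Set.range v) := by
    rw [← hαβ]
    exact Submodule.add_mem _ (Submodule.smul_mem _ _ m1) (Submodule.smul_mem _ _ m2)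
  have m4 : iteratedDeriv 4 γ 0 ∈ Submodule.span ℝ (Set.range v) := by
    have : iteratedDeriv 4 γ 0 = (3 : ℝ) • v 2 - (3 * a ^ 2 + 4 * b) • iteratedDeriv 2 γ 0
        - (6 * a) • iteratedDeriv 3 γ 0 := by
      funext l
      simp [v, H4]; ring
    rw [this]
    exact Submodule.sub_mem _ (Submodule.sub_mem _ (Submodule.smul_mem _ _ (mem 2))
      (Submodule.smul_mem _ _ m2)) (Submodule.smul_mem _ _ m3)
  have m5 : iteratedDeriv 5 γ 0 ∈ Submodule.span ℝ (Set.range v) := by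
    have : iteratedDeriv 5 γ 0 = (30 : ℝ) • v 3 - (10 * a * b) • iteratedDeriv 2 γ 0
        - (15 * a ^ 2 + 10 * b) • iteratedDeriv 3 γ 0 - (10 * a) • iteratedDeriv 4 γ 0 := by
      funext l
      simp [v, H5]; ring
    rw [this]
    exact Submodule.sub_mem _ (Submodule.sub_mem _ (Submodule.sub_mem _
      (Submodule.smul_mem _ _ (mem 3)) (Submodule.smul_mem _ _ m2))
      (Submodule.smul_mem _ _ m3)) (Submodule.smul_mem _ _ m4)
  obtain ⟨B, hB⟩ := exists_basis_ext v (indep_of_h5 _ _ _ _ _ h3 h5 v m1 m2 m4 m5)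
  let e : Fin 4 → Fin (4 + k) := Fin.castAdd k
  let τ : (Fin (4 + k) → ℝ) → Fin (4 + k) → ℝ := fun z l =>
    A l (z (e 0), z (e 1)) + z (e 2) * P l (z (e 0)) + z (e 3) * Q l (z (e 0), z (e 1))
      + ∑ j : Fin k, z (Fin.natAdd 4 j) * B (Fin.natAdd 4 j) l
  let σ : ℝ × ℝ → ℝ × ℝ := fun p => (p.2 * (1 + a * (p.1 - p.2) + b * (p.1 - p.2) ^ 2 / 2),
    (p.1 - p.2) + a * (p.1 - p.2) ^ 2 / 2 + b * (p.1 - p.2) ^ 3 / 6)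
  let S : (ℝ × ℝ) ≃L[ℝ] (ℝ × ℝ) := ContinuousLinearEquiv.equivOfInverse
    ((ContinuousLinearMap.snd ℝ ℝ ℝ).prod
      (ContinuousLinearMap.fst ℝ ℝ ℝ - ContinuousLinearMap.snd ℝ ℝ ℝ))
    ((ContinuousLinearMap.fst ℝ ℝ ℝ + ContinuousLinearMap.snd ℝ ℝ ℝ).prod
      (ContinuousLinearMap.fst ℝ ℝ ℝ)) (fun p => by simp) (fun p => by simp)
  have hn0 : nform (4 + k) 0 = 0 := by
    funext i; simp [nform]
  have hσ : ContDiff ℝ (⊤ : ℕ∞) σ := by fun_prop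
  have hτ : ContDiff ℝ (⊤ : ℕ∞) τ := by
    rw [contDiff_pi]
    intro l
    have := hA l
    have := hP l
    have := hQ l
    fun_prop
  refine GermEquiv.ofDerivs _ _ _ _ σ τ S B.equivFun.symm.toContinuousLinearEquiv hσ.contDiffAt
    hτ.contDiffAt ?_ ?_ (by simp [σ]) ?_
  · have f1 : HasFDerivAt (fun p : ℝ × ℝ => p.1) (ContinuousLinearMap.fst ℝ ℝ ℝ) 0 := hasFDerivAt_fst
    have f2 : HasFDerivAt (fun p : ℝ × ℝ => p.2) (ContinuousLinearMap.snd ℝ ℝ ℝ) 0 := hasFDerivAt_snd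
    have f3 := f1.sub f2
    have g1 : HasDerivAt (fun r : ℝ => 1 + a * r + b * r ^ 2 / 2) a ((0 : ℝ × ℝ).1 - (0 : ℝ × ℝ).2) := by
      have := (((hasDerivAt_id ((0 : ℝ × ℝ).1 - (0 : ℝ × ℝ).2)).const_mul a).const_add 1).add
        (((hasDerivAt_pow 2 ((0 : ℝ × ℝ).1 - (0 : ℝ × ℝ).2)).const_mul b).div_const 2)
      refine this.congr_deriv ?_
      simp
    have g2 : HasDerivAt (fun r : ℝ => r + a * r ^ 2 / 2 + b * r ^ 3 / 6) 1
        ((0 : ℝ × ℝ).1 - (0 : ℝ × ℝ).2) := by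
      have := ((hasDerivAt_id ((0 : ℝ × ℝ).1 - (0 : ℝ × ℝ).2)).add
        (((hasDerivAt_pow 2 ((0 : ℝ × ℝ).1 - (0 : ℝ × ℝ).2)).const_mul a).div_const 2)).add
        (((hasDerivAt_pow 3 ((0 : ℝ × ℝ).1 - (0 : ℝ × ℝ).2)).const_mul b).div_const 6)
      refine this.congr_deriv ?_
      simp
    have := (f2.mul (g1.comp_hasFDerivAt (0 : ℝ × ℝ) f3)).prodMk (g2.comp_hasFDerivAt (0 : ℝ × ℝ) f3)
    refine this.congr_fderiv ?_
    ext <;> simp [S]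
  · rw [hn0, hasFDerivAt_pi']
    intro l
    have pr : ∀ i : Fin (4 + k), HasFDerivAt (fun z : Fin (4 + k) → ℝ => z i)
        (ContinuousLinearMap.proj i : (Fin (4 + k) → ℝ) →L[ℝ] ℝ) 0 := fun i => hasFDerivAt_apply i 0
    have p01 := (pr (e 0)).prodMk (pr (e 1))
    have dA := HasFDerivAt.comp (0 : Fin (4 + k) → ℝ) (g := A l) (hA' l) p01
    have dP := HasFDerivAt.comp (0 : Fin (4 + k) → ℝ) (g := P l)
      ((hP l).differentiable (by simp) ((0 : Fin (4 + k) → ℝ) (e 0))).hasFDerivAt (pr (e 0))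
    have dQ := HasFDerivAt.comp (0 : Fin (4 + k) → ℝ) (g := Q l)
      ((hQ l).differentiable (by simp) ((0 : Fin (4 + k) → ℝ) (e 0), (0 : Fin (4 + k) → ℝ) (e 1))).hasFDerivAt p01
    have dS : HasFDerivAt (fun z : Fin (4 + k) → ℝ =>
        ∑ j : Fin k, z (Fin.natAdd 4 j) * B (Fin.natAdd 4 j) l) _ 0 :=
      HasFDerivAt.fun_sum (fun j _ => (pr (Fin.natAdd 4 j)).mul_const (B (Fin.natAdd 4 j) l))
    have := ((dA.add ((pr (e 2)).mul dP)).add ((pr (e 3)).mul dQ)).add dS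
    refine this.congr_fderiv ?_
    ext z
    have hQ0' : Q l (0, 0) = _ := hQ0 l
    simp [Module.Basis.equivFun_symm_apply, Fin.sum_univ_add, Fin.sum_univ_four, hB, hP0, hQ0', e, v, H1]
    simp only [mul_comm]
  · filter_upwards [eventually_all.2 hkey] with p hp
    funext l
    have q := hp l
    rw [H0 l] at q
    have dl : deriv γ = fun t l => deriv (fun t => γ t l) t := by
      funext t l
      have := iteratedDeriv_comp_pi γ hγ l 1 t
      rwa [iteratedDeriv_one, iteratedDeriv_one] at this
    have hz : ∀ j : Fin k, nform (4 + k) p (Fin.natAdd 4 j) = 0 := by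
      intro j
      have q1 : 4 + (j : ℕ) ≠ 1 := by omega
      have q2 : 4 + (j : ℕ) ≠ 2 := by omega
      have q3 : 4 + (j : ℕ) ≠ 3 := by omega
      simp [nform, q1, q2, q3]
    simp only [σ, τ, hz, zero_mul, Finset.sum_const_zero, dl]
    simp [nform, e]
    linarith


/-- In `ℝ^m`, `m ≥ 4`, the tangent variety to a finite-type curve `γ` of type
`(1,2,4,5,a₅,…,a_m)` at `0` is locally diffeomorphic to the open folded umbrella
`(u, x) ↦ (u, x² + ux, (1/2)x⁴ + (1/3)ux³, (2/5)x⁵ + (1/4)ux⁴, 0, …, 0)`. -/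
theorem tangent_variety_type_1245_open_folded_umbrella
    (m : ℕ) (hm : 4 ≤ m)
    (γ : ℝ → Fin m → ℝ) (hγ : ContDiff ℝ (⊤ : ℕ∞) γ)
    (hfin : Submodule.span ℝ
      (Set.range fun k : ℕ => iteratedDeriv (k + 1) γ 0) = (⊤ : Submodule ℝ (Fin m → ℝ)))
    (hind : LinearIndependent ℝ ![iteratedDeriv 1 γ 0, iteratedDeriv 2 γ 0])
    (h3 : iteratedDeriv 3 γ 0 ∈ Submodule.span ℝ
      ({iteratedDeriv 1 γ 0, iteratedDeriv 2 γ 0} : Set (Fin m → ℝ)))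
    (h4 : Module.finrank ℝ ↥(Submodule.span ℝ
      ({iteratedDeriv 1 γ 0, iteratedDeriv 2 γ 0, iteratedDeriv 3 γ 0,
        iteratedDeriv 4 γ 0} : Set (Fin m → ℝ))) = 3)
    (h5 : Module.finrank ℝ ↥(Submodule.span ℝ
      ({iteratedDeriv 1 γ 0, iteratedDeriv 2 γ 0, iteratedDeriv 3 γ 0,
        iteratedDeriv 4 γ 0, iteratedDeriv 5 γ 0} : Set (Fin m → ℝ))) = 4) :
    GermEquiv (fun p : ℝ × ℝ => γ p.2 + p.1 • deriv γ p.2) (0 : ℝ × ℝ)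
      (fun p : ℝ × ℝ => fun i : Fin m =>
        if (i : ℕ) = 0 then p.1
        else if (i : ℕ) = 1 then p.2 ^ 2 + p.1 * p.2
        else if (i : ℕ) = 2 then (1/2) * p.2 ^ 4 + (1/3) * p.1 * p.2 ^ 3
        else if (i : ℕ) = 3 then (2/5) * p.2 ^ 5 + (1/4) * p.1 * p.2 ^ 4
        else 0) (0 : ℝ × ℝ) := by
  obtain ⟨k, rfl⟩ := Nat.exists_eq_add_of_le hm
  exact ((nform_tan k γ hγ h3 h5).symm' (nform_contDiff _).continuous.continuousAt).trans'
    (nform_model _ hm)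
end
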